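/- Let K be a number field of degree [K:ℚ] ≥ 1 with Dedekind zeta function ζ_K, and let ε > 0 be fixed. Then there exists a constant C > 0 (depending only on ε and K) such that for each sufficiently large T there exists a Lebesgue measurable set E_T ⊆ [T, 2T] of Lebesgue measure λ(E_T) ≤ T^ε with the property that for all t ∈ [T, 2T] \ E_T one has |ζ_K(1 + it)|^{-1} ≤ C · log log T; in particular ζ_K(1+it) ≠ 0 for such t. -/

import Mathlib

open Complex Filter Asymptotics MeasureTheory

/-- `rK K n` is the number of nonzero integral ideals of the ring of integers of `K`
of absolute norm `n`. -/
noncomputable def rK (K : Type*) [Field K] [NumberField K] (n : ℕ) : ℕ :=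
  Nat.card {I : Ideal (NumberField.RingOfIntegers K) // Ideal.absNorm I = n ∧ I ≠ ⊥}

section LatticeCount

open NumberField NumberField.InfinitePlace NumberField.mixedEmbedding
  NumberField.mixedEmbedding.fundamentalCone NumberField.Units
  NumberField.Units.dirichletUnitTheorem
open scoped ENNReal

variable (K : Type*) [Field K] [NumberField K]

open scoped Classical in
/-- The thickening of `paramSet K` by `a` in every coordinate direction. -/
noncomputable def paramBox (a : ℝ) : Set (realSpace K) :=
  Set.univ.pi fun w ↦ if w = w₀ then Set.Iic a else Set.Ico (-a) (1 + a)

theorem paramBox_zero : paramBox K 0 = paramSet K := by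
  simp [paramBox, paramSet]

theorem measurableSet_paramBox (a : ℝ) : MeasurableSet (paramBox K a) := by
  refine MeasurableSet.univ_pi fun _ ↦ ?_
  split_ifs
  · exact measurableSet_Iic
  · exact measurableSet_Ico

variable {K} in
theorem mem_paramBox {a : ℝ} {x : realSpace K} :
    x ∈ paramBox K a ↔ x w₀ ≤ a ∧ ∀ w, w ≠ w₀ → -a ≤ x w ∧ x w < 1 + a := by
  classical
  simp only [paramBox, Set.mem_univ_pi]
  refine ⟨fun h ↦ ⟨by simpa using h w₀, fun w hw ↦ by simpa [hw] using h w⟩, fun h w ↦ ?_⟩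
  split_ifs with hw
  · exact hw ▸ h.1
  · exact h.2 w hw

theorem lintegral_paramBox {n : ℕ} (hn : 0 < n) (a : ℝ) (ha : 0 ≤ 1 + 2 * a) :
    ∫⁻ (x : realSpace K) in paramBox K a, .ofReal (Real.exp (x w₀ * n)) =
      ENNReal.ofReal (Real.exp (a * n) / n * (1 + 2 * a) ^ (Fintype.card (InfinitePlace K) - 1)) := by
  classical
  have hn : 0 < (n : ℝ) := Nat.cast_pos.mpr hn
  rw [volume_pi, paramBox, Measure.restrict_pi_pi, lintegral_eq_lmarginal_univ 0,
    lmarginal_erase' _ (by fun_prop) (Finset.mem_univ w₀), if_pos rfl]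
  have h1 : ∫⁻ x in Set.Iic a, ENNReal.ofReal (Real.exp (x * n)) =
      ENNReal.ofReal (Real.exp (a * n) / n) := by
    simp_rw [mul_comm _ (n : ℝ)]
    rw [← ofReal_integral_eq_lintegral_ofReal (integrableOn_exp_mul_Iic hn _),
      integral_exp_mul_Iic hn]
    filter_upwards with _ using Real.exp_nonneg _
  simp_rw [Function.update_self, h1, lmarginal, lintegral_const, Measure.pi_univ, if_neg
    (Finset.ne_of_mem_erase (Subtype.prop _)), Measure.restrict_apply_univ, Real.volume_Ico]
  rw [ENNReal.ofReal_mul (by positivity), Finset.prod_const, ENNReal.ofReal_pow ha]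
  congr 3
  · ring
  · rw [Finset.card_univ, Fintype.card_coe, Finset.card_erase_of_mem (Finset.mem_univ _),
      Finset.card_univ]

open scoped Classical in
/-- The constant relating the volume of a norm-invariant subset of the mixed space to an integral
over its parameters. -/
theorem exists_volume_preimage_expMapBasis_image :
    ∃ c : ℝ≥0∞, c ≠ ∞ ∧ ∀ s : Set (realSpace K), MeasurableSet s →
      volume (normAtAllPlaces ⁻¹' (expMapBasis '' s) : Set (mixedSpace K)) =
        c * ∫⁻ x in s, .ofReal (Real.exp (x w₀ * Module.finrank ℚ K)) := by
  classical
  refine ⟨2 ^ nrRealPlaces K * .ofReal (2 * Real.pi) ^ nrComplexPlaces K *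
    ((2 : ℝ≥0∞)⁻¹ ^ nrComplexPlaces K * ENNReal.ofReal (regulator K) * (Module.finrank ℚ K)),
    ?_, fun s hs ↦ ?_⟩
  · finiteness
  · have h₂ : MeasurableSet (normAtAllPlaces ⁻¹' (expMapBasis '' s) : Set (mixedSpace K)) := by
      refine MeasurableSet.preimage ?_ (continuous_normAtAllPlaces K).measurable
      exact hs.image_of_continuousOn_injOn (continuous_expMapBasis K).continuousOn
        (injective_expMapBasis K).injOn
    rw [volume_eq_two_pow_mul_two_pi_pow_mul_integral Set.preimage_image_preimage h₂,
      normAtAllPlaces_image_preimage_expMapBasis,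
      setLIntegral_expMapBasis_image hs (by fun_prop)]
    simp_rw [ENNReal.inv_mul_cancel_right
      (Finset.prod_ne_zero_iff.mpr fun _ _ ↦ ENNReal.ofReal_ne_zero_iff.mpr (expMapBasis_pos _ _))
      (ENNReal.prod_ne_top fun _ _ ↦ ENNReal.ofReal_ne_top)]
    ring

theorem paramBox_mono {a b : ℝ} (hab : a ≤ b) : paramBox K a ⊆ paramBox K b := fun x hx ↦ by
  rw [mem_paramBox] at hx ⊢
  exact ⟨hx.1.trans hab, fun w hw ↦ ⟨by linarith [(hx.2 w hw).1], by linarith [(hx.2 w hw).2]⟩⟩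

open scoped Classical in
theorem exists_volume_paramBox_diff_le :
    ∃ C : ℝ, 0 ≤ C ∧ ∀ h : ℝ, 0 ≤ h → h ≤ 1 / 2 →
      volume (normAtAllPlaces ⁻¹' (expMapBasis '' (paramBox K h \ paramBox K (-h))) :
        Set (mixedSpace K)) ≤ ENNReal.ofReal (C * h) := by
  obtain ⟨c, hc, hvol⟩ := exists_volume_preimage_expMapBasis_image K
  set n := Module.finrank ℚ K with hn
  have hn0 : 0 < n := Module.finrank_pos
  set r := Fintype.card (InfinitePlace K) - 1
  let f : ℝ → ℝ := fun a ↦ Real.exp (a * n) / n * (1 + 2 * a) ^ r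
  have hf : ContDiff ℝ 1 f := by fun_prop
  obtain ⟨L, hL⟩ := hf.contDiffOn.exists_lipschitzOnWith (s := Set.Icc (-1 : ℝ) 1) one_ne_zero
    (convex_Icc _ _) isCompact_Icc
  refine ⟨c.toReal * (2 * L), by positivity, fun h h0 h1 ↦ ?_⟩
  rw [hvol _ ((measurableSet_paramBox K h).diff (measurableSet_paramBox K (-h)))]
  have h2 : ∫⁻ (x : realSpace K) in paramBox K h \ paramBox K (-h),
      .ofReal (Real.exp (x w₀ * n)) ≤ ENNReal.ofReal (2 * L * h) := by
    have key := lintegral_union (μ := volume)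
      (f := fun x : realSpace K ↦ ENNReal.ofReal (Real.exp (x w₀ * n)))
      ((measurableSet_paramBox K h).diff (measurableSet_paramBox K (-h)))
      (Set.disjoint_sdiff_right (s := paramBox K (-h)))
    rw [Set.union_sdiff_cancel (paramBox_mono K (by linarith)),
      lintegral_paramBox K hn0 h (by linarith), lintegral_paramBox K hn0 (-h) (by linarith)] at key
    rw [ENNReal.eq_sub_of_add_eq ENNReal.ofReal_ne_top ((add_comm _ _).trans key.symm),
      ← ENNReal.ofReal_sub _ (mul_nonneg (by positivity) (pow_nonneg (by linarith) _))]
    refine ENNReal.ofReal_le_ofReal ?_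
    have := hL.dist_le_mul h ⟨by linarith, by linarith⟩ (-h) ⟨by linarith, by linarith⟩
    rw [Real.dist_eq, Real.dist_eq, sub_neg_eq_add, abs_of_nonneg (by linarith : 0 ≤ h + h)] at this
    linarith [le_abs_self (f h - f (-h))]
  calc _ ≤ c * ENNReal.ofReal (2 * L * h) := by gcongr
    _ = _ := by
      rw [mul_assoc c.toReal, ENNReal.ofReal_mul (p := c.toReal) (by positivity),
        ENNReal.ofReal_toReal hc]
end LatticeCount

section LatticeCount

open NumberField NumberField.InfinitePlace NumberField.mixedEmbedding
  NumberField.mixedEmbedding.fundamentalCone NumberField.Units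
  NumberField.Units.dirichletUnitTheorem
open scoped ENNReal

variable (K : Type*) [Field K] [NumberField K]

open scoped Classical in
theorem exists_mul_norm_le_normAtPlace :
    ∃ c : ℝ, 0 < c ∧ ∀ x ∈ normLeOne K, ∀ w, c * ‖x‖ ≤ normAtPlace w x := by
  classical
  let Q : Set (realSpace K) := Set.univ.pi fun w ↦ if w = w₀ then {0} else Set.Icc 0 1
  have hQ : IsCompact Q := isCompact_univ_pi fun w ↦ by
    split_ifs
    · exact isCompact_singleton
    · exact isCompact_Icc
  have hlow : ∀ w : InfinitePlace K, ∃ B : ℝ, ∀ y ∈ Q, (expMapBasis y w)⁻¹ ≤ B := fun w ↦ by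
    have hc : ContinuousOn (fun y : realSpace K ↦ (expMapBasis y w)⁻¹) Q :=
      (((continuous_apply w).comp (continuous_expMapBasis K)).inv₀
        fun y ↦ (expMapBasis_pos y w).ne').continuousOn
    obtain ⟨B, hB⟩ := (hQ.image_of_continuousOn hc).bddAbove
    exact ⟨B, fun y hy ↦ hB (Set.mem_image_of_mem _ hy)⟩
  have hupp : ∃ M : ℝ, ∀ y ∈ Q, ‖expMapBasis y‖ ≤ M := by
    obtain ⟨M, hM⟩ := (hQ.image_of_continuousOn
      (continuous_norm.comp (continuous_expMapBasis K)).continuousOn).bddAbove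
    exact ⟨M, fun y hy ↦ hM (Set.mem_image_of_mem _ hy)⟩
  choose B hB using hlow
  obtain ⟨M, hM⟩ := hupp
  set b := ∑ w, |B w| + 1
  have hb : 0 < b := by positivity
  have hM' : 0 < |M| + 1 := by positivity
  refine ⟨(b * (|M| + 1))⁻¹, by positivity, fun x hx w ↦ ?_⟩
  have hx' : normAtAllPlaces x ∈ expMapBasis '' paramSet K :=
    normAtAllPlaces_normLeOne_eq_image K ▸ Set.mem_image_of_mem _ hx
  obtain ⟨y, hy, hyx⟩ := hx'
  let y' : realSpace K := fun i ↦ if i = w₀ then 0 else y i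
  have hy' : y' ∈ Q := Set.mem_univ_pi.mpr fun i ↦ by
    have := (Set.mem_univ_pi.mp hy) i
    by_cases hi : i = w₀
    · simp [y', hi]
    · simp only [y', hi, if_false] at this ⊢
      exact ⟨this.1, this.2.le⟩
  have hval : ∀ v, normAtPlace v x = Real.exp (y w₀) * expMapBasis y' v := fun v ↦ by
    rw [← normAtAllPlaces_apply, ← hyx, expMapBasis_apply'']
    rfl
  have h1 : ‖x‖ ≤ Real.exp (y w₀) * (|M| + 1) := by
    rw [norm_eq_sup'_normAtPlace]
    refine Finset.sup'_le _ _ fun v _ ↦ ?_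
    rw [hval]
    gcongr
    calc _ ≤ ‖expMapBasis y'‖ := (le_abs_self _).trans (norm_le_pi_norm (expMapBasis y') v)
      _ ≤ M := hM y' hy'
      _ ≤ _ := by linarith [le_abs_self M]
  have h2 : 1 ≤ expMapBasis y' w * b := by
    have h3 := hB w y' hy'
    have h4 : B w ≤ b := by
      have := Finset.single_le_sum (f := fun w ↦ |B w|) (fun i _ ↦ abs_nonneg _)
        (Finset.mem_univ w)
      linarith [le_abs_self (B w)]
    have h5 := expMapBasis_pos y' w
    calc (1 : ℝ) = expMapBasis y' w * (expMapBasis y' w)⁻¹ := (mul_inv_cancel₀ h5.ne').symm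
      _ ≤ _ := by gcongr; exact h3.trans h4
  rw [hval, inv_mul_le_iff₀ (by positivity)]
  calc ‖x‖ ≤ Real.exp (y w₀) * (|M| + 1) * 1 := by rw [mul_one]; exact h1
    _ ≤ Real.exp (y w₀) * (|M| + 1) * (expMapBasis y' w * b) := by gcongr
    _ = _ := by ring

theorem abs_log_sub_log_le {m a b : ℝ} (hm : 0 < m) (ha : m ≤ a) (hb : m ≤ b) :
    |Real.log a - Real.log b| ≤ |a - b| / m := by
  have key : ∀ {a b : ℝ}, m ≤ a → m ≤ b → Real.log a - Real.log b ≤ |a - b| / m := by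
    intro a b ha hb
    have ha' := hm.trans_le ha
    have hb' := hm.trans_le hb
    rw [← Real.log_div ha'.ne' hb'.ne']
    refine (Real.log_le_sub_one_of_pos (by positivity)).trans ?_
    rw [div_sub_one hb'.ne']
    calc (a - b) / b ≤ |a - b| / b := by gcongr; exact le_abs_self _
      _ ≤ _ := by gcongr
  rw [abs_le]
  exact ⟨by have := key hb ha; rw [abs_sub_comm] at this; linarith, key ha hb⟩

theorem exists_abs_expMapBasis_symm_sub_le :
    ∃ Λ : ℝ, 0 < Λ ∧ ∀ m > 0, ∀ d : ℝ, ∀ p q : realSpace K, (∀ w, m ≤ p w) → (∀ w, m ≤ q w) →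
      (∀ w, |p w - q w| ≤ d) → ∀ w, |expMapBasis.symm p w - expMapBasis.symm q w| ≤ Λ * (d / m) := by
  refine ⟨‖((completeBasis K).equivFunL : realSpace K →L[ℝ] realSpace K)‖ * 2 + 1, by positivity,
    fun m hm d p q hp hq hd w ↦ ?_⟩
  have hd0 : 0 ≤ d := (abs_nonneg _).trans (hd w)
  have h1 : expMapBasis.symm p - expMapBasis.symm q =
      (completeBasis K).equivFunL (expMap.symm p - expMap.symm q) := by
    rw [map_sub]; rfl
  have h2 : ‖expMap.symm p - expMap.symm q‖ ≤ 2 * (d / m) := by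
    refine (pi_norm_le_iff_of_nonneg (by positivity)).mpr fun v ↦ ?_
    rw [Pi.sub_apply, expMap_symm_apply, expMap_symm_apply, ← mul_sub, norm_mul]
    have : ‖(v.mult : ℝ)‖ ≤ 2 := by
      rw [Real.norm_natCast]
      unfold InfinitePlace.mult
      split_ifs <;> norm_num
    gcongr
    exact (abs_log_sub_log_le hm (hp v) (hq v)).trans (by gcongr; exact hd v)
  rw [← Pi.sub_apply, h1]
  refine (norm_le_pi_norm ((completeBasis K).equivFunL (expMap.symm p - expMap.symm q)) w).trans ?_
  refine (((completeBasis K).equivFunL : realSpace K →L[ℝ] realSpace K).le_opNorm _).trans ?_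
  have : 0 ≤ d / m := by positivity
  calc _ ≤ ‖((completeBasis K).equivFunL : realSpace K →L[ℝ] realSpace K)‖ * (2 * (d / m)) := by
        gcongr
    _ ≤ _ := by nlinarith

end LatticeCount

section LatticeCount

open NumberField NumberField.InfinitePlace NumberField.mixedEmbedding
  NumberField.mixedEmbedding.fundamentalCone NumberField.Units
  NumberField.Units.dirichletUnitTheorem
open scoped ENNReal Pointwise

/-- The points at distance at most `r` from a point on the other side of the boundary of `S`. -/
def nearBoundary {V : Type*} [Norm V] [Sub V] (S : Set V) (r : ℝ) : Set V :=
  {y | ∃ x, ‖x - y‖ ≤ r ∧ ¬(x ∈ S ↔ y ∈ S)}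

variable (K : Type*) [Field K] [NumberField K]

theorem expMapBasis_target :
    (expMapBasis (K := K)).target = Set.univ.pi fun _ ↦ Set.Ioi 0 :=
  (Homeomorph.transOpenPartialHomeomorph_target _ _).trans (expMap_target K)

variable {K} in
theorem mem_normLeOne_iff_symm_mem_paramSet {x : mixedSpace K} (hx : ∀ w, 0 < normAtPlace w x) :
    x ∈ normLeOne K ↔ expMapBasis.symm (normAtAllPlaces x) ∈ paramSet K := by
  have ht : normAtAllPlaces x ∈ (expMapBasis (K := K)).target := by
    rw [expMapBasis_target]
    exact fun w _ ↦ hx w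
  rw [normLeOne_eq_preimage, Set.mem_preimage]
  refine ⟨?_, fun h ↦ ⟨_, h, expMapBasis.right_inv ht⟩⟩
  rintro ⟨y, hy, hyx⟩
  rwa [← hyx, expMapBasis.left_inv (by simp [expMapBasis_source])]

open scoped Classical in
theorem abs_normAtPlace_sub_le {x y : mixedSpace K} (w : InfinitePlace K) :
    |normAtPlace w x - normAtPlace w y| ≤ ‖x - y‖ := by
  have key : ∀ x y : mixedSpace K, normAtPlace w x - normAtPlace w y ≤ ‖x - y‖ := fun x y ↦ by
    have h1 := normAtPlace_add_le w (x - y) y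
    rw [sub_add_cancel] at h1
    have h2 : normAtPlace w (x - y) ≤ ‖x - y‖ := by
      rw [norm_eq_sup'_normAtPlace]
      exact Finset.le_sup' (fun w ↦ normAtPlace w (x - y)) (Finset.mem_univ w)
    linarith
  rw [abs_le]
  have := key y x
  rw [norm_sub_rev] at this
  exact ⟨by linarith, key x y⟩

theorem mem_paramSet_of_abs_sub_le {p q : realSpace K} {h : ℝ} (hp : p ∈ paramBox K (-h))
    (hpq : ∀ w, |p w - q w| ≤ h) : q ∈ paramSet K := by
  rw [← paramBox_zero, mem_paramBox]
  rw [mem_paramBox] at hp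
  refine ⟨by linarith [hp.1, (abs_le.mp (hpq w₀)).1], fun w hw ↦ ?_⟩
  have := abs_le.mp (hpq w)
  constructor <;> linarith [hp.2 w hw]

theorem mem_paramBox_of_abs_sub_le {p q : realSpace K} {h : ℝ} (hp : p ∈ paramSet K)
    (hpq : ∀ w, |p w - q w| ≤ h) : q ∈ paramBox K h := by
  rw [← paramBox_zero, mem_paramBox] at hp
  rw [mem_paramBox]
  refine ⟨by linarith [hp.1, (abs_le.mp (hpq w₀)).1], fun w hw ↦ ?_⟩
  have := abs_le.mp (hpq w)
  constructor <;> linarith [hp.2 w hw]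

open scoped Classical in
theorem exists_volume_nearBoundary_normLeOne_le :
    ∃ C : ℝ, 0 ≤ C ∧ ∃ r₀ > 0, ∀ r, 0 ≤ r → r ≤ r₀ →
      volume (nearBoundary (normLeOne K) r) ≤ ENNReal.ofReal (C * √r) := by
  obtain ⟨c, hc, hnorm⟩ := exists_mul_norm_le_normAtPlace K
  obtain ⟨Λ, hΛ, hlip⟩ := exists_abs_expMapBasis_symm_sub_le K
  obtain ⟨C, hC, hvol⟩ := exists_volume_paramBox_diff_le K
  set b := (volume (Metric.closedBall (0 : mixedSpace K) 1)).toReal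
  have hb : volume (Metric.closedBall (0 : mixedSpace K) 1) = ENNReal.ofReal b :=
    (ENNReal.ofReal_toReal measure_closedBall_lt_top.ne).symm
  set m := min (min (c / 2) (c / (4 * Λ))) (1 / 2) with hm
  have hm0 : 0 < m := by positivity
  refine ⟨2 * b + C * (2 * Λ / c), by positivity, m ^ 2, by positivity, fun r hr hr0 ↦ ?_⟩
  set ρ := √r with hρ
  have hρ0 : 0 ≤ ρ := Real.sqrt_nonneg r
  have hρr : ρ ^ 2 = r := Real.sq_sqrt hr
  have hρm : ρ ≤ m := by
    rw [hρ]
    exact Real.sqrt_le_iff.mpr ⟨hm0.le, hr0⟩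
  have hρ1 : ρ ≤ c / 2 := hρm.trans ((min_le_left _ _).trans (min_le_left _ _))
  have hρ2 : ρ ≤ c / (4 * Λ) := hρm.trans ((min_le_left _ _).trans (min_le_right _ _))
  have hρ3 : ρ ≤ 1 / 2 := hρm.trans (min_le_right _ _)
  set h := 2 * Λ / c * ρ with hh
  have hh0 : 0 ≤ h := by positivity
  have hh1 : h ≤ 1 / 2 := by
    calc h ≤ 2 * Λ / c * (c / (4 * Λ)) := mul_le_mul_of_nonneg_left hρ2 (by positivity)
      _ = 1 / 2 := by field_simp; norm_num
  have hparam : ∀ p q : mixedSpace K, p ∈ normLeOne K → q ∉ normLeOne K → ‖p - q‖ ≤ r →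
      ρ < ‖p‖ → (∀ w, 0 < normAtPlace w p) ∧ (∀ w, 0 < normAtPlace w q) ∧
        expMapBasis.symm (normAtAllPlaces p) ∈ paramBox K h \ paramBox K (-h) ∧
        expMapBasis.symm (normAtAllPlaces q) ∈ paramBox K h \ paramBox K (-h) := by
    intro p q hp hq hpq hpρ
    have hd : ∀ w, |normAtPlace w p - normAtPlace w q| ≤ r :=
      fun w ↦ (abs_normAtPlace_sub_le K w).trans hpq
    have hρpos : 0 < ρ := by
      refine hρ0.lt_of_ne fun h0 ↦ hq ?_
      have hr' : r = 0 := by rw [← hρr, ← h0]; norm_num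
      rw [hr'] at hpq
      rwa [← sub_eq_zero.mp (norm_le_zero_iff.mp hpq)]
    have hp1 : ∀ w, c * ρ ≤ normAtPlace w p := fun w ↦
      (mul_le_mul_of_nonneg_left hpρ.le hc.le).trans (hnorm p hp w)
    have hm1 : 0 < c * ρ / 2 := by positivity
    have hp2 : ∀ w, c * ρ / 2 ≤ normAtPlace w p := fun w ↦ by linarith [hp1 w]
    have hq2 : ∀ w, c * ρ / 2 ≤ normAtPlace w q := fun w ↦ by
      have h1 := abs_le.mp (hd w)
      have h2 : r ≤ c * ρ / 2 := by rw [← hρr]; nlinarith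
      linarith [hp1 w]
    have hsymm : ∀ w, |expMapBasis.symm (normAtAllPlaces p) w -
        expMapBasis.symm (normAtAllPlaces q) w| ≤ h := fun w ↦ by
      refine (hlip _ hm1 r _ _ hp2 hq2 hd w).trans (le_of_eq ?_)
      rw [hh, ← hρr]
      field_simp
    have hp0 := fun w ↦ hm1.trans_le (hp2 w)
    have hq0 := fun w ↦ hm1.trans_le (hq2 w)
    rw [mem_normLeOne_iff_symm_mem_paramSet hp0] at hp
    rw [mem_normLeOne_iff_symm_mem_paramSet hq0] at hq
    refine ⟨hp0, hq0, ⟨?_, fun hcon ↦ hq (mem_paramSet_of_abs_sub_le K hcon hsymm)⟩,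
      mem_paramBox_of_abs_sub_le K hp hsymm, fun hcon ↦ hq ?_⟩
    · rw [← paramBox_zero] at hp
      exact paramBox_mono K hh0 hp
    · rw [← paramBox_zero]
      exact paramBox_mono K (by linarith) hcon
  have hsub : nearBoundary (normLeOne K) r ⊆ Metric.closedBall 0 (2 * ρ) ∪
      normAtAllPlaces ⁻¹' (expMapBasis '' (paramBox K h \ paramBox K (-h))) := by
    have hrρ : r ≤ ρ := by rw [← hρr]; nlinarith
    have hmem : ∀ z : mixedSpace K, (∀ w, 0 < normAtPlace w z) →
        expMapBasis.symm (normAtAllPlaces z) ∈ paramBox K h \ paramBox K (-h) →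
        z ∈ normAtAllPlaces ⁻¹' (expMapBasis '' (paramBox K h \ paramBox K (-h))) :=
      fun z hz hz' ↦ ⟨_, hz', expMapBasis.right_inv (by
        rw [expMapBasis_target]; exact fun w _ ↦ hz w)⟩
    rintro y ⟨x, hxy, hiff⟩
    rw [Set.mem_union, mem_closedBall_zero_iff]
    by_cases hy : y ∈ normLeOne K
    · have hx : x ∉ normLeOne K := fun hx ↦ hiff (by simp [hx, hy])
      rcases le_or_gt ‖y‖ ρ with h1 | h1
      · left; linarith
      · right
        rw [norm_sub_rev] at hxy
        obtain ⟨h2, -, h3, -⟩ := hparam y x hy hx hxy h1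
        exact hmem y h2 h3
    · have hx : x ∈ normLeOne K := by_contra fun hx ↦ hiff (by simp [hx, hy])
      rcases le_or_gt ‖x‖ ρ with h1 | h1
      · left
        have := norm_sub_norm_le y x
        rw [norm_sub_rev] at this
        linarith
      · right
        obtain ⟨-, h2, -, h3⟩ := hparam x y hx hy hxy h1
        exact hmem y h2 h3
  calc _ ≤ volume (Metric.closedBall (0 : mixedSpace K) (2 * ρ)) +
        volume (normAtAllPlaces ⁻¹' (expMapBasis '' (paramBox K h \ paramBox K (-h))) :
          Set (mixedSpace K)) := (measure_mono hsub).trans (measure_union_le _ _)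
    _ ≤ ENNReal.ofReal (2 * b * ρ) + ENNReal.ofReal (C * h) := by
        gcongr
        · rw [Measure.addHaar_closedBall' _ _ (by positivity), hb, ← ENNReal.ofReal_mul (by positivity)]
          refine ENNReal.ofReal_le_ofReal ?_
          have : (2 * ρ) ^ Module.finrank ℝ (mixedSpace K) ≤ 2 * ρ :=
            pow_le_of_le_one (by positivity) (by linarith) Module.finrank_pos.ne'
          calc _ ≤ 2 * ρ * b := by gcongr
            _ = _ := by ring
        · exact hvol h hh0 hh1
    _ = _ := by
        rw [← ENNReal.ofReal_add (by positivity) (by positivity)]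
        congr 1
        rw [hh]; ring

end LatticeCount

section LatticeCount

open scoped ENNReal Pointwise
open Module

variable {V ι : Type*} [NormedAddCommGroup V] [NormedSpace ℝ V]

theorem nearBoundary_smul (S : Set V) (r : ℝ) {t : ℝ} (ht : 0 < t) :
    nearBoundary (t • S) r = t • nearBoundary S (r / t) := by
  ext y
  simp only [Set.mem_smul_set_iff_inv_smul_mem₀ ht.ne', nearBoundary, Set.mem_ofPred_eq]
  constructor
  · rintro ⟨x, hx, h⟩
    refine ⟨t⁻¹ • x, ?_, h⟩
    rw [← smul_sub, norm_smul, norm_inv, Real.norm_of_nonneg ht.le, inv_mul_eq_div]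
    gcongr
  · rintro ⟨x, hx, h⟩
    refine ⟨t • x, ?_, by rwa [inv_smul_smul₀ ht.ne']⟩
    have : t • x - y = t • (x - t⁻¹ • y) := by rw [smul_sub, smul_inv_smul₀ ht.ne']
    rw [this, norm_smul, Real.norm_of_nonneg ht.le]
    calc t * ‖x - t⁻¹ • y‖ ≤ t * (r / t) := by gcongr
      _ = r := by field_simp

variable [Finite ι] [MeasurableSpace V] [BorelSpace V] (μ : Measure V) (b : Basis ι ℝ V)

section

variable [μ.IsAddLeftInvariant]

theorem card_inter_span_mul_measure_le_and {S : Set V} (hS : Bornology.IsBounded S) {D : ℝ}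
    (hD : ∀ f ∈ ZSpan.fundamentalDomain b, ‖f‖ ≤ D) :
    (Nat.card ↑(S ∩ Submodule.span ℤ (Set.range b)) : ℝ≥0∞) * μ (ZSpan.fundamentalDomain b) ≤
        μ S + μ (nearBoundary S D) ∧
      μ S ≤ (Nat.card ↑(S ∩ Submodule.span ℤ (Set.range b)) : ℝ≥0∞) *
        μ (ZSpan.fundamentalDomain b) + μ (nearBoundary S D) := by
  classical
  have : FiniteDimensional ℝ V := b.finiteDimensional_of_finite
  have : ProperSpace V := FiniteDimensional.proper_real V
  have := Fintype.ofFinite ι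
  set F := ZSpan.fundamentalDomain b with hF
  have hfin : (S ∩ Submodule.span ℤ (Set.range b) : Set V).Finite := ZSpan.setFinite_inter b hS
  have hU : μ (⋃ v ∈ hfin.toFinset, v +ᵥ F) =
      (Nat.card ↑(S ∩ Submodule.span ℤ (Set.range b)) : ℝ≥0∞) * μ F := by
    rw [measure_biUnion_finset]
    · simp_rw [measure_vadd, Finset.sum_const, nsmul_eq_mul]
      rw [Nat.card_eq_card_finite_toFinset hfin]
    · intro v hv w hw hvw
      rw [Finset.mem_coe, Set.Finite.mem_toFinset] at hv hw
      refine Set.disjoint_left.mpr fun y hy hy' ↦ hvw ?_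
      rw [Set.mem_vadd_set_iff_neg_vadd_mem, vadd_eq_add] at hy hy'
      have h1 := ZSpan.fract_eq_self.mpr hy
      have h2 := ZSpan.fract_eq_self.mpr hy'
      rw [ZSpan.fract_zSpan_add b y (neg_mem hv.2)] at h1
      rw [ZSpan.fract_zSpan_add b y (neg_mem hw.2)] at h2
      simpa using h1.symm.trans h2
    · exact fun v _ ↦ (ZSpan.fundamentalDomain_measurableSet b).const_vadd v
  rw [← hU]
  constructor
  · refine (measure_mono fun y hy ↦ ?_).trans (measure_union_le _ _)
    simp only [Set.mem_iUnion, Set.Finite.mem_toFinset, exists_prop] at hy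
    obtain ⟨v, hv, hy⟩ := hy
    obtain ⟨f, hf, rfl⟩ := hy
    by_cases hyS : v +ᵥ f ∈ S
    · exact Or.inl hyS
    · refine Or.inr ⟨v, ?_, fun h ↦ hyS (h.mp hv.1)⟩
      simpa using hD f hf
  · refine (measure_mono fun y hy ↦ ?_).trans (measure_union_le _ _)
    by_cases hv : (ZSpan.floor b y : V) ∈ S
    · left
      simp only [Set.mem_iUnion, Set.Finite.mem_toFinset, exists_prop]
      refine ⟨ZSpan.floor b y, ⟨hv, (ZSpan.floor b y).2⟩, ZSpan.fract b y,
        ZSpan.fract_mem_fundamentalDomain b y, ?_⟩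
      simp [ZSpan.fract_apply]
    · refine Or.inr ⟨ZSpan.floor b y, ?_, fun h ↦ hv (h.mpr hy)⟩
      rw [norm_sub_rev, ← ZSpan.fract_apply]
      exact hD _ (ZSpan.fract_mem_fundamentalDomain b y)

end

theorem exists_abs_card_smul_inter_span_sub_le [μ.IsAddHaarMeasure] [Nontrivial V] {S : Set V}
    (hS : Bornology.IsBounded S) {C r₀ : ℝ} (hC : 0 ≤ C) (hr₀ : 0 < r₀)
    (hb : ∀ r, 0 ≤ r → r ≤ r₀ → μ (nearBoundary S r) ≤ ENNReal.ofReal (C * √r)) :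
    ∃ a ≥ 0, ∃ C' ≥ 0, ∃ t₀ > 0, ∀ t ≥ t₀,
      |(Nat.card ↑((t • S) ∩ (Submodule.span ℤ (Set.range b) : Set V)) : ℝ) -
        a * t ^ finrank ℝ V| ≤ C' * (t ^ finrank ℝ V / √t) := by
  have : FiniteDimensional ℝ V := b.finiteDimensional_of_finite
  have : ProperSpace V := FiniteDimensional.proper_real V
  have := Fintype.ofFinite ι
  obtain ⟨D', hD'⟩ := (ZSpan.fundamentalDomain_isBounded b).exists_norm_le
  set D := |D'| + 1
  have hD : ∀ f ∈ ZSpan.fundamentalDomain b, ‖f‖ ≤ D := fun f hf ↦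
    (hD' f hf).trans (by linarith [le_abs_self D'])
  have hD0 : 0 < D := by positivity
  set F := ZSpan.fundamentalDomain b
  set n := finrank ℝ V
  have hFtop : μ F ≠ ∞ := (ZSpan.fundamentalDomain_isBounded b).measure_lt_top.ne
  have hF0 : 0 < (μ F).toReal :=
    ENNReal.toReal_pos (ZSpan.measure_fundamentalDomain_ne_zero b) hFtop
  have hStop : μ S ≠ ∞ := hS.measure_lt_top.ne
  refine ⟨(μ S).toReal / (μ F).toReal, by positivity, C * √D / (μ F).toReal, by positivity,
    D / r₀, by positivity, fun t ht ↦ ?_⟩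
  have ht0 : 0 < t := lt_of_lt_of_le (by positivity) ht
  obtain ⟨h1, h2⟩ := card_inter_span_mul_measure_le_and μ b (hS.smul₀ t) hD
  rw [nearBoundary_smul S D ht0, Measure.addHaar_smul_of_nonneg μ ht0.le,
    Measure.addHaar_smul_of_nonneg μ ht0.le] at h1 h2
  set N := Nat.card ↑((t • S) ∩ (Submodule.span ℤ (Set.range b) : Set V))
  set B := ENNReal.ofReal (t ^ n) * μ (nearBoundary S (D / t)) with hBdef
  have hB : B ≤ ENNReal.ofReal (t ^ n * (C * √(D / t))) := by
    rw [hBdef, ENNReal.ofReal_mul (by positivity)]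
    gcongr
    exact hb _ (by positivity) (by rw [div_le_comm₀ ht0 hr₀]; exact ht)
  have hB' : B.toReal ≤ t ^ n * (C * √(D / t)) := ENNReal.toReal_le_of_le_ofReal (by positivity) hB
  have hBtop : B ≠ ∞ := ne_top_of_le_ne_top ENNReal.ofReal_ne_top hB
  have hSt : ENNReal.ofReal (t ^ n) * μ S ≠ ∞ := ENNReal.mul_ne_top ENNReal.ofReal_ne_top hStop
  have hNF : (N : ℝ≥0∞) * μ F ≠ ∞ := ENNReal.mul_ne_top (ENNReal.natCast_ne_top N) hFtop
  have h1' := ENNReal.toReal_mono (ENNReal.add_ne_top.mpr ⟨hSt, hBtop⟩) h1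
  have h2' := ENNReal.toReal_mono (ENNReal.add_ne_top.mpr ⟨hNF, hBtop⟩) h2
  rw [ENNReal.toReal_add hSt hBtop, ENNReal.toReal_mul, ENNReal.toReal_mul,
    ENNReal.toReal_ofReal (by positivity), ENNReal.toReal_natCast] at h1'
  rw [ENNReal.toReal_add hNF hBtop, ENNReal.toReal_mul, ENNReal.toReal_mul,
    ENNReal.toReal_ofReal (by positivity), ENNReal.toReal_natCast] at h2'
  have h3 : (N : ℝ) - (μ S).toReal / (μ F).toReal * t ^ n =
      (N * (μ F).toReal - t ^ n * (μ S).toReal) / (μ F).toReal := by field_simp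
  have h4 : C * √D / (μ F).toReal * (t ^ n / √t) = t ^ n * (C * √(D / t)) / (μ F).toReal := by
    rw [Real.sqrt_div hD0.le]
    field_simp
  rw [h3, h4, abs_div, abs_of_pos hF0]
  gcongr
  rw [abs_le]
  constructor <;> linarith

end LatticeCount

section IdealCount

open NumberField NumberField.InfinitePlace NumberField.mixedEmbedding
  NumberField.mixedEmbedding.fundamentalCone NumberField.Units
open scoped ENNReal Pointwise nonZeroDivisors

variable (K : Type*) [Field K] [NumberField K]

theorem card_norm_le_and_mk_eq {C : ClassGroup (𝓞 K)} {J : (Ideal (𝓞 K))⁰} {s : ℝ}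
    (hJ : ClassGroup.mk0 J = C⁻¹) :
    Nat.card {I : (Ideal (𝓞 K))⁰ //
        Ideal.absNorm (I : Ideal (𝓞 K)) ≤ s ∧ ClassGroup.mk0 I = C} =
      Nat.card {I : (Ideal (𝓞 K))⁰ // (J : Ideal (𝓞 K)) ∣ I ∧
        Submodule.IsPrincipal (I : Ideal (𝓞 K)) ∧
        Ideal.absNorm (I : Ideal (𝓞 K)) ≤ s * Ideal.absNorm (J : Ideal (𝓞 K))} := by
  simp_rw [← nonZeroDivisors_dvd_iff_dvd_coe]
  refine Nat.card_congr ?_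
  refine ((Equiv.dvd J).subtypeEquiv fun I ↦ ?_).trans
    (Equiv.subtypeSubtypeEquivSubtypeInter (fun I : (Ideal (𝓞 K))⁰ ↦ J ∣ I) _)
  rw [← ClassGroup.mk0_eq_one_iff (SetLike.coe_mem _)]
  simp_rw [Equiv.dvd_apply, Submonoid.coe_mul, ← Submonoid.mul_def, _root_.map_mul, hJ,
    inv_mul_eq_one, Nat.cast_mul, mul_comm s, eq_comm, and_comm, and_congr_left_iff]
  exact fun _ ↦ (mul_le_mul_iff_of_pos_left
    (Nat.cast_pos.mpr (Ideal.absNorm_pos_of_nonZeroDivisors J))).symm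

open scoped Classical in
theorem card_idealSet_norm_le_pow (J : (Ideal (𝓞 K))⁰) {t : ℝ} (ht : 0 < t) :
    Nat.card {a : idealSet K J //
        mixedEmbedding.norm (a : mixedSpace K) ≤ t ^ Module.finrank ℚ K} =
      Nat.card ↑((t • normLeOne K) ∩ (Submodule.span ℤ
        (Set.range (fractionalIdealLatticeBasis K (FractionalIdeal.mk0 K J))) :
          Set (mixedSpace K))) := by
  refine Nat.card_congr ((Equiv.subtypeSubtypeEquivSubtypeInter (· ∈ idealSet K J)
    (mixedEmbedding.norm · ≤ t ^ Module.finrank ℚ K)).trans (Equiv.subtypeEquivProp ?_))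
  ext x
  rw [Set.mem_inter_iff, Set.mem_smul_set_iff_inv_smul_mem₀ ht.ne', span_idealLatticeBasis,
    idealSet, Set.mem_inter_iff]
  have h1 : mixedEmbedding.norm (t⁻¹ • x) ≤ 1 ↔
      mixedEmbedding.norm x ≤ t ^ Module.finrank ℚ K := by
    rw [mixedEmbedding.norm_smul, abs_of_pos (by positivity), inv_pow,
      inv_mul_le_iff₀ (by positivity), mul_one]
  have h2 : t⁻¹ • x ∈ normLeOne K ↔
      x ∈ fundamentalCone K ∧ mixedEmbedding.norm x ≤ t ^ Module.finrank ℚ K := by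
    rw [mem_normLeOne, smul_mem_iff_mem (inv_ne_zero ht.ne'), h1]
  rw [h2]
  tauto

theorem exists_abs_card_class_sub_le (C : ClassGroup (𝓞 K)) :
    ∃ a ≥ 0, ∃ B ≥ 0, ∃ s₀ ≥ 1, ∀ s : ℝ, s₀ ≤ s →
      |(Nat.card {I : (Ideal (𝓞 K))⁰ //
        Ideal.absNorm (I : Ideal (𝓞 K)) ≤ s ∧ ClassGroup.mk0 I = C} : ℝ) - a * s| ≤
          B * s ^ (1 - 1 / (2 * (Module.finrank ℚ K : ℝ))) := by
  classical
  obtain ⟨J, hJ⟩ := ClassGroup.mk0_surjective C⁻¹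
  obtain ⟨D, hD, r₀, hr₀, hbd⟩ := exists_volume_nearBoundary_normLeOne_le K
  obtain ⟨a, ha, B, hB, t₀, ht₀, hcount⟩ := exists_abs_card_smul_inter_span_sub_le volume
    (fractionalIdealLatticeBasis K (FractionalIdeal.mk0 K J)) (isBounded_normLeOne K) hD hr₀ hbd
  rw [mixedEmbedding.finrank] at hcount
  set n := Module.finrank ℚ K with hn
  have hn0 : 0 < n := Module.finrank_pos
  have hn0' : (0 : ℝ) < n := Nat.cast_pos.mpr hn0
  have hN : 0 < Ideal.absNorm (J : Ideal (𝓞 K)) := Ideal.absNorm_pos_of_nonZeroDivisors J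
  set N : ℝ := ((Ideal.absNorm (J : Ideal (𝓞 K)) : ℕ) : ℝ) with hNdef
  have hN1 : 1 ≤ N := Nat.one_le_cast.mpr hN
  have hw : 0 < torsionOrder K := Nat.pos_of_ne_zero (torsionOrder_ne_zero K)
  set w : ℝ := (torsionOrder K : ℝ) with hwdef
  have hw0 : 0 < w := Nat.cast_pos.mpr hw
  refine ⟨a * N / w, by positivity, B * N / w, by positivity, max 1 (t₀ ^ n), le_max_left _ _,
    fun s hs ↦ ?_⟩
  have hs1 : 1 ≤ s := (le_max_left _ _).trans hs
  have hs0 : 0 < s := by linarith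
  set t := (s * N) ^ (1 / (n : ℝ)) with ht
  have htn : t ^ n = s * N := by
    rw [ht, ← Real.rpow_natCast, ← Real.rpow_mul (by positivity), one_div_mul_cancel hn0'.ne',
      Real.rpow_one]
  have htpos : 0 < t := by positivity
  have htt : t₀ ≤ t := by
    refine le_of_pow_le_pow_left₀ hn0.ne' htpos.le ?_
    rw [htn]
    calc t₀ ^ n ≤ s := (le_max_right _ _).trans hs
      _ ≤ s * N := le_mul_of_one_le_right hs0.le hN1
  have hsqrt : t ^ n / √t = (s * N) ^ (1 - 1 / (2 * (n : ℝ))) := by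
    rw [htn, Real.rpow_sub (by positivity), Real.rpow_one, Real.sqrt_eq_rpow, ht,
      ← Real.rpow_mul (by positivity)]
    congr 2
    field_simp
  have h := hcount t htt
  rw [← card_idealSet_norm_le_pow K J htpos, hsqrt, ← hn, htn, ← card_isPrincipal_dvd_norm_le,
    ← card_norm_le_and_mk_eq K hJ, Nat.cast_mul] at h
  set M : ℝ := (Nat.card {I : (Ideal (𝓞 K))⁰ //
        Ideal.absNorm (I : Ideal (𝓞 K)) ≤ s ∧ ClassGroup.mk0 I = C} : ℝ)
  have h1 : M - a * N / w * s = (M * w - a * (s * N)) / w := by field_simp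
  rw [h1, abs_div, abs_of_pos hw0, div_le_iff₀ hw0]
  refine h.trans ?_
  have h2 : N ^ (1 - 1 / (2 * (n : ℝ))) ≤ N := by
    conv_rhs => rw [← Real.rpow_one N]
    refine Real.rpow_le_rpow_of_exponent_le hN1 ?_
    have : 0 ≤ 1 / (2 * (n : ℝ)) := by positivity
    linarith
  rw [Real.mul_rpow hs0.le (by positivity)]
  calc _ ≤ B * (s ^ (1 - 1 / (2 * (n : ℝ))) * N) := by gcongr
    _ = _ := by field_simp

theorem finite_setOf_absNorm_le (s : ℝ) :
    Finite {I : (Ideal (𝓞 K))⁰ // Ideal.absNorm (I : Ideal (𝓞 K)) ≤ s} := by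
  rcases lt_or_ge s 0 with hs | hs
  · have : IsEmpty {I : (Ideal (𝓞 K))⁰ // Ideal.absNorm (I : Ideal (𝓞 K)) ≤ s} :=
      ⟨fun I ↦ by linarith [I.2, Nat.cast_nonneg (α := ℝ) (Ideal.absNorm (I.1 : Ideal (𝓞 K)))]⟩
    infer_instance
  · simp_rw [← Nat.le_floor_iff hs]
    exact Ideal.finite_setOfPred_absNorm_le₀ ⌊s⌋₊

theorem card_norm_le_eq_sum_class (s : ℝ) :
    Nat.card {I : (Ideal (𝓞 K))⁰ // Ideal.absNorm (I : Ideal (𝓞 K)) ≤ s} =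
      ∑ C : ClassGroup (𝓞 K), Nat.card {I : (Ideal (𝓞 K))⁰ //
        Ideal.absNorm (I : Ideal (𝓞 K)) ≤ s ∧ ClassGroup.mk0 I = C} := by
  classical
  have := finite_setOf_absNorm_le K s
  have := Fintype.ofFinite {I : (Ideal (𝓞 K))⁰ // Ideal.absNorm (I : Ideal (𝓞 K)) ≤ s}
  let e := fun C : ClassGroup (𝓞 K) ↦ Equiv.subtypeSubtypeEquivSubtypeInter
    (fun I : (Ideal (𝓞 K))⁰ ↦ Ideal.absNorm I.1 ≤ s) (fun I ↦ ClassGroup.mk0 I = C)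
  simp_rw [← Nat.card_congr (e _), Nat.card_eq_fintype_card, Fintype.subtype_card]
  rw [Fintype.card, Finset.card_eq_sum_card_fiberwise (f := fun I ↦ ClassGroup.mk0 I.1)
    (t := Finset.univ) (fun _ _ ↦ Finset.mem_univ _)]

theorem rK_eq_card (n : ℕ) :
    rK K n = Nat.card {I : (Ideal (𝓞 K))⁰ // Ideal.absNorm (I : Ideal (𝓞 K)) = n} := by
  refine Nat.card_congr ?_
  refine (Equiv.subtypeEquivRight fun I ↦ ?_).trans
    (Equiv.subtypeSubtypeEquivSubtypeInter (fun I : Ideal (𝓞 K) ↦ I ∈ (Ideal (𝓞 K))⁰)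
      (fun I ↦ Ideal.absNorm I = n)).symm
  rw [and_comm, mem_nonZeroDivisors_iff_ne_zero, Submodule.zero_eq_bot]

theorem sum_rK_eq_card {s : ℝ} (hs : 0 ≤ s) :
    ∑ k ∈ Finset.Icc 1 ⌊s⌋₊, rK K k =
      Nat.card {I : (Ideal (𝓞 K))⁰ // Ideal.absNorm (I : Ideal (𝓞 K)) ≤ s} := by
  classical
  have := finite_setOf_absNorm_le K s
  have := Fintype.ofFinite {I : (Ideal (𝓞 K))⁰ // Ideal.absNorm (I : Ideal (𝓞 K)) ≤ s}
  rw [Nat.card_eq_fintype_card, Fintype.card, Finset.card_eq_sum_card_fiberwise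
    (f := fun I ↦ Ideal.absNorm (I.1 : Ideal (𝓞 K))) (t := Finset.Icc 1 ⌊s⌋₊)]
  · refine Finset.sum_congr rfl fun k hk ↦ ?_
    rw [rK_eq_card, ← Fintype.card_subtype, ← Nat.card_eq_fintype_card]
    refine Nat.card_congr (Equiv.trans (Equiv.subtypeEquivRight fun I ↦ ?_)
      (Equiv.subtypeSubtypeEquivSubtypeInter (fun I : (Ideal (𝓞 K))⁰ ↦
        (Ideal.absNorm (I : Ideal (𝓞 K)) : ℝ) ≤ s)
        (fun I ↦ Ideal.absNorm (I : Ideal (𝓞 K)) = k)).symm)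
    have hk' := (Nat.le_floor_iff hs).mp (Finset.mem_Icc.mp hk).2
    exact ⟨fun h ↦ ⟨h ▸ hk', h⟩, fun h ↦ h.2⟩
  · intro I _
    rw [Finset.coe_Icc, Set.mem_Icc]
    exact ⟨Ideal.absNorm_pos_of_nonZeroDivisors I.1, Nat.le_floor I.2⟩

end IdealCount

section IdealCount

open NumberField
open scoped nonZeroDivisors Topology

variable (K : Type*) [Field K] [NumberField K]

theorem exists_abs_sum_rK_sub_le :
    ∃ κ > (0 : ℝ), ∃ δ > (0 : ℝ), δ ≤ 1 / 2 ∧ ∃ C ≥ 0, ∀ x : ℝ, 1 ≤ x →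
      |∑ k ∈ Finset.Icc 1 ⌊x⌋₊, (rK K k : ℝ) - κ * x| ≤ C * x ^ (1 - δ) := by
  set n := Module.finrank ℚ K with hn
  have hn0 : 0 < n := Module.finrank_pos
  have hn1 : (1 : ℝ) ≤ n := Nat.one_le_cast.mpr hn0
  choose a ha B hB s hs hcount using exists_abs_card_class_sub_le K
  set δ : ℝ := 1 / (2 * n) with hδ
  have hδ0 : 0 < δ := by positivity
  have hδ1 : δ ≤ 1 / 2 := by
    rw [hδ]
    gcongr
    linarith
  set A : ℝ → ℝ := fun x ↦ ∑ k ∈ Finset.Icc 1 ⌊x⌋₊, (rK K k : ℝ) with hA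
  have hAcard : ∀ x, 0 ≤ x → A x = Nat.card {I : (Ideal (𝓞 K))⁰ //
      Ideal.absNorm (I : Ideal (𝓞 K)) ≤ x} := fun x hx ↦ by
    rw [hA, ← sum_rK_eq_card K hx, Nat.cast_sum]
  have hAmono : Monotone A := fun x y hxy ↦
    Finset.sum_le_sum_of_subset_of_nonneg
      (Finset.Icc_subset_Icc_right (Nat.floor_mono hxy)) fun _ _ _ ↦ Nat.cast_nonneg _
  have hA0 : ∀ x, 0 ≤ A x := fun x ↦ Finset.sum_nonneg fun _ _ ↦ Nat.cast_nonneg _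
  set κ := ∑ c, a c with hκ
  have hκ0 : 0 ≤ κ := Finset.sum_nonneg fun c _ ↦ ha c
  set S := ∑ c, s c
  have hsS : ∀ c, s c ≤ S := fun c ↦ Finset.single_le_sum
    (f := s) (fun c _ ↦ zero_le_one.trans (hs c)) (Finset.mem_univ c)
  set D := ∑ c, B c
  have hD : 0 ≤ D := Finset.sum_nonneg fun c _ ↦ hB c
  have hlarge : ∀ x, S ≤ x → 0 ≤ x → |A x - κ * x| ≤ D * x ^ (1 - δ) := fun x hx hx0 ↦ by
    rw [hAcard x hx0, card_norm_le_eq_sum_class, Nat.cast_sum, hκ, Finset.sum_mul,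
      ← Finset.sum_sub_distrib, Finset.sum_mul]
    refine (Finset.abs_sum_le_sum_abs _ _).trans (Finset.sum_le_sum fun c _ ↦ ?_)
    exact hcount c x ((hsS c).trans hx)
  have hall : ∀ x, 1 ≤ x → |A x - κ * x| ≤ (D + A S + κ * |S|) * x ^ (1 - δ) := fun x hx ↦ by
    have hx1 : 1 ≤ x ^ (1 - δ) := Real.one_le_rpow hx (by linarith)
    have hAS := hA0 S
    rcases le_or_gt S x with h | h
    · refine (hlarge x h (by linarith)).trans ?_
      gcongr
      linarith [mul_nonneg hκ0 (abs_nonneg S)]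
    · have h1 : A x ≤ A S := hAmono h.le
      have h2 : κ * x ≤ κ * |S| := by gcongr; exact h.le.trans (le_abs_self S)
      have h3 := hA0 x
      have h4 : 0 ≤ κ * x := by positivity
      calc |A x - κ * x| ≤ A S + κ * |S| := abs_le.mpr ⟨by linarith, by linarith⟩
        _ ≤ (D + A S + κ * |S|) * 1 := by linarith
        _ ≤ _ := by gcongr
  refine ⟨κ, ?_, δ, hδ0, hδ1, D + A S + κ * |S|,
    by linarith [hA0 S, mul_nonneg hκ0 (abs_nonneg S)], hall⟩
  have h1 : Tendsto (fun x ↦ A x / x) atTop (𝓝 κ) := by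
    have h2 : Tendsto (fun x : ℝ ↦ (D + A S + κ * |S|) * x ^ (-δ)) atTop (𝓝 0) := by
      simpa using (tendsto_rpow_neg_atTop hδ0).const_mul (D + A S + κ * |S|)
    rw [tendsto_iff_norm_sub_tendsto_zero]
    refine squeeze_zero' (Eventually.of_forall fun _ ↦ norm_nonneg _) ?_ h2
    filter_upwards [eventually_ge_atTop 1] with x hx
    have hx0 : 0 < x := by linarith
    have h3 : A x / x - κ = (A x - κ * x) / x := by field_simp
    rw [h3, norm_div, Real.norm_eq_abs, Real.norm_of_nonneg hx0.le, div_le_iff₀ hx0, mul_assoc]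
    refine (hall x hx).trans (le_of_eq ?_)
    congr 1
    conv_rhs => rw [mul_comm, ← Real.rpow_one_add' hx0.le (by linarith)]
    rw [sub_eq_add_neg]
  have h2 := NumberField.Ideal.tendsto_norm_le_div_atTop₀ K
  have h3 : κ = _ := tendsto_nhds_unique h1 (h2.congr' (by
    filter_upwards [eventually_ge_atTop 0] with x hx
    rw [hAcard x hx]))
  rw [h3]
  exact NumberField.dedekindZeta_residue_pos K

end IdealCount

section MultisetSums

variable {α : Type*} [DecidableEq α]

/-- The Möbius function of the lattice of finite multisets. -/
def multisetMoebius (s : Multiset α) : ℝ := if s.Nodup then (-1) ^ Multiset.card s else 0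

theorem abs_multisetMoebius_le (s : Multiset α) : |multisetMoebius s| ≤ 1 := by
  unfold multisetMoebius
  split_ifs <;> simp

theorem sum_multisetMoebius_Iic (t : Multiset α) :
    ∑ s ∈ Finset.Iic t, multisetMoebius s = if t = 0 then 1 else 0 := by
  unfold multisetMoebius
  rw [← Finset.sum_filter]
  have h := Finset.sum_powerset_neg_one_pow_card (x := t.toFinset)
  simp only [Multiset.toFinset_eq_empty] at h
  rw [← Int.cast_inj (α := ℝ)] at h
  push_cast at h
  rw [← h]
  symm
  refine Finset.sum_bij (fun F _ ↦ F.val) ?_ ?_ ?_ ?_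
  · intro F hF
    rw [Finset.mem_filter, Finset.mem_Iic]
    exact ⟨(Finset.val_le_iff_val_subset.mpr (Finset.mem_powerset.mp hF)).trans
      (Multiset.dedup_le t), F.nodup⟩
  · exact fun F _ G _ h ↦ Finset.val_injective h
  · intro s hs
    rw [Finset.mem_filter, Finset.mem_Iic] at hs
    refine ⟨⟨s, hs.2⟩, ?_, rfl⟩
    rw [Finset.mem_powerset]
    exact fun a ha ↦ Multiset.mem_toFinset.mpr (Multiset.mem_of_le hs.1 ha)
  · exact fun _ _ ↦ rfl

/-- The von Mangoldt function of the lattice of finite multisets with weights `w`. -/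
def multisetVonMangoldt (w : α → ℝ) (s : Multiset α) : ℝ :=
  ∑ p ∈ s.toFinset with s = Multiset.replicate (Multiset.card s) p, w p

theorem multisetVonMangoldt_nonneg {w : α → ℝ} {s : Multiset α} (hw : ∀ p ∈ s, 0 ≤ w p) :
    0 ≤ multisetVonMangoldt w s :=
  Finset.sum_nonneg fun p hp ↦ hw p (Multiset.mem_toFinset.mp (Finset.mem_filter.mp hp).1)

theorem sum_multisetVonMangoldt_Iic (w : α → ℝ) (t : Multiset α) :
    ∑ s ∈ Finset.Iic t, multisetVonMangoldt w s = (t.map w).sum := by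
  unfold multisetVonMangoldt
  rw [Finset.sum_multiset_map_count]
  have h : ∀ p ∈ t.toFinset, t.count p • w p = ∑ _k ∈ Finset.Icc 1 (t.count p), w p := by
    simp
  rw [Finset.sum_congr rfl h, Finset.sum_sigma', Finset.sum_sigma']
  symm
  refine Finset.sum_bij (fun x _ ↦ ⟨Multiset.replicate x.2 x.1, x.1⟩) ?_ ?_ ?_ ?_
  · rintro ⟨p, k⟩ hx
    simp only [Finset.mem_sigma, Finset.mem_Icc, Multiset.mem_toFinset] at hx
    simp only [Finset.mem_sigma, Finset.mem_Iic, Finset.mem_filter, Multiset.mem_toFinset,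
      Multiset.card_replicate, and_true]
    exact ⟨Multiset.le_count_iff_replicate_le.mp hx.2.2, Multiset.mem_replicate.mpr
      ⟨by omega, rfl⟩⟩
  · rintro ⟨p, k⟩ _ ⟨q, l⟩ _ h
    simp only [Sigma.mk.injEq, heq_eq_eq] at h
    obtain ⟨h1, rfl⟩ := h
    have := congrArg Multiset.card h1
    simp only [Multiset.card_replicate] at this
    simp [this]
  · rintro ⟨s, p⟩ hx
    simp only [Finset.mem_sigma, Finset.mem_Iic, Finset.mem_filter, Multiset.mem_toFinset] at hx
    refine ⟨⟨p, Multiset.card s⟩, ?_, ?_⟩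
    · simp only [Finset.mem_sigma, Finset.mem_Icc, Multiset.mem_toFinset]
      refine ⟨Multiset.mem_of_le hx.1 hx.2.1, Multiset.card_pos_iff_exists_mem.mpr ⟨p, hx.2.1⟩, ?_⟩
      rw [Multiset.le_count_iff_replicate_le, ← hx.2.2]
      exact hx.1
    · simp [← hx.2.2]
  · exact fun _ _ ↦ rfl

end MultisetSums

section IdealArithmetic

open NumberField UniqueFactorizationMonoid

variable (K : Type*) [Field K] [NumberField K]

theorem finite_setOf_absNorm_eq_and_ne_bot (n : ℕ) :
    {I : Ideal (𝓞 K) | Ideal.absNorm I = n ∧ I ≠ ⊥}.Finite :=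
  (Ideal.finite_setOfPred_absNorm_eq n).subset fun _ h ↦ h.1

/-- The nonzero ideals of norm `n`. -/
noncomputable def idealsOfNorm (n : ℕ) : Finset (Ideal (𝓞 K)) :=
  (finite_setOf_absNorm_eq_and_ne_bot K n).toFinset

variable {K} in
theorem mem_idealsOfNorm {n : ℕ} {I : Ideal (𝓞 K)} :
    I ∈ idealsOfNorm K n ↔ Ideal.absNorm I = n ∧ I ≠ ⊥ := by
  simp [idealsOfNorm]

theorem card_idealsOfNorm (n : ℕ) : (idealsOfNorm K n).card = rK K n := by
  rw [idealsOfNorm, ← Nat.card_eq_card_finite_toFinset]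
  rfl

theorem idealsOfNorm_zero : idealsOfNorm K 0 = ∅ := by
  ext I
  simpa [mem_idealsOfNorm] using Ideal.absNorm_eq_zero_iff.mp

open scoped Classical in
/-- The sum over the nonzero ideals of norm `n` of a function of their prime factors. -/
noncomputable def normSum (h : Multiset (Ideal (𝓞 K)) → ℝ) (n : ℕ) : ℝ :=
  ∑ I ∈ idealsOfNorm K n, h (normalizedFactors I)

theorem normSum_zero_right (h : Multiset (Ideal (𝓞 K)) → ℝ) : normSum K h 0 = 0 := by
  simp [normSum, idealsOfNorm_zero]

open scoped Classical in
theorem sum_rK_mul_normSum (h : Multiset (Ideal (𝓞 K)) → ℝ) {n : ℕ} (hn : n ≠ 0) :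
    ∑ x ∈ n.divisorsAntidiagonal, (rK K x.1 : ℝ) * normSum K h x.2 =
      ∑ A ∈ idealsOfNorm K n, ∑ s ∈ Finset.Iic (normalizedFactors A), h s := by
  have h1 : ∀ x ∈ n.divisorsAntidiagonal, (rK K x.1 : ℝ) * normSum K h x.2 =
      ∑ y ∈ idealsOfNorm K x.1 ×ˢ idealsOfNorm K x.2, h (normalizedFactors y.2) := fun x _ ↦ by
    simp [Finset.sum_product, card_idealsOfNorm, normSum]
  rw [Finset.sum_congr rfl h1, Finset.sum_sigma', Finset.sum_sigma']
  refine Finset.sum_bij (fun x _ ↦ ⟨x.2.1 * x.2.2, normalizedFactors x.2.2⟩) ?_ ?_ ?_ ?_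
  · rintro ⟨⟨d, e⟩, ⟨I, J⟩⟩ hx
    simp only [Finset.mem_sigma, Nat.mem_divisorsAntidiagonal, Finset.mem_product,
      mem_idealsOfNorm] at hx
    simp only [Finset.mem_sigma, mem_idealsOfNorm, Finset.mem_Iic]
    refine ⟨⟨by rw [map_mul, hx.2.1.1, hx.2.2.1, hx.1.1], mul_ne_zero hx.2.1.2 hx.2.2.2⟩, ?_⟩
    rw [normalizedFactors_mul hx.2.1.2 hx.2.2.2]
    exact Multiset.le_add_left _ _
  · rintro ⟨⟨d, e⟩, ⟨I, J⟩⟩ hx ⟨⟨d', e'⟩, ⟨I', J'⟩⟩ hx' heq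
    simp only [Finset.mem_sigma, Nat.mem_divisorsAntidiagonal, Finset.mem_product,
      mem_idealsOfNorm] at hx hx'
    simp only [Sigma.mk.injEq, heq_eq_eq] at heq
    have hJ : J = J' := by
      rw [← Ideal.prod_normalizedFactors_eq_self hx.2.2.2, heq.2,
        Ideal.prod_normalizedFactors_eq_self hx'.2.2.2]
    subst hJ
    have hI : I = I' := mul_right_cancel₀ hx.2.2.2 heq.1
    subst hI
    obtain ⟨-, ⟨rfl, -⟩, rfl, -⟩ := hx
    obtain ⟨-, ⟨rfl, -⟩, rfl, -⟩ := hx'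
    rfl
  · rintro ⟨A, s⟩ hx
    simp only [Finset.mem_sigma, mem_idealsOfNorm, Finset.mem_Iic] at hx
    obtain ⟨⟨hA, hA0⟩, hs⟩ := hx
    have hprime : ∀ p ∈ s, Prime p := fun p hp ↦
      prime_of_normalized_factor p (Multiset.mem_of_le hs hp)
    have hns : normalizedFactors s.prod = s := normalizedFactors_prod_of_prime hprime
    have hs0 : s.prod ≠ 0 := Multiset.prod_ne_zero fun h ↦ (hprime 0 h).ne_zero rfl
    obtain ⟨I, hI⟩ : s.prod ∣ A := by
      rw [dvd_iff_normalizedFactors_le_normalizedFactors hs0 hA0, hns]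
      exact hs
    have hI0 : I ≠ 0 := by
      rintro rfl
      exact hA0 (by rw [hI, mul_zero]; rfl)
    refine ⟨⟨(Ideal.absNorm I, Ideal.absNorm s.prod), (I, s.prod)⟩, ?_, ?_⟩
    · simp only [Finset.mem_sigma, Nat.mem_divisorsAntidiagonal, Finset.mem_product,
        mem_idealsOfNorm, true_and]
      refine ⟨⟨?_, hn⟩, hI0, hs0⟩
      rw [← map_mul, mul_comm, ← hI, hA]
    · simp only [hns, hI, mul_comm I]
  · exact fun _ _ ↦ rfl

end IdealArithmetic

section IdealArithmetic

open NumberField UniqueFactorizationMonoid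

variable (K : Type*) [Field K] [NumberField K]

theorem rK_zero : rK K 0 = 0 := by
  rw [← card_idealsOfNorm, idealsOfNorm_zero, Finset.card_empty]

theorem idealsOfNorm_one : idealsOfNorm K 1 = {⊤} := by
  ext I
  simp only [mem_idealsOfNorm, Ideal.absNorm_eq_one_iff, Finset.mem_singleton]
  exact ⟨fun h ↦ h.1, fun h ↦ ⟨h, h ▸ top_ne_bot⟩⟩

theorem rK_one : rK K 1 = 1 := by
  rw [← card_idealsOfNorm, idealsOfNorm_one, Finset.card_singleton]

/-- The coefficients of the inverse of the Dedekind zeta function. -/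
noncomputable def dedekindMoebius (n : ℕ) : ℝ :=
  open scoped Classical in normSum K multisetMoebius n

theorem abs_dedekindMoebius_le (n : ℕ) : |dedekindMoebius K n| ≤ rK K n := by
  classical
  rw [dedekindMoebius, normSum, ← card_idealsOfNorm]
  refine (Finset.abs_sum_le_sum_abs _ _).trans ?_
  refine (Finset.sum_le_card_nsmul _ _ 1 fun _ _ ↦ abs_multisetMoebius_le _).trans ?_
  simp

theorem sum_rK_mul_dedekindMoebius {n : ℕ} (hn : n ≠ 0) :
    ∑ x ∈ n.divisorsAntidiagonal, (rK K x.1 : ℝ) * dedekindMoebius K x.2 =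
      if n = 1 then 1 else 0 := by
  classical
  unfold dedekindMoebius
  rw [sum_rK_mul_normSum K _ hn]
  have h : ∀ A ∈ idealsOfNorm K n, ∑ s ∈ Finset.Iic (normalizedFactors A), multisetMoebius s =
      if n = 1 then 1 else 0 := fun A hA ↦ by
    rw [mem_idealsOfNorm] at hA
    simp only [sum_multisetMoebius_Iic, normalizedFactors_eq_zero_iff hA.2, Ideal.isUnit_iff,
      ← Ideal.absNorm_eq_one_iff, hA.1]
  rw [Finset.sum_congr rfl h]
  split_ifs with h1
  · rw [h1, idealsOfNorm_one, Finset.sum_singleton]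
  · simp

variable {K} in
theorem prod_map_absNorm_normalizedFactors {A : Ideal (𝓞 K)} (hA : A ≠ ⊥) :
    ((normalizedFactors A).map fun P ↦ (Ideal.absNorm P : ℝ)).prod = Ideal.absNorm A := by
  conv_rhs => rw [← Ideal.prod_normalizedFactors_eq_self hA]
  rw [map_multiset_prod, Nat.cast_multiset_prod, Multiset.map_map]
  rfl

variable {K} in
theorem two_le_absNorm_of_mem_normalizedFactors {A P : Ideal (𝓞 K)}
    (hP : P ∈ normalizedFactors A) : 2 ≤ Ideal.absNorm P := by
  have hp := prime_of_normalized_factor P hP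
  have h0 : Ideal.absNorm P ≠ 0 := fun h ↦ hp.ne_zero (Ideal.absNorm_eq_zero_iff.mp h)
  have h1 : Ideal.absNorm P ≠ 1 := fun h ↦ hp.not_isUnit
    (Ideal.isUnit_iff.mpr (Ideal.absNorm_eq_one_iff.mp h))
  omega

/-- The von Mangoldt function of the Dedekind zeta function. -/
noncomputable def dedekindVonMangoldt (n : ℕ) : ℝ :=
  open scoped Classical in
  normSum K (multisetVonMangoldt fun P ↦ Real.log (Ideal.absNorm P)) n

theorem dedekindVonMangoldt_nonneg (n : ℕ) : 0 ≤ dedekindVonMangoldt K n := by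
  classical
  exact Finset.sum_nonneg fun A _ ↦ multisetVonMangoldt_nonneg fun P _ ↦
    Real.log_natCast_nonneg _

theorem sum_rK_mul_dedekindVonMangoldt {n : ℕ} (hn : n ≠ 0) :
    ∑ x ∈ n.divisorsAntidiagonal, (rK K x.1 : ℝ) * dedekindVonMangoldt K x.2 =
      rK K n * Real.log n := by
  classical
  unfold dedekindVonMangoldt
  rw [sum_rK_mul_normSum K _ hn, ← card_idealsOfNorm, ← nsmul_eq_mul, ← Finset.sum_const]
  refine Finset.sum_congr rfl fun A hA ↦ ?_
  rw [mem_idealsOfNorm] at hA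
  rw [sum_multisetVonMangoldt_Iic, ← hA.1, ← prod_map_absNorm_normalizedFactors hA.2,
    Real.log_multiset_prod, Multiset.map_map]
  · rfl
  · rintro _ h rfl
    rw [Multiset.mem_map] at h
    obtain ⟨P, hP, h⟩ := h
    have := two_le_absNorm_of_mem_normalizedFactors hP
    rw [Nat.cast_eq_zero] at h
    omega

theorem dedekindVonMangoldt_le (n : ℕ) : dedekindVonMangoldt K n ≤ rK K n * Real.log n := by
  rcases eq_or_ne n 0 with rfl | hn
  · simp [dedekindVonMangoldt, normSum_zero_right]
  rw [← sum_rK_mul_dedekindVonMangoldt K hn]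
  refine le_trans (by simp [rK_one]) (Finset.single_le_sum (f := fun x : ℕ × ℕ ↦
    (rK K x.1 : ℝ) * dedekindVonMangoldt K x.2) (a := (1, n))
    (fun x _ ↦ mul_nonneg (Nat.cast_nonneg _) (dedekindVonMangoldt_nonneg K _)) (by simp [hn]))

theorem add_one_le_mul_rpow {ε x : ℝ} (hε : 0 < ε) (hx : 2 ≤ x) (v : ℕ) :
    (v + 1 : ℝ) ≤ max 1 (ε * Real.log 2)⁻¹ * (x ^ v) ^ ε := by
  have hl : 0 < Real.log 2 := Real.log_pos one_lt_two
  have h1 : 1 + v * (ε * Real.log 2) ≤ (x ^ v) ^ ε := by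
    have : (2 : ℝ) ^ v ≤ x ^ v := pow_le_pow_left₀ (by norm_num) hx v
    refine le_trans ?_ (Real.rpow_le_rpow (by positivity) this hε.le)
    rw [← Real.rpow_natCast, ← Real.rpow_mul (by norm_num), Real.rpow_def_of_pos (by norm_num)]
    refine le_trans (le_of_eq (by ring)) (Real.add_one_le_exp _)
  have h2 : (v : ℝ) + 1 ≤ max 1 (ε * Real.log 2)⁻¹ * (1 + v * (ε * Real.log 2)) := by
    have ha := le_max_left 1 (ε * Real.log 2)⁻¹
    have hb : 1 ≤ max 1 (ε * Real.log 2)⁻¹ * (ε * Real.log 2) := by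
      rw [← inv_mul_cancel₀ (mul_pos hε hl).ne']
      exact mul_le_mul_of_nonneg_right (le_max_right _ _) (mul_pos hε hl).le
    nlinarith [mul_le_mul_of_nonneg_left hb (Nat.cast_nonneg v : (0 : ℝ) ≤ v)]
  exact h2.trans (mul_le_mul_of_nonneg_left h1 (by positivity))

open scoped Classical in
/-- The number of divisors of an ideal is smaller than any power of its norm. -/
theorem exists_card_Iic_normalizedFactors_le {ε : ℝ} (hε : 0 < ε) :
    ∃ C > (0 : ℝ), ∀ A : Ideal (𝓞 K), A ≠ ⊥ →
      ((Finset.Iic (normalizedFactors A)).card : ℝ) ≤ C * (Ideal.absNorm A : ℝ) ^ ε := by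
  set D : ℝ := max 1 (ε * Real.log 2)⁻¹
  have hD : 1 ≤ D := le_max_left _ _
  have hfin : {P : Ideal (𝓞 K) | Ideal.absNorm P ≤ ⌊(2 : ℝ) ^ ε⁻¹⌋₊}.Finite :=
    Ideal.finite_setOfPred_absNorm_le _
  set S := hfin.toFinset
  refine ⟨D ^ S.card, by positivity, fun A hA ↦ ?_⟩
  set s := normalizedFactors A
  have hnorm : ∏ P ∈ s.toFinset, ((Ideal.absNorm P : ℝ) ^ s.count P) ^ ε =
      (Ideal.absNorm A : ℝ) ^ ε := by
    rw [Real.finsetProd_rpow _ _ fun _ _ ↦ by positivity,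
      ← prod_map_absNorm_normalizedFactors hA, Finset.prod_multiset_map_count]
  rw [Multiset.card_Iic, ← hnorm]
  push_cast
  have hle : ∀ P ∈ s.toFinset, ((s.count P : ℝ) + 1) ≤
      (if P ∈ S then D else 1) * ((Ideal.absNorm P : ℝ) ^ s.count P) ^ ε := fun P hP ↦ by
    have h2 : (2 : ℝ) ≤ Ideal.absNorm P := by
      exact_mod_cast two_le_absNorm_of_mem_normalizedFactors (Multiset.mem_toFinset.mp hP)
    split_ifs with hS
    · exact add_one_le_mul_rpow hε h2 _
    · rw [one_mul]
      have h3 : (2 : ℝ) ≤ (Ideal.absNorm P : ℝ) ^ ε := by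
        have : (2 : ℝ) ^ ε⁻¹ ≤ Ideal.absNorm P := by
          simp only [S, Set.Finite.mem_toFinset, Set.mem_ofPred_eq, not_le] at hS
          exact ((Nat.floor_lt (by positivity)).mp hS).le
        calc (2 : ℝ) = ((2 : ℝ) ^ ε⁻¹) ^ ε := by
              rw [← Real.rpow_mul (by norm_num), inv_mul_cancel₀ hε.ne', Real.rpow_one]
          _ ≤ _ := Real.rpow_le_rpow (by positivity) this hε.le
      rw [← Real.rpow_natCast, ← Real.rpow_mul (by positivity), mul_comm _ ε,
        Real.rpow_mul (by positivity), Real.rpow_natCast]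
      refine le_trans ?_ (pow_le_pow_left₀ (by norm_num) h3 _)
      exact_mod_cast Nat.lt_two_pow_self
  refine (Finset.prod_le_prod (fun _ _ ↦ by positivity) hle).trans ?_
  rw [Finset.prod_mul_distrib]
  refine mul_le_mul_of_nonneg_right ?_ (Finset.prod_nonneg fun _ _ ↦ by positivity)
  rw [Finset.prod_ite, Finset.prod_const, Finset.prod_const_one, mul_one]
  exact pow_le_pow_right₀ hD (Finset.card_le_card fun P hP ↦ (Finset.mem_filter.mp hP).2)

theorem exists_rK_le {ε : ℝ} (hε : 0 < ε) :
    ∃ C > (0 : ℝ), ∀ n : ℕ, (rK K n : ℝ) ≤ C * (n : ℝ) ^ ε := by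
  classical
  have hd : (0 : ℝ) < Module.finrank ℚ K := by exact_mod_cast Module.finrank_pos
  obtain ⟨C, hC, h⟩ := exists_card_Iic_normalizedFactors_le K (div_pos hε hd)
  refine ⟨C, hC, fun n ↦ ?_⟩
  rcases eq_or_ne n 0 with rfl | hn
  · rw [rK_zero, Nat.cast_zero]
    positivity
  set B : Ideal (𝓞 K) := Ideal.span {(n : 𝓞 K)}
  have hB : B ≠ ⊥ := by
    simpa [B] using hn
  have hnB : (Ideal.absNorm B : ℝ) ^ (ε / Module.finrank ℚ K) = (n : ℝ) ^ ε := by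
    rw [Ideal.absNorm_span_singleton]
    have : Algebra.norm ℤ (n : 𝓞 K) = (n : ℤ) ^ Module.finrank ℚ K := by
      rw [← RingOfIntegers.rank K]
      exact_mod_cast Algebra.norm_algebraMap (S := 𝓞 K) (n : ℤ)
    rw [this, Int.natAbs_pow, Int.natAbs_natCast, Nat.cast_pow, ← Real.rpow_natCast,
      ← Real.rpow_mul (by positivity), mul_div_cancel₀ _ hd.ne']
  rw [← hnB]
  refine le_trans ?_ (h B hB)
  rw [← card_idealsOfNorm, Nat.cast_le]
  refine Finset.card_le_card_of_injOn normalizedFactors (fun I hI ↦ ?_) fun I hI J hJ hIJ ↦ ?_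
  · obtain ⟨hI, hI0⟩ := mem_idealsOfNorm.mp hI
    simp only [Finset.coe_Iic, Set.mem_Iic]
    rw [← dvd_iff_normalizedFactors_le_normalizedFactors hI0 hB, Ideal.dvd_span_singleton, ← hI]
    exact Ideal.absNorm_mem I
  · rw [← Ideal.prod_normalizedFactors_eq_self (mem_idealsOfNorm.mp hI).2, hIJ,
      Ideal.prod_normalizedFactors_eq_self (mem_idealsOfNorm.mp hJ).2]

theorem exists_sum_rK_mul_rK_le {ε : ℝ} (hε : 0 < ε) :
    ∃ C > (0 : ℝ), ∀ n : ℕ,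
      ∑ x ∈ n.divisorsAntidiagonal, (rK K x.1 : ℝ) * rK K x.2 ≤ C * (n : ℝ) ^ ε := by
  classical
  obtain ⟨C, hC, h⟩ := exists_card_Iic_normalizedFactors_le K (half_pos hε)
  obtain ⟨D, hD, h'⟩ := exists_rK_le K (half_pos hε)
  refine ⟨D * C, by positivity, fun n ↦ ?_⟩
  rcases eq_or_ne n 0 with rfl | hn
  · simp only [Nat.divisorsAntidiagonal_zero, Finset.sum_empty]
    positivity
  have h1 : ∀ k, (rK K k : ℝ) = normSum K (fun _ ↦ 1) k := fun k ↦ by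
    simp [normSum, card_idealsOfNorm]
  calc ∑ x ∈ n.divisorsAntidiagonal, (rK K x.1 : ℝ) * rK K x.2
      = ∑ A ∈ idealsOfNorm K n, ((Finset.Iic (normalizedFactors A)).card : ℝ) := by
        simp_rw [h1 (Prod.snd _)]
        rw [sum_rK_mul_normSum K _ hn]
        simp
    _ ≤ (idealsOfNorm K n).card • (C * (n : ℝ) ^ (ε / 2)) :=
        Finset.sum_le_card_nsmul _ _ _ fun A hA ↦ by
          obtain ⟨hA, hA0⟩ := mem_idealsOfNorm.mp hA
          rw [← hA]
          exact h A hA0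
    _ ≤ (D * (n : ℝ) ^ (ε / 2)) * (C * (n : ℝ) ^ (ε / 2)) := by
        rw [nsmul_eq_mul, card_idealsOfNorm]
        exact mul_le_mul_of_nonneg_right (h' n) (by positivity)
    _ = D * C * (n : ℝ) ^ ε := by
        rw [mul_mul_mul_comm, ← Real.rpow_add (by positivity), add_halves]

end IdealArithmetic

section DirichletApproximation

/-- The summatory function of a sequence. -/
noncomputable def summatory (r : ℕ → ℝ) (t : ℝ) : ℝ := ∑ k ∈ Finset.Icc 1 ⌊t⌋₊, r k

theorem measurable_summatory (r : ℕ → ℝ) : Measurable (summatory r) :=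
  (measurable_from_nat (f := fun n ↦ ∑ k ∈ Finset.Icc 1 n, r k)).comp Nat.measurable_floor

/-- The increment past `N` of the error term in the approximation of the summatory function
by `κ * t`. -/
noncomputable def tailRemainder (r : ℕ → ℝ) (κ : ℝ) (N : ℕ) (t : ℝ) : ℝ :=
  if (N : ℝ) < t then (summatory r t - κ * t) - (summatory r N - κ * N) else 0

theorem measurable_tailRemainder (r : ℕ → ℝ) (κ : ℝ) (N : ℕ) :
    Measurable (tailRemainder r κ N) :=
  Measurable.ite measurableSet_Ioi
    (((measurable_summatory r).sub (measurable_const.mul measurable_id)).sub measurable_const)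
    measurable_const

variable {r : ℕ → ℝ} {κ δ C : ℝ}

theorem abs_tailRemainder_le (hδ : δ ≤ 1) (hC : 0 ≤ C)
    (h : ∀ x : ℝ, 1 ≤ x → |summatory r x - κ * x| ≤ C * x ^ (1 - δ)) {N : ℕ} (hN : 1 ≤ N) {t : ℝ}
    (ht : 0 < t) : |tailRemainder r κ N t| ≤ 2 * C * t ^ (1 - δ) := by
  unfold tailRemainder
  have hN' : (1 : ℝ) ≤ N := by exact_mod_cast hN
  split_ifs with hNt
  · have h1 := h t (hN'.trans hNt.le)
    have h2 := h N hN'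
    have h3 : (N : ℝ) ^ (1 - δ) ≤ t ^ (1 - δ) :=
      Real.rpow_le_rpow (by positivity) hNt.le (by linarith)
    calc _ ≤ |summatory r t - κ * t| + |summatory r N - κ * N| := abs_sub _ _
      _ ≤ _ := by nlinarith
  · rw [abs_zero]
    positivity

theorem sum_Icc_ite_lt_eq_summatory_sub (r : ℕ → ℝ) {N : ℕ} {t : ℝ} (hNt : (N : ℝ) ≤ t) :
    ∑ k ∈ Finset.Icc 1 ⌊t⌋₊, (if N < k then r k else 0) = summatory r t - summatory r N := by
  have hN : N ≤ ⌊t⌋₊ := Nat.le_floor hNt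
  rw [summatory, summatory, Nat.floor_natCast, eq_sub_iff_add_eq, ← Finset.sum_filter, add_comm]
  rw [← Finset.sum_union]
  · congr 1
    ext k
    simp only [Finset.mem_union, Finset.mem_Icc, Finset.mem_filter]
    omega
  · rw [Finset.disjoint_left]
    intro k
    simp only [Finset.mem_Icc, Finset.mem_filter]
    omega

theorem differentiableAt_mellin_tailRemainder (hδ : δ ≤ 1) (hC : 0 ≤ C)
    (h : ∀ x : ℝ, 1 ≤ x → |summatory r x - κ * x| ≤ C * x ^ (1 - δ)) {N : ℕ} (hN : 1 ≤ N) {s : ℂ}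
    (hs : s.re < -(1 - δ)) :
    DifferentiableAt ℂ (mellin fun t ↦ (tailRemainder r κ N t : ℂ)) s := by
  have hN' : (1 : ℝ) ≤ N := by exact_mod_cast hN
  refine mellin_differentiableAt_of_isBigO_rpow (a := -(1 - δ)) (b := s.re - 1) ?_ ?_ hs ?_
    (by linarith)
  · have hcont : ContinuousOn (fun t : ℝ ↦ 2 * C * t ^ (1 - δ)) (Set.Ioi 0) := fun t ht ↦
      (continuousAt_const.mul (Real.continuousAt_rpow_const _ _ (Or.inl (ne_of_gt ht))))
        |>.continuousWithinAt
    have hloc := hcont.locallyIntegrableOn (μ := volume) measurableSet_Ioi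
    rw [locallyIntegrableOn_iff isOpen_Ioi.isLocallyClosed] at hloc ⊢
    intro k hk hk'
    refine (hloc k hk hk').mono'
      (measurable_ofReal.comp (measurable_tailRemainder r κ N)).aestronglyMeasurable ?_
    refine (ae_restrict_iff' hk'.measurableSet).mpr (ae_of_all _ fun t ht ↦ ?_)
    rw [norm_real]
    exact abs_tailRemainder_le hδ hC h hN (hk ht)
  · rw [neg_neg]
    refine IsBigO.of_bound (2 * C) ?_
    filter_upwards [eventually_gt_atTop 0] with t ht
    rw [norm_real, Real.norm_of_nonneg (by positivity : (0 : ℝ) ≤ t ^ (1 - δ))]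
    exact abs_tailRemainder_le hδ hC h hN ht
  · refine EventuallyEq.trans_isBigO (f₂ := fun _ ↦ (0 : ℂ)) ?_ (isBigO_zero _ _)
    have : Set.Iio (1 : ℝ) ∈ nhdsWithin 0 (Set.Ioi 0) :=
      mem_nhdsWithin_of_mem_nhds (Iio_mem_nhds one_pos)
    filter_upwards [this] with t ht
    rw [tailRemainder, if_neg (not_lt.mpr (ht.le.trans hN')), ofReal_zero]

theorem norm_cpow_mul_tailRemainder_le (hδ : δ ≤ 1) (hC : 0 ≤ C)
    (h : ∀ x : ℝ, 1 ≤ x → |summatory r x - κ * x| ≤ C * x ^ (1 - δ)) {N : ℕ} (hN : 1 ≤ N) {s : ℂ}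
    {t : ℝ} (ht : 0 < t) :
    ‖(t : ℂ) ^ (-s - 1) * (tailRemainder r κ N t : ℂ)‖ ≤ 2 * C * t ^ (1 - δ - s.re - 1) := by
  rw [norm_mul, norm_real, norm_cpow_eq_rpow_re_of_pos ht, mul_comm]
  refine (mul_le_mul_of_nonneg_right (abs_tailRemainder_le hδ hC h hN ht)
    (by positivity)).trans (le_of_eq ?_)
  rw [mul_assoc, ← Real.rpow_add ht]
  congr 2
  simp
  ring

theorem mellin_tailRemainder_neg (r : ℕ → ℝ) (κ : ℝ) (N : ℕ) (s : ℂ) :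
    mellin (fun t ↦ (tailRemainder r κ N t : ℂ)) (-s) =
      ∫ t in Set.Ioi (N : ℝ), (t : ℂ) ^ (-s - 1) * (tailRemainder r κ N t : ℂ) := by
  rw [mellin]
  refine setIntegral_eq_of_subset_of_forall_sdiff_eq_zero measurableSet_Ioi
    (Set.Ioi_subset_Ioi N.cast_nonneg) fun t ht ↦ ?_
  rw [tailRemainder, if_neg (show ¬(N : ℝ) < t from ht.2), ofReal_zero, smul_zero]

theorem norm_mellin_tailRemainder_le (hδ : δ ≤ 1) (hC : 0 ≤ C)
    (h : ∀ x : ℝ, 1 ≤ x → |summatory r x - κ * x| ≤ C * x ^ (1 - δ)) {N : ℕ} (hN : 1 ≤ N) {s : ℂ}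
    (hs : 1 - δ < s.re) :
    ‖mellin (fun t ↦ (tailRemainder r κ N t : ℂ)) (-s)‖ ≤
      2 * C * ((N : ℝ) ^ (1 - δ - s.re) / (s.re - (1 - δ))) := by
  have hN' : (0 : ℝ) < N := by exact_mod_cast hN
  have hlt : 1 - δ - s.re - 1 < -1 := by linarith
  have h2 := integral_Ioi_rpow_of_lt hlt hN'
  rw [mellin_tailRemainder_neg]
  refine (norm_integral_le_of_norm_le (g := fun t ↦ 2 * C * t ^ (1 - δ - s.re - 1))
    ((integrableOn_Ioi_rpow_of_lt hlt hN').const_mul _) ?_).trans (le_of_eq ?_)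
  · refine (ae_restrict_iff' measurableSet_Ioi).mpr (ae_of_all _ fun t (ht : (N : ℝ) < t) ↦ ?_)
    exact norm_cpow_mul_tailRemainder_le hδ hC h hN (hN'.trans ht)
  · rw [integral_const_mul, h2, show 1 - δ - s.re - 1 + 1 = -(s.re - (1 - δ)) by ring, neg_div_neg_eq,
      show -(s.re - (1 - δ)) = 1 - δ - s.re by ring]

theorem mellinConvergent_tailRemainder (hδ : δ ≤ 1) (hC : 0 ≤ C)
    (h : ∀ x : ℝ, 1 ≤ x → |summatory r x - κ * x| ≤ C * x ^ (1 - δ)) {N : ℕ} (hN : 1 ≤ N) {s : ℂ}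
    (hs : 1 - δ < s.re) :
    IntegrableOn (fun t : ℝ ↦ (t : ℂ) ^ (-s - 1) * (tailRemainder r κ N t : ℂ))
      (Set.Ioi (N : ℝ)) := by
  have hN' : (0 : ℝ) < N := by exact_mod_cast hN
  have hlt : 1 - δ - s.re - 1 < -1 := by linarith
  refine Integrable.mono' (g := fun t ↦ 2 * C * t ^ (1 - δ - s.re - 1))
    ((integrableOn_Ioi_rpow_of_lt hlt hN').const_mul _) ?_ ?_
  · exact (Measurable.mul (by fun_prop)
      (measurable_ofReal.comp (measurable_tailRemainder r κ N))).aestronglyMeasurable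
  · refine (ae_restrict_iff' measurableSet_Ioi).mpr (ae_of_all _ fun t (ht : (N : ℝ) < t) ↦ ?_)
    exact norm_cpow_mul_tailRemainder_le hδ hC h hN (hN'.trans ht)

end DirichletApproximation

section DirichletApproximation

variable {r : ℕ → ℝ} {κ δ C : ℝ}

theorem summatory_le (hδ₀ : 0 < δ) (hC : 0 ≤ C)
    (h : ∀ x : ℝ, 1 ≤ x → |summatory r x - κ * x| ≤ C * x ^ (1 - δ)) {x : ℝ} (hx : 1 ≤ x) :
    summatory r x ≤ (κ + C) * x := by
  have h1 := (le_abs_self _).trans (h x hx)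
  have h2 : x ^ (1 - δ) ≤ x := by
    conv_rhs => rw [← Real.rpow_one x]
    exact Real.rpow_le_rpow_of_exponent_le hx (by linarith)
  nlinarith

theorem isBigO_sum_ite_lt (hr : ∀ n, 0 ≤ r n) (hδ₀ : 0 < δ) (hC : 0 ≤ C)
    (h : ∀ x : ℝ, 1 ≤ x → |summatory r x - κ * x| ≤ C * x ^ (1 - δ)) (N : ℕ) :
    (fun n ↦ ∑ k ∈ Finset.Icc 1 n, (if N < k then r k else 0)) =O[atTop]
      fun n : ℕ ↦ (n : ℝ) ^ (1 : ℝ) := by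
  refine IsBigO.of_bound (κ + C) ?_
  filter_upwards [eventually_ge_atTop 1] with n hn
  have h0 : ∀ k ∈ Finset.Icc 1 n, 0 ≤ (if N < k then r k else 0) := fun k _ ↦ by
    split_ifs
    exacts [hr k, le_rfl]
  rw [Real.norm_of_nonneg (Finset.sum_nonneg h0), Real.rpow_one,
    Real.norm_of_nonneg (Nat.cast_nonneg n)]
  refine le_trans ?_ (summatory_le hδ₀ hC h (by exact_mod_cast hn : (1 : ℝ) ≤ n))
  rw [summatory, Nat.floor_natCast]
  refine Finset.sum_le_sum fun k _ ↦ ?_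
  split_ifs
  exacts [le_rfl, hr k]

theorem LSeriesSummable_ite_lt (hr : ∀ n, 0 ≤ r n) (hδ₀ : 0 < δ) (hC : 0 ≤ C)
    (h : ∀ x : ℝ, 1 ≤ x → |summatory r x - κ * x| ≤ C * x ^ (1 - δ)) (N : ℕ) {s : ℂ}
    (hs : 1 < s.re) :
    LSeriesSummable (fun n ↦ ((if N < n then r n else 0 : ℝ) : ℂ)) s := by
  refine LSeriesSummable_of_sum_norm_bigO_and_nonneg
    (f := fun n ↦ if N < n then r n else 0) (isBigO_sum_ite_lt hr hδ₀ hC h N) (fun n ↦ ?_)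
    zero_le_one hs
  split_ifs
  exacts [hr n, le_rfl]

theorem LSeries_ite_lt_eq (hr : ∀ n, 0 ≤ r n) (hδ₀ : 0 < δ) (hδ : δ ≤ 1) (hC : 0 ≤ C)
    (h : ∀ x : ℝ, 1 ≤ x → |summatory r x - κ * x| ≤ C * x ^ (1 - δ)) {N : ℕ} (hN : 1 ≤ N) {s : ℂ}
    (hs : 1 < s.re) :
    LSeries (fun n ↦ ((if N < n then r n else 0 : ℝ) : ℂ)) s =
      κ * (N : ℂ) ^ (1 - s) / (s - 1) + s * mellin (fun t ↦ (tailRemainder r κ N t : ℂ)) (-s) := by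
  have hN' : (0 : ℝ) < N := by exact_mod_cast hN
  have hN1 : (1 : ℝ) ≤ N := by exact_mod_cast hN
  have hs1 : s - 1 ≠ 0 := fun h ↦ by
    rw [sub_eq_zero.mp h, one_re] at hs
    exact lt_irrefl _ hs
  have hs0 : s ≠ 0 := fun h ↦ by
    rw [h, zero_re] at hs
    linarith
  rw [LSeries_eq_mul_integral_of_nonneg (fun n ↦ if N < n then r n else 0) zero_le_one hs
    (isBigO_sum_ite_lt hr hδ₀ hC h N) (fun n ↦ by
      split_ifs
      exacts [hr n, le_rfl])]
  have h1 : ∫ t in Set.Ioi (1 : ℝ), (∑ k ∈ Finset.Icc 1 ⌊t⌋₊,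
        (((if N < k then r k else 0 : ℝ)) : ℂ)) * (t : ℂ) ^ (-(s + 1)) =
      ∫ t in Set.Ioi (N : ℝ), (κ * (t : ℂ) ^ (-s) - κ * N * (t : ℂ) ^ (-s - 1) +
        (t : ℂ) ^ (-s - 1) * (tailRemainder r κ N t : ℂ)) := by
    rw [setIntegral_eq_of_subset_of_forall_sdiff_eq_zero measurableSet_Ioi
      (Set.Ioi_subset_Ioi hN1)]
    · refine setIntegral_congr_fun measurableSet_Ioi fun t (ht : (N : ℝ) < t) ↦ ?_
      have ht0 : (t : ℂ) ≠ 0 := ofReal_ne_zero.mpr (hN'.trans ht).ne'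
      rw [← ofReal_sum, sum_Icc_ite_lt_eq_summatory_sub r ht.le, tailRemainder, if_pos ht, neg_add',
        cpow_sub _ _ ht0, cpow_one]
      push_cast
      field_simp
      ring
    · intro t ht
      have ht' : t ≤ N := not_lt.mp ht.2
      rw [Finset.sum_eq_zero, zero_mul]
      intro k hk
      have : k ≤ N := (Finset.mem_Icc.mp hk).2.trans (Nat.floor_le_of_le ht')
      rw [if_neg (not_lt.mpr this), ofReal_zero]
  have hre : (-s).re < -1 := by
    rw [neg_re]
    linarith
  have hre' : (-s - 1).re < -1 := by
    rw [sub_re, neg_re, one_re]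
    linarith
  have i1 := (integrableOn_Ioi_cpow_of_lt hre hN').const_mul (κ : ℂ)
  have i2 := (integrableOn_Ioi_cpow_of_lt hre' hN').const_mul (κ * N : ℂ)
  have i12 : IntegrableOn (fun t : ℝ ↦ κ * (t : ℂ) ^ (-s) - κ * N * (t : ℂ) ^ (-s - 1))
      (Set.Ioi (N : ℝ)) := i1.sub i2
  rw [h1, integral_add i12 (mellinConvergent_tailRemainder hδ hC h hN (by linarith)),
    integral_sub i1 i2, integral_const_mul, integral_const_mul, integral_Ioi_cpow_of_lt hre hN',
    integral_Ioi_cpow_of_lt hre' hN', mellin_tailRemainder_neg, mul_add]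
  congr 1
  have e1 : -s + 1 ≠ 0 := by
    rw [neg_add_eq_sub, ← neg_sub]
    exact neg_ne_zero.mpr hs1
  have hNc : (N : ℂ) ≠ 0 := Nat.cast_ne_zero.mpr (by omega)
  rw [ofReal_natCast, sub_add_cancel, neg_add_eq_sub, cpow_sub _ _ hNc, cpow_one, cpow_neg]
  have e2 : (1 : ℂ) - s ≠ 0 := by rwa [neg_add_eq_sub] at e1
  have e3 : (N : ℂ) ^ s ≠ 0 := by
    rw [Ne, cpow_eq_zero_iff]
    exact fun h ↦ hNc h.1
  field_simp
  ring

theorem LSeries_eq_sum_add_LSeries_ite_lt (hr : ∀ n, 0 ≤ r n) (hδ₀ : 0 < δ) (hC : 0 ≤ C)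
    (h : ∀ x : ℝ, 1 ≤ x → |summatory r x - κ * x| ≤ C * x ^ (1 - δ)) (N : ℕ) {s : ℂ}
    (hs : 1 < s.re) :
    LSeries (fun n ↦ (r n : ℂ)) s = ∑ n ∈ Finset.Icc 1 N, LSeries.term (fun n ↦ (r n : ℂ)) s n +
      LSeries (fun n ↦ ((if N < n then r n else 0 : ℝ) : ℂ)) s := by
  have hfin : ∀ n ∉ Finset.Icc 1 N,
      LSeries.term (fun n ↦ ((if N < n then 0 else r n : ℝ) : ℂ)) s n = 0 := fun n hn ↦ by
    rcases eq_or_ne n 0 with rfl | hn0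
    · simp
    · have : N < n := by
        simp only [Finset.mem_Icc, not_and, not_le] at hn
        exact hn (Nat.pos_of_ne_zero hn0)
      simp [LSeries.term_of_ne_zero hn0, this]
  have h1 : LSeriesHasSum (fun n ↦ ((if N < n then 0 else r n : ℝ) : ℂ)) s
      (∑ n ∈ Finset.Icc 1 N, LSeries.term (fun n ↦ (r n : ℂ)) s n) := by
    have h2 := hasSum_sum_of_ne_finset_zero (L := SummationFilter.unconditional ℕ) hfin
    rw [LSeriesHasSum]
    convert h2 using 1
    refine Finset.sum_congr rfl fun n hn ↦ ?_
    obtain ⟨hn1, hnN⟩ := Finset.mem_Icc.mp hn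
    have hn0 : n ≠ 0 := by omega
    rw [LSeries.term_of_ne_zero hn0, LSeries.term_of_ne_zero hn0, if_neg (not_lt.mpr hnN)]
  have h3 := h1.add (LSeriesSummable_ite_lt hr hδ₀ hC h N hs).LSeriesHasSum
  refine LSeriesHasSum.LSeries_eq ?_
  convert h3 using 1
  ext n
  rw [Pi.add_apply]
  split_ifs <;> simp

end DirichletApproximation

section DirichletApproximation

variable {r : ℕ → ℝ} {κ δ C : ℝ} {Z : ℂ → ℂ}

theorem eq_sum_add_mellin (hr : ∀ n, 0 ≤ r n) (hδ₀ : 0 < δ) (hδ : δ ≤ 1) (hC : 0 ≤ C)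
    (h : ∀ x : ℝ, 1 ≤ x → |summatory r x - κ * x| ≤ C * x ^ (1 - δ))
    (hZ : ∀ s ≠ 1, DifferentiableAt ℂ Z s)
    (hZr : ∀ s : ℂ, 1 < s.re → Z s = LSeries (fun n ↦ (r n : ℂ)) s) {N : ℕ} (hN : 1 ≤ N) {s : ℂ}
    (hs : 1 - δ < s.re) (hs' : 0 < s.im ∨ 1 < s.re) :
    Z s = ∑ n ∈ Finset.Icc 1 N, LSeries.term (fun n ↦ (r n : ℂ)) s n +
      (κ * (N : ℂ) ^ (1 - s) / (s - 1) +
        s * mellin (fun t ↦ (tailRemainder r κ N t : ℂ)) (-s)) := by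
  have key : ∀ s : ℂ, 1 < s.re → Z s =
      ∑ n ∈ Finset.Icc 1 N, LSeries.term (fun n ↦ (r n : ℂ)) s n +
      (κ * (N : ℂ) ^ (1 - s) / (s - 1) +
        s * mellin (fun t ↦ (tailRemainder r κ N t : ℂ)) (-s)) := fun s hs ↦ by
    rw [hZr s hs, LSeries_eq_sum_add_LSeries_ite_lt hr hδ₀ hC h N hs,
      LSeries_ite_lt_eq hr hδ₀ hδ hC h hN hs]
  rcases hs' with him | hre
  swap
  · exact key s hre
  have hNc : (N : ℂ) ≠ 0 := Nat.cast_ne_zero.mpr (by omega)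
  set U : Set ℂ := {z | 1 - δ < z.re} ∩ {z | 0 < z.im}
  have hUo : IsOpen U := (isOpen_lt continuous_const continuous_re).inter
    (isOpen_lt continuous_const continuous_im)
  have hUc : Convex ℝ U := (convex_halfSpace_re_gt _).inter (convex_halfSpace_im_gt _)
  have hne : ∀ z ∈ U, z - 1 ≠ 0 := fun z hz h0 ↦ by
    have := hz.2
    rw [sub_eq_zero.mp h0] at this
    simp at this
  refine AnalyticOnNhd.eqOn_of_preconnected_of_eventuallyEq (𝕜 := ℂ) (U := U) (f := Z)
    (g := fun s ↦ ∑ n ∈ Finset.Icc 1 N, LSeries.term (fun n ↦ (r n : ℂ)) s n +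
      (κ * (N : ℂ) ^ (1 - s) / (s - 1) +
        s * mellin (fun t ↦ (tailRemainder r κ N t : ℂ)) (-s))) ?_ ?_ hUc.isPreconnected
    (z₀ := 2 + I) ?_ ?_ ⟨hs, him⟩
  · exact DifferentiableOn.analyticOnNhd (fun z hz ↦
      (hZ z (sub_ne_zero.mp (hne z hz))).differentiableWithinAt) hUo
  · refine DifferentiableOn.analyticOnNhd (fun z hz ↦
      DifferentiableAt.differentiableWithinAt ?_) hUo
    refine DifferentiableAt.add (DifferentiableAt.fun_sum fun n _ ↦
      (LSeries.hasDerivAt_term _ n z).differentiableAt) (DifferentiableAt.add ?_ ?_)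
    · refine DifferentiableAt.div (DifferentiableAt.const_mul ?_ _) (by fun_prop) (hne z hz)
      exact DifferentiableAt.const_cpow (by fun_prop) (Or.inl hNc)
    · refine differentiableAt_id.mul ?_
      have hm : DifferentiableAt ℂ (mellin fun t ↦ (tailRemainder r κ N t : ℂ)) (-z) :=
        differentiableAt_mellin_tailRemainder hδ hC h hN (neg_lt_neg hz.1)
      exact DifferentiableAt.comp (g := mellin fun t ↦ (tailRemainder r κ N t : ℂ)) z hm
        differentiableAt_id.neg
  · constructor
    · simp only [Set.mem_ofPred_eq, add_re, I_re, re_ofNat]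
      linarith
    · simp
  · have : {z : ℂ | 1 < z.re} ∈ nhds (2 + I) :=
      (isOpen_lt continuous_const continuous_re).mem_nhds (by simp)
    filter_upwards [this] with z hz using key z hz

/-- Approximation of an `L`-series by a partial sum, to the left of the line `re s = 1`. -/
theorem norm_sub_sum_sub_le (hr : ∀ n, 0 ≤ r n) (hδ₀ : 0 < δ) (hδ : δ ≤ 1) (hC : 0 ≤ C)
    (h : ∀ x : ℝ, 1 ≤ x → |summatory r x - κ * x| ≤ C * x ^ (1 - δ))
    (hZ : ∀ s ≠ 1, DifferentiableAt ℂ Z s)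
    (hZr : ∀ s : ℂ, 1 < s.re → Z s = LSeries (fun n ↦ (r n : ℂ)) s) {N : ℕ} (hN : 1 ≤ N) {s : ℂ}
    (hs : 1 - δ < s.re) (hs' : 0 < s.im ∨ 1 < s.re) :
    ‖Z s - ∑ n ∈ Finset.Icc 1 N, LSeries.term (fun n ↦ (r n : ℂ)) s n -
      κ * (N : ℂ) ^ (1 - s) / (s - 1)‖ ≤
      ‖s‖ * (2 * C * ((N : ℝ) ^ (1 - δ - s.re) / (s.re - (1 - δ)))) := by
  rw [eq_sum_add_mellin hr hδ₀ hδ hC h hZ hZr hN hs hs', add_sub_cancel_left, add_sub_cancel_left,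
    norm_mul]
  exact mul_le_mul_of_nonneg_left (norm_mellin_tailRemainder_le hδ hC h hN hs) (norm_nonneg _)

end DirichletApproximation

section ZetaBounds

theorem norm_LSeries_ofReal {g : ℕ → ℝ} (hg : ∀ n, 0 ≤ g n) {σ : ℝ} :
    ‖LSeries (fun n ↦ (g n : ℂ)) σ‖ = ∑' n, ‖LSeries.term (fun n ↦ (g n : ℂ)) σ n‖ := by
  have h : ∀ n, LSeries.term (fun n ↦ (g n : ℂ)) σ n =
      ((‖LSeries.term (fun n ↦ (g n : ℂ)) σ n‖ : ℝ) : ℂ) := fun n ↦ by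
    rcases eq_or_ne n 0 with rfl | hn
    · simp
    · rw [LSeries.norm_term_eq, if_neg hn, LSeries.term_of_ne_zero hn, ofReal_re, norm_real,
        Real.norm_of_nonneg (hg n), ofReal_div, ofReal_cpow n.cast_nonneg, ofReal_natCast]
  rw [LSeries, tsum_congr h, ← ofReal_tsum, norm_real,
    Real.norm_of_nonneg (tsum_nonneg fun _ ↦ norm_nonneg _)]

theorem LSeries.norm_term_re (f : ℕ → ℂ) (s : ℂ) (n : ℕ) :
    ‖LSeries.term f (s.re : ℂ) n‖ = ‖LSeries.term f s n‖ := by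
  rw [LSeries.norm_term_eq, LSeries.norm_term_eq, ofReal_re]

theorem LSeriesSummable.of_norm_le_ofReal {f : ℕ → ℂ} {g : ℕ → ℝ} (hfg : ∀ n, ‖f n‖ ≤ g n) {s : ℂ}
    (hs : LSeriesSummable (fun n ↦ (g n : ℂ)) s) : LSeriesSummable f s :=
  Summable.of_norm_bounded hs.norm fun n ↦ LSeries.norm_term_le s (by
    rw [norm_real]
    exact (hfg n).trans (le_abs_self _))

theorem norm_LSeries_le {f : ℕ → ℂ} {g : ℕ → ℝ} (hfg : ∀ n, ‖f n‖ ≤ g n) {s : ℂ}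
    (hs : LSeriesSummable (fun n ↦ (g n : ℂ)) s) :
    ‖LSeries f s‖ ≤ ‖LSeries (fun n ↦ (g n : ℂ)) s.re‖ := by
  rw [norm_LSeries_ofReal fun n ↦ (norm_nonneg _).trans (hfg n)]
  simp_rw [LSeries.norm_term_re]
  refine (norm_tsum_le_tsum_norm (LSeriesSummable.of_norm_le_ofReal hfg hs).norm).trans ?_
  exact (LSeriesSummable.of_norm_le_ofReal hfg hs).norm.tsum_le_tsum (fun n ↦
    LSeries.norm_term_le s (by
      rw [norm_real]
      exact (hfg n).trans (le_abs_self _))) hs.norm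

variable {r : ℕ → ℝ} {κ δ C : ℝ} {Z : ℂ → ℂ}

theorem LSeriesSummable_of_summatory (hr : ∀ n, 0 ≤ r n) (hδ₀ : 0 < δ) (hC : 0 ≤ C)
    (h : ∀ x : ℝ, 1 ≤ x → |summatory r x - κ * x| ≤ C * x ^ (1 - δ)) {s : ℂ} (hs : 1 < s.re) :
    LSeriesSummable (fun n ↦ (r n : ℂ)) s := by
  refine (LSeriesSummable_congr s fun {n} hn ↦ ?_).mp (LSeriesSummable_ite_lt hr hδ₀ hC h 0 hs)
  rw [if_pos (Nat.pos_of_ne_zero hn)]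

theorem abscissaOfAbsConv_lt_of_summatory (hr : ∀ n, 0 ≤ r n) (hδ₀ : 0 < δ) (hC : 0 ≤ C)
    (h : ∀ x : ℝ, 1 ≤ x → |summatory r x - κ * x| ≤ C * x ^ (1 - δ)) {s : ℂ} (hs : 1 < s.re) :
    LSeries.abscissaOfAbsConv (fun n ↦ (r n : ℂ)) < s.re := by
  refine lt_of_le_of_lt (LSeries.abscissaOfAbsConv_le_of_forall_lt_LSeriesSummable (x := 1)
    fun y hy ↦ LSeriesSummable_of_summatory hr hδ₀ hC h (by simpa using hy)) ?_
  exact_mod_cast hs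

theorem norm_sub_one_sub_le (hr : ∀ n, 0 ≤ r n) (hr1 : r 1 = 1) (hδ₀ : 0 < δ) (hδ : δ ≤ 1)
    (hC : 0 ≤ C) (h : ∀ x : ℝ, 1 ≤ x → |summatory r x - κ * x| ≤ C * x ^ (1 - δ))
    (hZ : ∀ s ≠ 1, DifferentiableAt ℂ Z s)
    (hZr : ∀ s : ℂ, 1 < s.re → Z s = LSeries (fun n ↦ (r n : ℂ)) s) {s : ℂ}
    (hs : 1 - δ < s.re) (hs' : 0 < s.im ∨ 1 < s.re) :
    ‖Z s - 1 - κ / (s - 1)‖ ≤ ‖s‖ * (2 * C / (s.re - (1 - δ))) := by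
  have := norm_sub_sum_sub_le hr hδ₀ hδ hC h hZ hZr le_rfl hs hs'
  simpa [LSeries.term_of_ne_zero, hr1, ← div_eq_mul_inv] using this

theorem one_le_norm_LSeries (hr : ∀ n, 0 ≤ r n) (hr1 : r 1 = 1) {σ : ℝ}
    (hs : LSeriesSummable (fun n ↦ (r n : ℂ)) σ) : 1 ≤ ‖LSeries (fun n ↦ (r n : ℂ)) σ‖ := by
  rw [norm_LSeries_ofReal hr]
  refine le_trans (le_of_eq ?_) (hs.norm.le_tsum 1 fun _ _ ↦ norm_nonneg _)
  simp [LSeries.term_of_ne_zero, hr1]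

theorem LSeries_mul_eq_of_convolution {f g k : ℕ → ℝ}
    (hfg : ∀ n ≠ 0, ∑ x ∈ n.divisorsAntidiagonal, f x.1 * g x.2 = k n) {s : ℂ}
    (hf : LSeriesSummable (fun n ↦ (f n : ℂ)) s) (hg : LSeriesSummable (fun n ↦ (g n : ℂ)) s) :
    LSeries (fun n ↦ (f n : ℂ)) s * LSeries (fun n ↦ (g n : ℂ)) s =
      LSeries (fun n ↦ (k n : ℂ)) s := by
  rw [← LSeries_convolution' hf hg]
  refine LSeries_congr (fun {n} hn ↦ ?_) s
  rw [LSeries.convolution_def, ← hfg n hn, ofReal_sum]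
  simp_rw [ofReal_mul]

/-- Bounds near the line `re s = 1` for a Dirichlet series with nonnegative coefficients whose
inverse and logarithmic derivative are controlled by Möbius and von Mangoldt functions. -/
theorem exists_bounds_of_one_lt_re {m Λ : ℕ → ℝ} (hr : ∀ n, 0 ≤ r n) (hr1 : r 1 = 1)
    (hm : ∀ n, |m n| ≤ r n)
    (hrm : ∀ n ≠ 0, ∑ x ∈ n.divisorsAntidiagonal, r x.1 * m x.2 = if n = 1 then 1 else 0)
    (hΛ : ∀ n, 0 ≤ Λ n) (hΛr : ∀ n, Λ n ≤ r n * Real.log n)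
    (hrΛ : ∀ n ≠ 0, ∑ x ∈ n.divisorsAntidiagonal, r x.1 * Λ x.2 = r n * Real.log n)
    (hκ : 0 < κ) (hδ₀ : 0 < δ) (hδ : δ ≤ 1)
    (hC : 0 ≤ C) (h : ∀ x : ℝ, 1 ≤ x → |summatory r x - κ * x| ≤ C * x ^ (1 - δ))
    (hZ : ∀ s ≠ 1, DifferentiableAt ℂ Z s)
    (hZr : ∀ s : ℂ, 1 < s.re → Z s = LSeries (fun n ↦ (r n : ℂ)) s) :
    ∃ A > (0 : ℝ), ∀ s : ℂ, 1 < s.re → s.re ≤ 3 → Z s ≠ 0 ∧ ‖(Z s)⁻¹‖ ≤ A / (s.re - 1) ∧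
      ‖deriv Z s / Z s‖ ≤ A / (s.re - 1) := by
  set B : ℝ := 4 * (2 * C / δ)
  have hB : 0 ≤ B := by positivity
  have hsum : ∀ s : ℂ, 1 < s.re → LSeriesSummable (fun n ↦ (r n : ℂ)) s := fun s hs ↦
    LSeriesSummable_of_summatory hr hδ₀ hC h hs
  have hreal : ∀ σ : ℝ, 1 < σ → σ ≤ 4 → ‖Z σ - 1 - κ / (σ - 1)‖ ≤ B := fun σ h1 h4 ↦ by
    have hσ : (1 : ℝ) < (σ : ℂ).re := h1
    refine (norm_sub_one_sub_le hr hr1 hδ₀ hδ hC h hZ hZr (by linarith) (Or.inr hσ)).trans ?_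
    rw [norm_real, Real.norm_of_nonneg (by linarith), ofReal_re]
    refine mul_le_mul h4 ?_ (div_nonneg (by positivity) (by linarith)) (by norm_num)
    exact div_le_div_of_nonneg_left (by positivity) hδ₀ (by linarith)
  have hκn : ∀ σ : ℝ, 1 < σ → ‖(κ : ℂ) / (σ - 1)‖ = κ / (σ - 1) := fun σ h1 ↦ by
    rw [← ofReal_one, ← ofReal_sub, ← ofReal_div, norm_real,
      Real.norm_of_nonneg (div_nonneg hκ.le (by linarith))]
  set A₁ : ℝ := κ + 3 * (1 + B)
  have hupper : ∀ σ : ℝ, 1 < σ → σ ≤ 4 → ‖Z σ‖ ≤ A₁ / (σ - 1) := fun σ h1 h4 ↦ by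
    have h0 : 0 < σ - 1 := by linarith
    have e : Z σ = (Z σ - 1 - κ / (σ - 1)) + (1 + κ / (σ - 1)) := by ring
    have h2 : ‖Z σ‖ ≤ B + (1 + κ / (σ - 1)) := by
      rw [e]
      refine (norm_add_le _ _).trans (add_le_add (hreal σ h1 h4) ((norm_add_le _ _).trans ?_))
      rw [norm_one, hκn σ h1]
    refine h2.trans ?_
    rw [le_div_iff₀ h0, add_mul, add_mul, div_mul_cancel₀ _ h0.ne']
    simp only [A₁]
    nlinarith
  have hlower : ∀ σ : ℝ, 1 < σ → σ ≤ 4 → κ / (2 + B) / (σ - 1) ≤ ‖Z σ‖ := fun σ h1 h4 ↦ by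
    have h0 : 0 < σ - 1 := by linarith
    have h2 : 1 ≤ ‖Z σ‖ := by
      rw [hZr σ h1]
      exact one_le_norm_LSeries hr hr1 (hsum _ h1)
    have h3 : κ / (σ - 1) ≤ ‖Z σ‖ + 1 + B := by
      rw [← hκn σ h1]
      have e : (κ : ℂ) / (σ - 1) = Z σ - 1 - (Z σ - 1 - κ / (σ - 1)) := by ring
      rw [e]
      refine (norm_sub_le _ _).trans (add_le_add ((norm_sub_le _ _).trans ?_) (hreal σ h1 h4))
      rw [norm_one]
    rw [div_div, mul_comm, ← div_div, div_le_iff₀ (by positivity)]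
    nlinarith
  have hZle : ∀ s : ℂ, 1 < s.re → ‖Z s‖ ≤ ‖Z s.re‖ := fun s hs ↦ by
    rw [hZr s hs, hZr s.re hs]
    exact norm_LSeries_le (fun n ↦ by rw [norm_real, Real.norm_of_nonneg (hr n)]) (hsum s hs)
  have hinv : ∀ s : ℂ, 1 < s.re → Z s * LSeries (fun n ↦ (m n : ℂ)) s = 1 := fun s hs ↦ by
    rw [hZr s hs, LSeries_mul_eq_of_convolution (k := fun n ↦ if n = 1 then 1 else 0)
      hrm (hsum s hs) (LSeriesSummable.of_norm_le_ofReal (fun n ↦ by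
        rw [norm_real]
        exact hm n) (hsum s hs))]
    refine Eq.trans ?_ (congrFun LSeries_delta s)
    refine LSeries_congr (fun {n} hn ↦ ?_) s
    rw [LSeries.delta]
    split_ifs <;> simp
  have hlogsum : ∀ s : ℂ, 1 < s.re → LSeriesSummable (fun n ↦ ((r n * Real.log n : ℝ) : ℂ)) s :=
    fun s hs ↦ by
      have := LSeriesSummable_logMul_of_lt_re (abscissaOfAbsConv_lt_of_summatory hr hδ₀ hC h hs)
      refine (LSeriesSummable_congr s fun {n} hn ↦ ?_).mp this
      rw [LSeries.logMul, ofReal_mul, mul_comm, natCast_log]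
  have hderiv : ∀ s : ℂ, 1 < s.re → deriv Z s = -LSeries (fun n ↦ ((r n * Real.log n : ℝ) : ℂ)) s :=
    fun s hs ↦ by
      have h1 := LSeries_hasDerivAt (abscissaOfAbsConv_lt_of_summatory hr hδ₀ hC h hs)
      have h2 : Z =ᶠ[nhds s] LSeries (fun n ↦ (r n : ℂ)) := by
        filter_upwards [(isOpen_lt continuous_const continuous_re).mem_nhds hs] with z hz using
          hZr z hz
      rw [h2.deriv_eq, h1.deriv]
      congr 1
      refine LSeries_congr (fun {n} hn ↦ ?_) s
      rw [LSeries.logMul, ofReal_mul, mul_comm, natCast_log]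
  have hΛsum : ∀ s : ℂ, 1 < s.re → LSeriesSummable (fun n ↦ (Λ n : ℂ)) s := fun s hs ↦
    LSeriesSummable.of_norm_le_ofReal (fun n ↦ by
      rw [norm_real, Real.norm_of_nonneg (hΛ n)]
      exact hΛr n) (hlogsum s hs)
  have hne : ∀ s : ℂ, 1 < s.re → Z s ≠ 0 := fun s hs h0 ↦ by
    have := hinv s hs
    rw [h0, zero_mul] at this
    exact zero_ne_one this
  have hlogderiv : ∀ s : ℂ, 1 < s.re → deriv Z s / Z s = -LSeries (fun n ↦ (Λ n : ℂ)) s :=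
    fun s hs ↦ by
      rw [div_eq_iff (hne s hs), hderiv s hs, neg_mul, mul_comm, hZr s hs,
        LSeries_mul_eq_of_convolution (k := fun n ↦ r n * Real.log n) hrΛ (hsum s hs) (hΛsum s hs)]
  have hA₁ : 0 < A₁ := by positivity
  have hdle : ∀ σ : ℝ, 1 < σ → σ ≤ 3 → ‖deriv Z σ‖ ≤ 4 * A₁ / (σ - 1) ^ 2 := fun σ h1 h3 ↦ by
    have h0 : 0 < (σ - 1) / 2 := by linarith
    have hre : ∀ z : ℂ, z ∈ Metric.closedBall (σ : ℂ) ((σ - 1) / 2) →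
        (σ - 1) / 2 ≤ z.re - 1 ∧ z.re ≤ 4 := fun z hz ↦ by
      have h5 := (abs_re_le_norm (z - σ)).trans (mem_closedBall_iff_norm.mp hz)
      rw [sub_re, ofReal_re, abs_le] at h5
      constructor <;> linarith [h5.1, h5.2]
    have hd : DiffContOnCl ℂ Z (Metric.ball (σ : ℂ) ((σ - 1) / 2)) := by
      refine DifferentiableOn.diffContOnCl fun z hz ↦ (hZ z ?_).differentiableWithinAt
      rintro rfl
      have := (hre 1 (Metric.closure_ball_subset_closedBall hz)).1
      rw [one_re] at this
      linarith
    have := norm_deriv_le_of_forall_mem_sphere_norm_le (C := A₁ / ((σ - 1) / 2)) h0 hd fun z hz ↦ by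
      obtain ⟨h5, h6⟩ := hre z (Metric.sphere_subset_closedBall hz)
      have h7 : 1 < z.re := by linarith
      refine (hZle z h7).trans ((hupper _ h7 h6).trans ?_)
      exact div_le_div_of_nonneg_left hA₁.le h0 h5
    refine this.trans (le_of_eq ?_)
    field_simp
    norm_num
  set A₂ : ℝ := 4 * A₁ / (κ / (2 + B))
  have hA₂ : 0 < A₂ := by positivity
  refine ⟨max A₁ A₂, lt_max_of_lt_left hA₁, fun s hs hs3 ↦ ⟨hne s hs, ?_, ?_⟩⟩
  · have h0 : 0 < s.re - 1 := by linarith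
    rw [inv_eq_of_mul_eq_one_right (hinv s hs)]
    refine (norm_LSeries_le (fun n ↦ ?_) (hsum s hs)).trans ?_
    · rw [norm_real]
      exact hm n
    · rw [← hZr s.re hs]
      exact (hupper _ hs (by linarith)).trans (div_le_div_of_nonneg_right (le_max_left _ _) h0.le)
  · have h0 : 0 < s.re - 1 := by linarith
    rw [hlogderiv s hs, norm_neg]
    refine (norm_LSeries_le (fun n ↦ ?_) (hΛsum s hs)).trans ?_
    · rw [norm_real, Real.norm_of_nonneg (hΛ n)]
    · rw [← norm_neg, ← hlogderiv s.re hs, norm_div]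
      refine (div_le_div₀ (by positivity) (hdle _ hs hs3) (by positivity)
        (hlower _ hs (by linarith))).trans ?_
      refine le_trans (le_of_eq ?_) (div_le_div_of_nonneg_right (le_max_right A₁ A₂) h0.le)
      simp only [A₂]
      field_simp

end ZetaBounds

section MeanValue

theorem integral_cexp_mul_gaussian {R : ℝ} (hR : 0 < R) (u : ℝ) :
    Integrable (fun t : ℝ ↦ cexp (I * u * t) * cexp (-((R ^ 2)⁻¹ : ℝ) * t ^ 2)) ∧
      ‖∫ t : ℝ, cexp (I * u * t) * cexp (-((R ^ 2)⁻¹ : ℝ) * t ^ 2)‖ =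
        R * √Real.pi * Real.exp (-(R * u) ^ 2 / 4) := by
  have hb : 0 < (((R ^ 2)⁻¹ : ℝ) : ℂ).re := by
    rw [ofReal_re]
    positivity
  refine ⟨?_, ?_⟩
  · refine (integrable_cexp_quadratic hb (I * u) 0).congr (Eventually.of_forall fun t ↦ ?_)
    simp only [← exp_add]
    congr 1
    ring
  · rw [fourierIntegral_gaussian hb, norm_mul]
    congr 1
    · rw [← ofReal_div, show (1 / 2 : ℂ) = ((1 / 2 : ℝ) : ℂ) by norm_num,
        ← ofReal_cpow (by positivity), norm_real, Real.norm_of_nonneg (by positivity),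
        ← Real.sqrt_eq_rpow, div_inv_eq_mul, Real.sqrt_mul Real.pi_pos.le, Real.sqrt_sq hR.le,
        mul_comm]
    · rw [norm_exp]
      congr 1
      rw [← ofReal_pow, ← ofReal_neg, show (4 : ℂ) = ((4 : ℝ) : ℂ) by norm_num, ← ofReal_mul,
        ← ofReal_div, ofReal_re]
      field_simp

theorem integral_norm_sq_mul_gaussian_le {R : ℝ} (hR : 0 < R) (S : Finset ℕ) (c : ℕ → ℂ)
    (l : ℕ → ℝ) :
    Integrable (fun t : ℝ ↦ ‖∑ n ∈ S, c n * cexp (I * l n * t)‖ ^ 2 *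
      Real.exp (-(R ^ 2)⁻¹ * t ^ 2)) ∧
    ∫ t : ℝ, ‖∑ n ∈ S, c n * cexp (I * l n * t)‖ ^ 2 * Real.exp (-(R ^ 2)⁻¹ * t ^ 2) ≤
      ∑ n ∈ S, ∑ m ∈ S, ‖c n‖ * ‖c m‖ *
        (R * √Real.pi * Real.exp (-(R * (l n - l m)) ^ 2 / 4)) := by
  set G : ℝ → ℂ := fun t ↦ ∑ n ∈ S, ∑ m ∈ S, c n * (starRingEnd ℂ) (c m) *
    (cexp (I * (l n - l m : ℝ) * t) * cexp (-((R ^ 2)⁻¹ : ℝ) * t ^ 2))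
  have hG : ∀ t : ℝ, ((‖∑ n ∈ S, c n * cexp (I * l n * t)‖ ^ 2 *
      Real.exp (-(R ^ 2)⁻¹ * t ^ 2) : ℝ) : ℂ) = G t := fun t ↦ by
    rw [ofReal_mul, ofReal_pow, ← mul_conj', map_sum, Finset.sum_mul_sum, Finset.sum_mul]
    refine Finset.sum_congr rfl fun n _ ↦ ?_
    rw [Finset.sum_mul]
    refine Finset.sum_congr rfl fun m _ ↦ ?_
    rw [map_mul, ← exp_conj]
    have : cexp (I * (l n - l m : ℝ) * t) =
        cexp (I * l n * t) * cexp ((starRingEnd ℂ) (I * l m * t)) := by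
      rw [← exp_add]
      congr 1
      simp only [map_mul, conj_I, conj_ofReal, ofReal_sub]
      ring
    rw [this, ofReal_exp]
    push_cast
    ring
  have hinteg : ∀ n ∈ S, ∀ m ∈ S, Integrable (fun t : ℝ ↦ c n * (starRingEnd ℂ) (c m) *
      (cexp (I * (l n - l m : ℝ) * t) * cexp (-((R ^ 2)⁻¹ : ℝ) * t ^ 2))) := fun n _ m _ ↦
    (integral_cexp_mul_gaussian hR _).1.const_mul _
  have hGi : Integrable G := integrable_finsetSum _ fun n hn ↦ integrable_finsetSum _ fun m hm ↦
    hinteg n hn m hm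
  constructor
  · refine hGi.re.congr (Eventually.of_forall fun t ↦ ?_)
    simp only [← hG t]
    exact ofReal_re _
  · have h0 : 0 ≤ ∫ t : ℝ, ‖∑ n ∈ S, c n * cexp (I * l n * t)‖ ^ 2 *
        Real.exp (-(R ^ 2)⁻¹ * t ^ 2) := integral_nonneg fun t ↦ by positivity
    rw [← Real.norm_of_nonneg h0, ← norm_real, ← integral_complex_ofReal, integral_congr_ae
      (Eventually.of_forall hG), integral_finsetSum _ fun n hn ↦ integrable_finsetSum _ fun m hm ↦
      hinteg n hn m hm]
    refine (norm_sum_le _ _).trans (Finset.sum_le_sum fun n hn ↦ ?_)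
    rw [integral_finsetSum _ fun m hm ↦ hinteg n hn m hm]
    refine (norm_sum_le _ _).trans (Finset.sum_le_sum fun m hm ↦ ?_)
    rw [integral_const_mul, norm_mul, norm_mul, RCLike.norm_conj,
      (integral_cexp_mul_gaussian hR _).2]

theorem one_add_mul_abs_sub_div_le_exp {R : ℝ} (hR : 1 ≤ R) {x y : ℝ} (hx : 0 < x) (hy : 0 < y) :
    1 + R * (|x - y| / x) ≤ Real.exp (R * |Real.log x - Real.log y|) := by
  have key : ∀ u v : ℝ, 0 < u → u ≤ v →
      1 + R * ((v - u) / u) ≤ Real.exp (R * (Real.log v - Real.log u)) := fun u v hu huv ↦ by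
    have hv := hu.trans_le huv
    have h1 : (0 : ℝ) ≤ (v - u) / u := div_nonneg (by linarith) hu.le
    refine (one_add_mul_self_le_rpow_one_add (by linarith) hR).trans (le_of_eq ?_)
    rw [Real.rpow_def_of_pos (by linarith), ← Real.log_div hv.ne' hu.ne', mul_comm]
    congr 3
    field_simp
    ring
  rcases le_total x y with hxy | hxy
  · rw [abs_sub_comm, abs_of_nonneg (sub_nonneg.mpr hxy), abs_sub_comm,
      abs_of_nonneg (sub_nonneg.mpr (Real.log_le_log hx hxy))]
    exact key x y hx hxy
  · rw [abs_of_nonneg (sub_nonneg.mpr hxy),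
      abs_of_nonneg (sub_nonneg.mpr (Real.log_le_log hy hxy))]
    refine le_trans ?_ (key y x hy hxy)
    have : (x - y) / x ≤ (x - y) / y := div_le_div_of_nonneg_left (by linarith) hy hxy
    nlinarith

theorem exp_neg_sq_log_sub_le {R : ℝ} (hR : 1 ≤ R) {x y : ℝ} (hx : 0 < x) (hy : 0 < y) :
    Real.exp (-(R * (Real.log x - Real.log y)) ^ 2 / 4) ≤
      Real.exp 4 * ((1 + R / x * |x - y|) ^ 2)⁻¹ := by
  have h1 := one_add_mul_abs_sub_div_le_exp hR hx hy
  have h0 : 0 < 1 + R / x * |x - y| := by positivity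
  rw [show R * (|x - y| / x) = R / x * |x - y| by ring] at h1
  have h2 := inv_anti₀ (pow_pos h0 2) (pow_le_pow_left₀ h0.le h1 2)
  refine le_trans ?_ (mul_le_mul_of_nonneg_left h2 (Real.exp_pos _).le)
  rw [← Real.exp_nat_mul, ← Real.exp_neg, ← Real.exp_add, Real.exp_le_exp]
  have h3 : (R * (Real.log x - Real.log y)) ^ 2 = (R * |Real.log x - Real.log y|) ^ 2 := by
    rw [mul_pow, mul_pow, sq_abs]
  rw [h3]
  push_cast
  nlinarith [sq_nonneg (R * |Real.log x - Real.log y| - 4)]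

theorem sum_range_inv_one_add_mul_sq_le {x : ℝ} (hx : 0 < x) (M : ℕ) :
    ∑ k ∈ Finset.range M, ((1 + x * k) ^ 2)⁻¹ ≤ 1 + x⁻¹ := by
  have key : ∀ M : ℕ, ∑ k ∈ Finset.range (M + 1), ((1 + x * k) ^ 2)⁻¹ ≤
      1 + x⁻¹ * (1 - (1 + x * M)⁻¹) := fun M ↦ by
    induction M with
    | zero => simp
    | succ M ih =>
      rw [Finset.sum_range_succ]
      refine (add_le_add_left ih _).trans ?_
      have h1 : 0 < 1 + x * M := by positivity
      have h2 : 0 < 1 + x * (M + 1) := by positivity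
      have h3 : x⁻¹ * ((1 + x * M)⁻¹ - (1 + x * (M + 1))⁻¹) =
          ((1 + x * M) * (1 + x * (M + 1)))⁻¹ := by
        field_simp
        ring
      have h4 : ((1 + x * (M + 1)) ^ 2)⁻¹ ≤ ((1 + x * M) * (1 + x * (M + 1)))⁻¹ := by
        refine inv_anti₀ (by positivity) ?_
        nlinarith
      push_cast
      linarith
  refine (Finset.sum_le_sum_of_subset_of_nonneg (Finset.range_mono M.le_succ)
    fun _ _ _ ↦ by positivity).trans ((key M).trans ?_)
  have : 0 ≤ (1 + x * M)⁻¹ := by positivity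
  have := inv_pos.mpr hx
  nlinarith

theorem sum_inv_one_add_mul_abs_sub_sq_le {x : ℝ} (hx : 0 < x) (S : Finset ℕ) (n : ℕ) :
    ∑ m ∈ S, ((1 + x * |(n : ℝ) - m|) ^ 2)⁻¹ ≤ 2 * (1 + x⁻¹) := by
  have hsub : ∀ S' : Finset ℕ, ∑ k ∈ S', ((1 + x * k) ^ 2)⁻¹ ≤ 1 + x⁻¹ := fun S' ↦
    (Finset.sum_le_sum_of_subset_of_nonneg S'.subset_range_sup_succ
      fun _ _ _ ↦ by positivity).trans (sum_range_inv_one_add_mul_sq_le hx _)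
  rw [← Finset.sum_filter_add_sum_filter_not S (fun m ↦ m ≤ n), two_mul]
  refine add_le_add ?_ ?_
  · refine le_trans (le_of_eq ?_) (hsub ((S.filter (fun m ↦ m ≤ n)).image (fun m ↦ n - m)))
    rw [Finset.sum_image]
    · refine Finset.sum_congr rfl fun m hm ↦ ?_
      have hmn := (Finset.mem_filter.mp hm).2
      rw [Nat.cast_sub hmn, abs_of_nonneg (sub_nonneg.mpr (by exact_mod_cast hmn))]
    · intro a ha b hb hab
      have h1 := (Finset.mem_filter.mp (Finset.mem_coe.mp ha)).2
      have h2 := (Finset.mem_filter.mp (Finset.mem_coe.mp hb)).2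
      simp only at hab
      omega
  · refine le_trans (le_of_eq ?_) (hsub ((S.filter (fun m ↦ ¬ m ≤ n)).image (fun m ↦ m - n)))
    rw [Finset.sum_image]
    · refine Finset.sum_congr rfl fun m hm ↦ ?_
      have hmn := (not_le.mp (Finset.mem_filter.mp hm).2).le
      rw [Nat.cast_sub hmn, abs_sub_comm, abs_of_nonneg (sub_nonneg.mpr (by exact_mod_cast hmn))]
    · intro a ha b hb hab
      have h1 := (Finset.mem_filter.mp (Finset.mem_coe.mp ha)).2
      have h2 := (Finset.mem_filter.mp (Finset.mem_coe.mp hb)).2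
      simp only at hab
      omega

/-- A mean value theorem for Dirichlet polynomials. -/
theorem exists_lintegral_enorm_sq_le : ∃ C > (0 : ℝ), ∀ R : ℝ, 1 ≤ R → ∀ (S : Finset ℕ),
    0 ∉ S → ∀ c : ℕ → ℂ,
    ∫⁻ t in Set.Icc (-R) R, ENNReal.ofReal (‖∑ n ∈ S, c n * cexp (I * Real.log n * t)‖ ^ 2) ≤
      ENNReal.ofReal (C * ∑ n ∈ S, (R + n) * ‖c n‖ ^ 2) := by
  refine ⟨Real.exp 1 * (√Real.pi * (Real.exp 4 * 2)), by positivity, fun R hR S hS c ↦ ?_⟩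
  have hR0 : 0 < R := by linarith
  obtain ⟨hinteg, hle⟩ := integral_norm_sq_mul_gaussian_le hR0 S c (fun n ↦ Real.log n)
  set F : ℝ → ℝ := fun t ↦ ‖∑ n ∈ S, c n * cexp (I * Real.log n * t)‖ ^ 2 *
      Real.exp (-(R ^ 2)⁻¹ * t ^ 2)
  have hF0 : ∀ t, 0 ≤ F t := fun t ↦ by positivity
  have hpt : ∀ t ∈ Set.Icc (-R) R,
      ‖∑ n ∈ S, c n * cexp (I * Real.log n * t)‖ ^ 2 ≤ Real.exp 1 * F t := fun t ht ↦ by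
    have h1 : (R ^ 2)⁻¹ * t ^ 2 ≤ 1 := by
      rw [inv_mul_le_iff₀ (by positivity), mul_one]
      exact sq_le_sq' ht.1 ht.2
    have h2 : 1 ≤ Real.exp 1 * Real.exp (-(R ^ 2)⁻¹ * t ^ 2) := by
      rw [← Real.exp_add]
      exact Real.one_le_exp (by linarith)
    have h3 : 0 ≤ ‖∑ n ∈ S, c n * cexp (I * Real.log n * t)‖ ^ 2 := by positivity
    simp only [F]
    nlinarith
  have hsum : ∫ t, F t ≤ √Real.pi * (Real.exp 4 * 2) * ∑ n ∈ S, (R + n) * ‖c n‖ ^ 2 := by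
    set K : ℕ → ℕ → ℝ := fun n m ↦
      R * √Real.pi * Real.exp (-(R * (Real.log n - Real.log m)) ^ 2 / 4)
    have hK0 : ∀ n m, 0 ≤ K n m := fun n m ↦ by positivity
    have hKs : ∀ n m, K n m = K m n := fun n m ↦ by
      simp only [K]
      ring_nf
    refine hle.trans ?_
    have h1 : ∑ n ∈ S, ∑ m ∈ S, ‖c n‖ * ‖c m‖ * K n m ≤
        ∑ n ∈ S, ∑ m ∈ S, (‖c n‖ ^ 2 / 2 * K n m + ‖c m‖ ^ 2 / 2 * K n m) :=
      Finset.sum_le_sum fun n _ ↦ Finset.sum_le_sum fun m _ ↦ by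
        rw [← add_mul]
        refine mul_le_mul_of_nonneg_right ?_ (hK0 n m)
        nlinarith [sq_nonneg (‖c n‖ - ‖c m‖)]
    refine h1.trans ?_
    simp_rw [Finset.sum_add_distrib]
    rw [Finset.sum_comm (f := fun n m ↦ ‖c m‖ ^ 2 / 2 * K n m)]
    simp_rw [hKs _ _, ← Finset.sum_add_distrib, ← add_mul, add_halves, ← Finset.mul_sum]
    rw [Finset.mul_sum]
    refine Finset.sum_le_sum fun n hn ↦ ?_
    have hn0 : (0 : ℝ) < n := by
      exact_mod_cast Nat.pos_of_ne_zero fun h ↦ hS (h ▸ hn)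
    have h2 : ∑ m ∈ S, K n m ≤
        ∑ m ∈ S, R * √Real.pi * (Real.exp 4 * ((1 + R / n * |(n : ℝ) - m|) ^ 2)⁻¹) :=
      Finset.sum_le_sum fun m hm ↦ mul_le_mul_of_nonneg_left (exp_neg_sq_log_sub_le hR hn0 (by
        exact_mod_cast Nat.pos_of_ne_zero fun h ↦ hS (h ▸ hm))) (by positivity)
    have h3 := sum_inv_one_add_mul_abs_sub_sq_le (div_pos hR0 hn0) S n
    simp_rw [← Finset.mul_sum] at h2
    have h4 : ∑ m ∈ S, K n m ≤
        R * √Real.pi * (Real.exp 4 * (2 * (1 + (R / n)⁻¹))) :=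
      h2.trans (by gcongr)
    have h5 : R * √Real.pi * (Real.exp 4 * (2 * (1 + (R / n)⁻¹))) =
        √Real.pi * (Real.exp 4 * 2) * (R + n) := by
      field_simp
    rw [h5] at h4
    calc _ ≤ ‖c n‖ ^ 2 * (√Real.pi * (Real.exp 4 * 2) * (R + n)) := by
          refine mul_le_mul_of_nonneg_left ?_ (by positivity)
          simpa only [hKs] using h4
      _ = _ := by ring
  calc _ ≤ ∫⁻ t in Set.Icc (-R) R, ENNReal.ofReal (Real.exp 1 * F t) :=
        setLIntegral_mono' measurableSet_Icc fun t ht ↦ ENNReal.ofReal_le_ofReal (hpt t ht)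
    _ ≤ ∫⁻ t, ENNReal.ofReal (Real.exp 1 * F t) := setLIntegral_le_lintegral _ _
    _ = ENNReal.ofReal (Real.exp 1 * ∫ t, F t) := by
        rw [← integral_const_mul, ofReal_integral_eq_lintegral_ofReal (hinteg.const_mul _)
          (Eventually.of_forall fun t ↦ mul_nonneg (Real.exp_pos _).le (hF0 t))]
    _ ≤ _ := by
        refine ENNReal.ofReal_le_ofReal ?_
        rw [mul_assoc]
        exact mul_le_mul_of_nonneg_left hsum (Real.exp_pos _).le

end MeanValue

section Mollifier

theorem sum_Icc_rpow_sub_one_le {η : ℝ} (hη : 0 < η) (hη1 : η ≤ 1) (N : ℕ) :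
    ∑ n ∈ Finset.Icc 1 N, (n : ℝ) ^ (η - 1) ≤ (N : ℝ) ^ η / η := by
  induction N with
  | zero => simp [hη.ne']
  | succ N ih =>
    rw [Finset.sum_Icc_succ_top (by omega)]
    have hN : (0 : ℝ) < (N + 1 : ℕ) := by positivity
    have h1 : (N : ℝ) ^ η ≤ (N + 1 : ℕ) ^ η * (1 + η * (-((N + 1 : ℕ) : ℝ)⁻¹)) := by
      have h2 : (N : ℝ) = (N + 1 : ℕ) * (1 + -((N + 1 : ℕ) : ℝ)⁻¹) := by
        field_simp
        push_cast
        ring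
      have h3 : -1 ≤ -((N + 1 : ℕ) : ℝ)⁻¹ := by
        rw [neg_le_neg_iff]
        exact inv_le_one_of_one_le₀ (by simp)
      conv_lhs => rw [h2, Real.mul_rpow hN.le (by linarith)]
      exact mul_le_mul_of_nonneg_left (rpow_one_add_le_one_add_mul_self h3 hη.le hη1)
        (by positivity)
    rw [Real.rpow_sub_one hN.ne']
    rw [le_div_iff₀ hη] at ih ⊢
    rw [add_mul]
    refine (add_le_add_left ih _).trans ?_
    refine (add_le_add_left h1 _).trans (le_of_eq ?_)
    field_simp
    ring

/-- The partial sum of the Dirichlet series with coefficients `f`. -/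
noncomputable def dirichletPartialSum (f : ℕ → ℝ) (N : ℕ) (s : ℂ) : ℂ :=
  ∑ n ∈ Finset.Icc 1 N, LSeries.term (fun n ↦ (f n : ℂ)) s n

theorem differentiable_dirichletPartialSum (f : ℕ → ℝ) (N : ℕ) :
    Differentiable ℂ (dirichletPartialSum f N) := by
  unfold dirichletPartialSum
  refine Differentiable.fun_sum fun n hn ↦ ?_
  exact fun s ↦ (LSeries.hasDerivAt_term _ n s).differentiableAt

theorem LSeries_ite_le_eq_dirichletPartialSum (f : ℕ → ℝ) (N : ℕ) (s : ℂ) :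
    LSeriesSummable (fun n ↦ ((if n ≤ N then f n else 0 : ℝ) : ℂ)) s ∧
      LSeries (fun n ↦ ((if n ≤ N then f n else 0 : ℝ) : ℂ)) s = dirichletPartialSum f N s := by
  have h0 : ∀ n ∉ Finset.Icc 1 N,
      LSeries.term (fun n ↦ ((if n ≤ N then f n else 0 : ℝ) : ℂ)) s n = 0 := fun n hn ↦ by
    rcases eq_or_ne n 0 with rfl | hn0
    · simp
    · rw [LSeries.term_of_ne_zero hn0, if_neg, ofReal_zero, zero_div]
      exact fun h ↦ hn (Finset.mem_Icc.mpr ⟨by omega, h⟩)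
  refine ⟨summable_of_ne_finset_zero h0, ?_⟩
  rw [LSeries, tsum_eq_sum h0, dirichletPartialSum]
  refine Finset.sum_congr rfl fun n hn ↦ ?_
  obtain ⟨h1, h2⟩ := Finset.mem_Icc.mp hn
  rw [LSeries.term_of_ne_zero (by omega), LSeries.term_of_ne_zero (by omega), if_pos h2]

/-- The coefficients of the product of two partial sums of Dirichlet series. -/
noncomputable def truncConv (f g : ℕ → ℝ) (N X k : ℕ) : ℝ :=
  ∑ x ∈ k.divisorsAntidiagonal, (if x.1 ≤ N then f x.1 else 0) * (if x.2 ≤ X then g x.2 else 0)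

theorem truncConv_eq_zero (f g : ℕ → ℝ) {N X k : ℕ} (hk : N * X < k) : truncConv f g N X k = 0 := by
  refine Finset.sum_eq_zero fun x hx ↦ ?_
  have h1 := (Nat.mem_divisorsAntidiagonal.mp hx).1
  by_cases h2 : x.1 ≤ N
  · rw [if_neg (c := x.2 ≤ X), mul_zero]
    exact fun h3 ↦ (h1 ▸ hk).not_ge (Nat.mul_le_mul h2 h3)
  · rw [if_neg h2, zero_mul]

theorem truncConv_of_le (f g : ℕ → ℝ) {N X k : ℕ} (hN : k ≤ N) (hX : k ≤ X) :
    truncConv f g N X k = ∑ x ∈ k.divisorsAntidiagonal, f x.1 * g x.2 := by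
  refine Finset.sum_congr rfl fun x hx ↦ ?_
  obtain ⟨h1, h0⟩ := Nat.mem_divisorsAntidiagonal.mp hx
  have hd1 : x.1 ≤ k := Nat.le_of_dvd (Nat.pos_of_ne_zero h0) ⟨x.2, h1.symm⟩
  have hd2 : x.2 ≤ k := Nat.le_of_dvd (Nat.pos_of_ne_zero h0) ⟨x.1, by rw [← h1, mul_comm]⟩
  rw [if_pos (hd1.trans hN), if_pos (hd2.trans hX)]

theorem abs_truncConv_le {f g : ℕ → ℝ} (hf : ∀ n, 0 ≤ f n) (hg : ∀ n, |g n| ≤ f n) (N X k : ℕ) :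
    |truncConv f g N X k| ≤ ∑ x ∈ k.divisorsAntidiagonal, f x.1 * f x.2 := by
  refine (Finset.abs_sum_le_sum_abs _ _).trans (Finset.sum_le_sum fun x _ ↦ ?_)
  rw [abs_mul]
  refine mul_le_mul ?_ ?_ (abs_nonneg _) (hf _)
  · split_ifs
    · rw [abs_of_nonneg (hf _)]
    · simpa using hf _
  · split_ifs
    · exact hg _
    · simpa using hf _

theorem dirichletPartialSum_mul {f g : ℕ → ℝ}
    (hfg : ∀ n ≠ 0, ∑ x ∈ n.divisorsAntidiagonal, f x.1 * g x.2 = if n = 1 then 1 else 0)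
    {N X : ℕ} (hX : 1 ≤ X) (hXN : X ≤ N) (s : ℂ) :
    dirichletPartialSum f N s * dirichletPartialSum g X s =
      1 + ∑ k ∈ Finset.Ioc X (N * X), LSeries.term (fun k ↦ (truncConv f g N X k : ℂ)) s k := by
  obtain ⟨hf, hf'⟩ := LSeries_ite_le_eq_dirichletPartialSum f N s
  obtain ⟨hg, hg'⟩ := LSeries_ite_le_eq_dirichletPartialSum g X s
  have h0 : ∀ n ∉ Finset.Icc 1 (N * X),
      LSeries.term (fun k ↦ (truncConv f g N X k : ℂ)) s n = 0 := fun n hn ↦ by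
    rcases eq_or_ne n 0 with rfl | hn0
    · simp
    · rw [LSeries.term_of_ne_zero hn0, truncConv_eq_zero, ofReal_zero, zero_div]
      by_contra! h
      exact hn (Finset.mem_Icc.mpr ⟨by omega, h⟩)
  rw [← hf', ← hg', LSeries_mul_eq_of_convolution (k := truncConv f g N X) (fun n _ ↦ rfl) hf hg,
    LSeries, tsum_eq_sum h0]
  have hXNX : X ≤ N * X := Nat.le_mul_of_pos_left X (by omega)
  have hU : Finset.Icc 1 (N * X) = Finset.Icc 1 X ∪ Finset.Ioc X (N * X) := by
    ext k
    simp only [Finset.mem_union, Finset.mem_Icc, Finset.mem_Ioc]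
    omega
  rw [hU, Finset.sum_union (Finset.disjoint_left.mpr fun k h1 h2 ↦ by
    rw [Finset.mem_Icc] at h1
    rw [Finset.mem_Ioc] at h2
    omega)]
  congr 1
  rw [Finset.sum_eq_single 1]
  · rw [LSeries.term_of_ne_zero one_ne_zero, truncConv_of_le f g (hX.trans hXN) hX,
      hfg 1 one_ne_zero]
    simp
  · intro k hk hk1
    obtain ⟨h1, h2⟩ := Finset.mem_Icc.mp hk
    rw [LSeries.term_of_ne_zero (by omega), truncConv_of_le f g (h2.trans hXN) h2,
      hfg k (by omega), if_neg hk1, ofReal_zero, zero_div]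
  · exact fun h ↦ absurd (Finset.mem_Icc.mpr ⟨le_rfl, hX⟩) h

theorem norm_term_le_rpow {f : ℕ → ℝ} {D ρ : ℝ} (hf : ∀ n, |f n| ≤ D * (n : ℝ) ^ ρ) {s : ℂ}
    (hs : 1 - ρ ≤ s.re) {n : ℕ} (hn : 1 ≤ n) :
    ‖LSeries.term (fun n ↦ (f n : ℂ)) s n‖ ≤ D * (n : ℝ) ^ (2 * ρ - 1) := by
  have hn' : (1 : ℝ) ≤ n := by exact_mod_cast hn
  have hn0 : (0 : ℝ) < n := by linarith
  rw [LSeries.norm_term_eq, if_neg (by omega), norm_real, Real.norm_eq_abs, div_le_iff₀ (by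
    positivity), mul_assoc, ← Real.rpow_add hn0]
  have hD : 0 ≤ D * (n : ℝ) ^ ρ := (abs_nonneg _).trans (hf n)
  have hD' : 0 ≤ D := nonneg_of_mul_nonneg_left hD (by positivity)
  refine (hf n).trans (mul_le_mul_of_nonneg_left ?_ hD')
  exact Real.rpow_le_rpow_of_exponent_le hn' (by linarith)

theorem norm_dirichletPartialSum_le {f : ℕ → ℝ} {D ρ : ℝ} (hρ : 0 < ρ) (hρ' : 2 * ρ ≤ 1)
    (hf : ∀ n, |f n| ≤ D * (n : ℝ) ^ ρ) {s : ℂ} (hs : 1 - ρ ≤ s.re) (hD : 0 ≤ D) (X : ℕ) :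
    ‖dirichletPartialSum f X s‖ ≤ D * ((X : ℝ) ^ (2 * ρ) / (2 * ρ)) := by
  refine (norm_sum_le _ _).trans ((Finset.sum_le_sum fun n hn ↦ norm_term_le_rpow hf hs
    (Finset.mem_Icc.mp hn).1).trans ?_)
  rw [← Finset.mul_sum]
  exact mul_le_mul_of_nonneg_left (sum_Icc_rpow_sub_one_le (by linarith) hρ' X) hD

theorem norm_sum_term_eq (f : ℕ → ℝ) {S : Finset ℕ} (hS : 0 ∉ S) (σ t : ℝ) :
    ‖∑ k ∈ S, LSeries.term (fun k ↦ (f k : ℂ)) (σ + t * I) k‖ =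
      ‖∑ k ∈ S, ((f k * (k : ℝ) ^ (-σ) : ℝ) : ℂ) * cexp (I * Real.log k * t)‖ := by
  rw [← RCLike.norm_conj, map_sum]
  congr 1
  refine Finset.sum_congr rfl fun k hk ↦ ?_
  have hk0 : k ≠ 0 := fun h ↦ hS (h ▸ hk)
  have hk' : (k : ℂ) ≠ 0 := by exact_mod_cast hk0
  rw [LSeries.term_of_ne_zero hk0, map_div₀, conj_ofReal, ofReal_mul, div_eq_mul_inv, mul_assoc]
  congr 1
  rw [← map_inv₀, ← cpow_neg, neg_add, cpow_add _ _ hk', map_mul]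
  congr 1
  · rw [ofReal_cpow k.cast_nonneg, ofReal_natCast, ofReal_neg, ← ofReal_natCast, ← ofReal_neg,
      ← ofReal_cpow k.cast_nonneg, conj_ofReal]
  · rw [cpow_def_of_ne_zero hk', ← exp_conj, ← natCast_log]
    congr 1
    simp only [map_mul, map_neg, conj_I, conj_ofReal]
    ring

theorem exists_lintegral_sum_term_le : ∃ C > (0 : ℝ), ∀ {f : ℕ → ℝ} {D ρ : ℝ}, 0 < ρ → 4 * ρ ≤ 1 →
    (∀ n, |f n| ≤ D * (n : ℝ) ^ ρ) → ∀ {R : ℝ}, 1 ≤ R → ∀ {X : ℕ}, R ≤ X → ∀ (Y : ℕ) {σ : ℝ},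
    1 - ρ ≤ σ → ∫⁻ t in Set.Icc (-R) R, ENNReal.ofReal
        (‖∑ k ∈ Finset.Ioc X Y, LSeries.term (fun k ↦ (f k : ℂ)) (σ + t * I) k‖ ^ 2) ≤
      ENNReal.ofReal (C * (D ^ 2 * ((Y : ℝ) ^ (4 * ρ) / (4 * ρ)))) := by
  obtain ⟨C, hC, h⟩ := exists_lintegral_enorm_sq_le
  refine ⟨2 * C, by positivity, fun {f D ρ} hρ hρ' hf {R} hR {X} hRX Y {σ} hσ ↦ ?_⟩
  have hX : 0 ∉ Finset.Ioc X Y := by simp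
  simp_rw [norm_sum_term_eq f hX]
  refine (h R hR _ hX _).trans (ENNReal.ofReal_le_ofReal ?_)
  rw [mul_comm 2 C, mul_assoc]
  refine mul_le_mul_of_nonneg_left ?_ hC.le
  calc ∑ n ∈ Finset.Ioc X Y, (R + n) * ‖((f n * (n : ℝ) ^ (-σ) : ℝ) : ℂ)‖ ^ 2
      ≤ ∑ n ∈ Finset.Ioc X Y, 2 * (D ^ 2 * (n : ℝ) ^ (4 * ρ - 1)) := by
        refine Finset.sum_le_sum fun n hn ↦ ?_
        obtain ⟨hn1, hn2⟩ := Finset.mem_Ioc.mp hn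
        have hXn : (X : ℝ) ≤ n := by exact_mod_cast hn1.le
        have hn' : (1 : ℝ) ≤ n := by linarith
        have hn0 : (0 : ℝ) < n := by linarith
        have h1 : ‖((f n * (n : ℝ) ^ (-σ) : ℝ) : ℂ)‖ ≤ D * (n : ℝ) ^ (2 * ρ - 1) := by
          rw [norm_real, norm_mul, Real.norm_eq_abs, Real.norm_of_nonneg (by positivity)]
          have h2 : (n : ℝ) ^ (-σ) ≤ (n : ℝ) ^ (ρ - 1) :=
            Real.rpow_le_rpow_of_exponent_le hn' (by linarith)
          refine (mul_le_mul (hf n) h2 (by positivity) ((abs_nonneg _).trans (hf n))).trans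
            (le_of_eq ?_)
          rw [mul_assoc, ← Real.rpow_add hn0]
          ring_nf
        have h2 := pow_le_pow_left₀ (norm_nonneg _) h1 2
        calc _ ≤ (2 * n) * (D * (n : ℝ) ^ (2 * ρ - 1)) ^ 2 :=
              mul_le_mul (by linarith) h2 (by positivity) (by positivity)
          _ = 2 * (D ^ 2 * ((n : ℝ) ^ (1 : ℝ) *
              ((n : ℝ) ^ (2 * ρ - 1) * (n : ℝ) ^ (2 * ρ - 1)))) := by
              rw [Real.rpow_one]
              ring
          _ = _ := by
              rw [← Real.rpow_add hn0, ← Real.rpow_add hn0]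
              ring_nf
    _ ≤ ∑ n ∈ Finset.Icc 1 Y, 2 * (D ^ 2 * (n : ℝ) ^ (4 * ρ - 1)) := by
        refine Finset.sum_le_sum_of_subset_of_nonneg (fun n hn ↦ ?_) fun _ _ _ ↦ by positivity
        rw [Finset.mem_Ioc] at hn
        exact Finset.mem_Icc.mpr ⟨by omega, hn.2⟩
    _ ≤ 2 * (D ^ 2 * ((Y : ℝ) ^ (4 * ρ) / (4 * ρ))) := by
        rw [← Finset.mul_sum, ← Finset.mul_sum]
        gcongr
        exact sum_Icc_rpow_sub_one_le (by linarith) hρ' Y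

end Mollifier

section MollifiedMeanValue

variable {r m : ℕ → ℝ} {κ δ C : ℝ} {Z : ℂ → ℂ}

theorem norm_mul_sub_sub_le (hr : ∀ n, 0 ≤ r n) (hκ : 0 < κ) (hδ₀ : 0 < δ) (hδ : δ ≤ 1)
    (hC : 0 ≤ C) (h : ∀ x : ℝ, 1 ≤ x → |summatory r x - κ * x| ≤ C * x ^ (1 - δ))
    (hZ : ∀ s ≠ 1, DifferentiableAt ℂ Z s)
    (hZr : ∀ s : ℂ, 1 < s.re → Z s = LSeries (fun n ↦ (r n : ℂ)) s)
    {ρ : ℝ} (hρ : 0 < ρ) (hρδ : ρ ≤ δ / 16) {T : ℝ} (hT : 2 ≤ T) {N : ℕ}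
    (hN : T ^ (6 / δ) ≤ N) (hN' : (N : ℝ) ≤ 2 * T ^ (6 / δ)) {σ t : ℝ} (hσ : |σ - 1| ≤ ρ)
    (ht : t ∈ Set.Icc (T - 1) (2 * T + 1)) :
    ‖Z (σ + t * I) - dirichletPartialSum r N (σ + t * I)‖ ≤
      (4 * κ + 32 * C / δ) * T ^ (-(5 / 8) : ℝ) := by
  have hT0 : 0 < T := by linarith
  have hT1 : 1 ≤ T := by linarith
  obtain ⟨hσ1, hσ2⟩ := abs_le.mp hσ
  set s : ℂ := σ + t * I
  have hsre : s.re = σ := by simp [s]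
  have hsim : s.im = t := by simp [s]
  have hN1 : (1 : ℝ) ≤ N := (Real.one_le_rpow hT1 (by positivity)).trans hN
  have hN0 : (0 : ℝ) < N := by linarith
  have h1 := norm_sub_sum_sub_le hr hδ₀ hδ hC h hZ hZr (N := N) (by exact_mod_cast hN1) (s := s)
    (by
      rw [hsre]
      linarith) (Or.inl (by
      rw [hsim]
      linarith [ht.1]))
  rw [hsre] at h1
  have hs4 : ‖s‖ ≤ 4 * T := by
    refine (norm_le_abs_re_add_abs_im s).trans ?_
    rw [hsre, hsim, abs_of_nonneg (by linarith), abs_of_nonneg (by linarith [ht.1])]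
    linarith [ht.2]
  have hs1 : T / 2 ≤ ‖s - 1‖ := by
    have := abs_im_le_norm (s - 1)
    rw [sub_im, hsim, one_im, sub_zero, abs_of_nonneg (by linarith [ht.1])] at this
    linarith [ht.1]
  have hpole : ‖κ * (N : ℂ) ^ (1 - s) / (s - 1)‖ ≤ 4 * κ * T ^ (-(5 / 8) : ℝ) := by
    rw [norm_div, norm_mul, norm_real, Real.norm_of_nonneg hκ.le, norm_natCast_cpow_of_pos (by
      exact_mod_cast hN0), sub_re, one_re, hsre, div_le_iff₀ (by linarith)]
    have h2 : (N : ℝ) ^ (1 - σ) ≤ 2 * T ^ (3 / 8 : ℝ) := by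
      calc (N : ℝ) ^ (1 - σ) ≤ (N : ℝ) ^ ρ :=
            Real.rpow_le_rpow_of_exponent_le hN1 (by linarith)
        _ ≤ (2 * T ^ (6 / δ)) ^ ρ := Real.rpow_le_rpow hN0.le hN' hρ.le
        _ = 2 ^ ρ * T ^ (6 / δ * ρ) := by
            rw [Real.mul_rpow (by norm_num) (by positivity), ← Real.rpow_mul hT0.le]
        _ ≤ 2 ^ (1 : ℝ) * T ^ (3 / 8 : ℝ) := by
            refine mul_le_mul (Real.rpow_le_rpow_of_exponent_le (by norm_num) (by linarith))
              (Real.rpow_le_rpow_of_exponent_le hT1 ?_) (by positivity) (by positivity)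
            rw [div_mul_eq_mul_div, div_le_iff₀ hδ₀]
            linarith
        _ = _ := by rw [Real.rpow_one]
    have h3 : T ^ (3 / 8 : ℝ) = T ^ (-(5 / 8) : ℝ) * T := by
      rw [← Real.rpow_add_one hT0.ne']
      norm_num
    calc κ * (N : ℝ) ^ (1 - σ) ≤ κ * (2 * T ^ (3 / 8 : ℝ)) := mul_le_mul_of_nonneg_left h2 hκ.le
      _ = 4 * κ * T ^ (-(5 / 8) : ℝ) * (T / 2) := by
        rw [h3]
        ring
      _ ≤ _ := mul_le_mul_of_nonneg_left hs1 (by positivity)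
  have hrem : ‖s‖ * (2 * C * ((N : ℝ) ^ (1 - δ - σ) / (σ - (1 - δ)))) ≤
      32 * C / δ * T ^ (-(5 / 8) : ℝ) := by
    have h2 : (N : ℝ) ^ (1 - δ - σ) ≤ T ^ (-3 : ℝ) := by
      calc (N : ℝ) ^ (1 - δ - σ) ≤ (N : ℝ) ^ (-(δ / 2)) :=
            Real.rpow_le_rpow_of_exponent_le hN1 (by linarith)
        _ ≤ (T ^ (6 / δ)) ^ (-(δ / 2)) :=
            Real.rpow_le_rpow_of_nonpos (by positivity) hN (by linarith)
        _ = _ := by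
            rw [← Real.rpow_mul hT0.le]
            congr 1
            field_simp
            norm_num
    have h3 : (N : ℝ) ^ (1 - δ - σ) / (σ - (1 - δ)) ≤ T ^ (-3 : ℝ) / (δ / 4) :=
      div_le_div₀ (by positivity) h2 (by positivity) (by linarith)
    calc _ ≤ 4 * T * (2 * C * (T ^ (-3 : ℝ) / (δ / 4))) :=
          mul_le_mul hs4 (mul_le_mul_of_nonneg_left h3 (by positivity))
            (mul_nonneg (by positivity) (div_nonneg (by positivity) (by linarith))) (by positivity)
      _ = 32 * C / δ * (T ^ (-3 : ℝ) * T) := by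
          field_simp
          ring
      _ = 32 * C / δ * T ^ (-2 : ℝ) := by
          rw [← Real.rpow_add_one hT0.ne']
          norm_num
      _ ≤ _ := by
          refine mul_le_mul_of_nonneg_left ?_ (by positivity)
          exact Real.rpow_le_rpow_of_exponent_le hT1 (by norm_num)
  calc ‖Z s - dirichletPartialSum r N s‖
      = ‖(Z s - ∑ n ∈ Finset.Icc 1 N, LSeries.term (fun n ↦ (r n : ℂ)) s n -
          κ * (N : ℂ) ^ (1 - s) / (s - 1)) + κ * (N : ℂ) ^ (1 - s) / (s - 1)‖ := by
        rw [sub_add_cancel, dirichletPartialSum]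
    _ ≤ _ := (norm_add_le _ _).trans (add_le_add (h1.trans hrem) hpole)
    _ = _ := by ring

/-- In mean square, `Z` times a mollifier is close to `1` near the line `re s = 1`. -/
theorem exists_lintegral_mul_mollifier_sub_one_le (hr : ∀ n, 0 ≤ r n) (hm : ∀ n, |m n| ≤ r n)
    (hrm : ∀ n ≠ 0, ∑ x ∈ n.divisorsAntidiagonal, r x.1 * m x.2 = if n = 1 then 1 else 0)
    (hrε : ∀ η > (0 : ℝ), ∃ D > (0 : ℝ), ∀ n : ℕ, r n ≤ D * (n : ℝ) ^ η)
    (hrr : ∀ η > (0 : ℝ), ∃ D > (0 : ℝ), ∀ n : ℕ,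
      ∑ x ∈ n.divisorsAntidiagonal, r x.1 * r x.2 ≤ D * (n : ℝ) ^ η)
    (hκ : 0 < κ) (hδ₀ : 0 < δ) (hδ : δ ≤ 1)
    (hC : 0 ≤ C) (h : ∀ x : ℝ, 1 ≤ x → |summatory r x - κ * x| ≤ C * x ^ (1 - δ))
    (hZ : ∀ s ≠ 1, DifferentiableAt ℂ Z s)
    (hZr : ∀ s : ℂ, 1 < s.re → Z s = LSeries (fun n ↦ (r n : ℂ)) s)
    {ε ρ₀ : ℝ} (hε : 0 < ε) (hρ₀ : 0 < ρ₀) :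
    ∃ ρ > (0 : ℝ), ρ ≤ ρ₀ ∧ ∃ B > (0 : ℝ), ∀ T : ℝ, 3 ≤ T → ∃ M : ℂ → ℂ, Differentiable ℂ M ∧
      ∀ σ : ℝ, |σ - 1| ≤ ρ → ∫⁻ t in Set.Icc (T - 1) (2 * T + 1), ENNReal.ofReal
        (‖Z (σ + t * I) * M (σ + t * I) - 1‖ ^ 2) ≤ ENNReal.ofReal (B * T ^ ε) := by
  set ρ : ℝ := min ρ₀ (min (δ / 16) (ε * δ / 28))
  have hρ : 0 < ρ := by positivity
  have hρδ : ρ ≤ δ / 16 := (min_le_right _ _).trans (min_le_left _ _)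
  have hρε : ρ ≤ ε * δ / 28 := (min_le_right _ _).trans (min_le_right _ _)
  obtain ⟨D, hD, hrD⟩ := hrε ρ hρ
  obtain ⟨D', hD', hrD'⟩ := hrr ρ hρ
  obtain ⟨C₀, hC₀, hmv⟩ := exists_lintegral_sum_term_le
  set B₁ : ℝ := (4 * κ + 32 * C / δ) * (D * (4 / (2 * ρ)))
  have hB₁ : 0 < B₁ := by positivity
  set B₂ : ℝ := C₀ * (D' ^ 2 * (8 / (4 * ρ)))
  have hB₂ : 0 < B₂ := by positivity
  refine ⟨ρ, hρ, min_le_left _ _, 2 * B₂ + 4 * B₁ ^ 2, by positivity, fun T hT ↦ ?_⟩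
  have hT0 : 0 < T := by linarith
  have hT1 : 1 ≤ T := by linarith
  have h6 : 6 ≤ 6 / δ := by
    rw [le_div_iff₀ hδ₀]
    linarith
  have hT6 : 3 * T ≤ T ^ (6 / δ) := by
    calc 3 * T ≤ T * T := by nlinarith
      _ = T ^ (2 : ℝ) := by rw [← pow_two, ← Real.rpow_natCast]; norm_num
      _ ≤ _ := Real.rpow_le_rpow_of_exponent_le hT1 (by linarith)
  set X : ℕ := ⌈3 * T⌉₊
  set N : ℕ := ⌈T ^ (6 / δ)⌉₊
  have hX : 3 * T ≤ X := Nat.le_ceil _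
  have hX' : (X : ℝ) ≤ 4 * T := by
    have := Nat.ceil_lt_add_one (show 0 ≤ 3 * T by positivity)
    linarith
  have hN : T ^ (6 / δ) ≤ N := Nat.le_ceil _
  have hN' : (N : ℝ) ≤ 2 * T ^ (6 / δ) := by
    have := Nat.ceil_lt_add_one (show 0 ≤ T ^ (6 / δ) by positivity)
    linarith
  have hXN : X ≤ N := Nat.ceil_mono hT6
  have hX1 : 1 ≤ X := by
    have : (1 : ℝ) ≤ X := by linarith
    exact_mod_cast this
  have hXpow : (X : ℝ) ^ (2 * ρ) ≤ 4 * T ^ (1 / 8 : ℝ) := by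
    calc (X : ℝ) ^ (2 * ρ) ≤ (4 * T) ^ (2 * ρ) :=
          Real.rpow_le_rpow X.cast_nonneg hX' (by positivity)
      _ = 4 ^ (2 * ρ) * T ^ (2 * ρ) := Real.mul_rpow (by norm_num) hT0.le
      _ ≤ 4 ^ (1 : ℝ) * T ^ (1 / 8 : ℝ) :=
          mul_le_mul (Real.rpow_le_rpow_of_exponent_le (by norm_num) (by linarith))
            (Real.rpow_le_rpow_of_exponent_le hT1 (by linarith)) (by positivity) (by positivity)
      _ = _ := by rw [Real.rpow_one]
  have hYpow : ((N * X : ℕ) : ℝ) ^ (4 * ρ) ≤ 8 * T ^ ε := by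
    have h7 : ((N * X : ℕ) : ℝ) ≤ 8 * T ^ (7 / δ) := by
      push_cast
      calc (N : ℝ) * X ≤ 2 * T ^ (6 / δ) * (4 * T) :=
            mul_le_mul hN' hX' X.cast_nonneg (by positivity)
        _ = 8 * (T ^ (6 / δ) * T) := by ring
        _ = 8 * T ^ (6 / δ + 1) := by rw [Real.rpow_add_one hT0.ne']
        _ ≤ _ := by
            refine mul_le_mul_of_nonneg_left
              (Real.rpow_le_rpow_of_exponent_le hT1 ?_) (by norm_num)
            have : 1 ≤ 1 / δ := (one_le_div hδ₀).mpr hδ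
            calc 6 / δ + 1 ≤ 6 / δ + 1 / δ := by linarith
              _ = _ := by ring
    calc ((N * X : ℕ) : ℝ) ^ (4 * ρ) ≤ (8 * T ^ (7 / δ)) ^ (4 * ρ) :=
          Real.rpow_le_rpow (Nat.cast_nonneg _) h7 (by positivity)
      _ = 8 ^ (4 * ρ) * T ^ (7 / δ * (4 * ρ)) := by
          rw [Real.mul_rpow (by norm_num) (by positivity), ← Real.rpow_mul hT0.le]
      _ ≤ 8 ^ (1 : ℝ) * T ^ ε := by
          refine mul_le_mul (Real.rpow_le_rpow_of_exponent_le (by norm_num) (by linarith))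
            (Real.rpow_le_rpow_of_exponent_le hT1 ?_) (by positivity) (by positivity)
          rw [div_mul_eq_mul_div, div_le_iff₀ hδ₀]
          linarith
      _ = _ := by rw [Real.rpow_one]
  refine ⟨dirichletPartialSum m X, differentiable_dirichletPartialSum m X, fun σ hσ ↦ ?_⟩
  have hσ1 := (abs_le.mp hσ).1
  set P : ℝ → ℂ := fun t ↦ ∑ k ∈ Finset.Ioc X (N * X),
    LSeries.term (fun k ↦ (truncConv r m N X k : ℂ)) (σ + t * I) k
  have hpt : ∀ t ∈ Set.Icc (T - 1) (2 * T + 1),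
      ENNReal.ofReal (‖Z (σ + t * I) * dirichletPartialSum m X (σ + t * I) - 1‖ ^ 2) ≤
        ENNReal.ofReal 2 * ENNReal.ofReal (‖P t‖ ^ 2) + ENNReal.ofReal (2 * B₁ ^ 2 * T⁻¹) :=
      fun t ht ↦ by
    have he := norm_mul_sub_sub_le hr hκ hδ₀ hδ hC h hZ hZr hρ hρδ (by linarith) hN hN' hσ ht
    have hM : ‖dirichletPartialSum m X (σ + t * I)‖ ≤ D * (4 / (2 * ρ)) * T ^ (1 / 8 : ℝ) := by
      refine (norm_dirichletPartialSum_le (D := D) hρ (by linarith)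
        (fun n ↦ (hm n).trans (hrD n)) (by simp; linarith) hD.le X).trans ?_
      calc D * ((X : ℝ) ^ (2 * ρ) / (2 * ρ)) ≤ D * (4 * T ^ (1 / 8 : ℝ) / (2 * ρ)) := by gcongr
        _ = _ := by ring
    have hid : Z (σ + t * I) * dirichletPartialSum m X (σ + t * I) - 1 =
        (Z (σ + t * I) - dirichletPartialSum r N (σ + t * I)) *
          dirichletPartialSum m X (σ + t * I) + P t := by
      have := dirichletPartialSum_mul hrm hX1 hXN (σ + t * I)
      rw [sub_mul, this]
      simp only [P]
      ring
    have herr : ‖(Z (σ + t * I) - dirichletPartialSum r N (σ + t * I)) *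
        dirichletPartialSum m X (σ + t * I)‖ ≤ B₁ * T ^ (-(1 / 2) : ℝ) := by
      rw [norm_mul]
      refine (mul_le_mul he hM (norm_nonneg _) (by positivity)).trans (le_of_eq ?_)
      have : T ^ (-(1 / 2) : ℝ) = T ^ (-(5 / 8) : ℝ) * T ^ (1 / 8 : ℝ) := by
        rw [← Real.rpow_add hT0]
        norm_num
      rw [this]
      ring
    rw [← ENNReal.ofReal_mul zero_le_two, ← ENNReal.ofReal_add (by positivity) (by positivity)]
    refine ENNReal.ofReal_le_ofReal ?_
    rw [hid]
    have h1 := (norm_add_le ((Z (σ + t * I) - dirichletPartialSum r N (σ + t * I)) *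
          dirichletPartialSum m X (σ + t * I)) (P t)).trans (add_le_add_left herr _)
    have h2 := pow_le_pow_left₀ (norm_nonneg _) h1 2
    have h3 : (T ^ (-(1 / 2) : ℝ)) ^ 2 = T⁻¹ := by
      rw [← Real.rpow_natCast, ← Real.rpow_mul hT0.le, ← Real.rpow_neg_one]
      norm_num
    have h4 : (B₁ * T ^ (-(1 / 2) : ℝ)) ^ 2 = B₁ ^ 2 * T⁻¹ := by rw [mul_pow, h3]
    nlinarith [sq_nonneg (B₁ * T ^ (-(1 / 2) : ℝ) - ‖P t‖)]
  have hsub : Set.Icc (T - 1) (2 * T + 1) ⊆ Set.Icc (-(3 * T)) (3 * T) :=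
    Set.Icc_subset_Icc (by linarith) (by linarith)
  calc _ ≤ ∫⁻ t in Set.Icc (T - 1) (2 * T + 1), (ENNReal.ofReal 2 * ENNReal.ofReal (‖P t‖ ^ 2) +
          ENNReal.ofReal (2 * B₁ ^ 2 * T⁻¹)) := setLIntegral_mono' measurableSet_Icc hpt
    _ = ENNReal.ofReal 2 * (∫⁻ t in Set.Icc (T - 1) (2 * T + 1), ENNReal.ofReal (‖P t‖ ^ 2)) +
          ENNReal.ofReal (2 * B₁ ^ 2 * T⁻¹) * ENNReal.ofReal (T + 2) := by
        rw [lintegral_add_right _ measurable_const, lintegral_const_mul' _ _ ENNReal.ofReal_ne_top,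
          setLIntegral_const, Real.volume_Icc]
        ring_nf
    _ ≤ ENNReal.ofReal 2 * ENNReal.ofReal (B₂ * T ^ ε) +
          ENNReal.ofReal (2 * B₁ ^ 2 * T⁻¹) * ENNReal.ofReal (T + 2) := by
        gcongr
        refine (lintegral_mono_set hsub).trans ((hmv hρ (by linarith) (fun n ↦
          (abs_truncConv_le hr hm N X n).trans (hrD' n)) (by linarith) hX (N * X)
          (by linarith)).trans (ENNReal.ofReal_le_ofReal ?_))
        calc _ ≤ C₀ * (D' ^ 2 * (8 * T ^ ε / (4 * ρ))) := by gcongr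
          _ = _ := by ring
    _ ≤ _ := by
        rw [← ENNReal.ofReal_mul zero_le_two, ← ENNReal.ofReal_mul (by positivity),
          ← ENNReal.ofReal_add (by positivity) (by positivity)]
        refine ENNReal.ofReal_le_ofReal ?_
        have h1 : 2 * B₁ ^ 2 * T⁻¹ * (T + 2) ≤ 4 * B₁ ^ 2 * 1 := by
          have : T⁻¹ * (T + 2) ≤ 2 := by
            rw [inv_mul_le_iff₀ hT0]
            linarith
          nlinarith [sq_nonneg B₁]
        have h2 : 4 * B₁ ^ 2 * 1 ≤ 4 * B₁ ^ 2 * T ^ ε :=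
          mul_le_mul_of_nonneg_left (Real.one_le_rpow hT1 hε.le) (by positivity)
        linarith

end MollifiedMeanValue

section LocalBounds

variable {Z : ℂ → ℂ} {c : ℂ} {a L : ℝ}

theorem norm_deriv_div_le_of_norm_le_exp (ha : 0 < a)
    (hZ : DifferentiableOn ℂ Z (Metric.ball c (4 * a))) (hne : ∀ z ∈ Metric.ball c (4 * a), Z z ≠ 0)
    (hL : 0 < L) (hup : ∀ z ∈ Metric.ball c (4 * a), ‖Z z‖ ≤ Real.exp L)
    (hlow : Real.exp (-L) ≤ ‖Z c‖) {z : ℂ} (hz : z ∈ Metric.closedBall c (2 * a)) :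
    ‖deriv Z z / Z z‖ ≤ 24 / a * L := by
  have hc : c ∈ Metric.ball c (4 * a) := Metric.mem_ball_self (by positivity)
  have hG : DifferentiableOn ℂ (fun w ↦ deriv Z w / Z w) (Metric.ball c (4 * a)) :=
    (hZ.deriv Metric.isOpen_ball).div hZ hne
  obtain ⟨g, hg0, hg⟩ := hG.isExactOn_ball.with_val_at c 0
  have hexp : ∀ w ∈ Metric.ball c (4 * a), Z w = Z c * exp (g w) := by
    have hd : ∀ w ∈ Metric.ball c (4 * a), HasDerivAt (fun w ↦ Z w * exp (-g w)) 0 w :=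
      fun w hw ↦ by
        have h1 := (hZ.differentiableAt (Metric.isOpen_ball.mem_nhds hw)).hasDerivAt
        refine (h1.mul (hg w hw).neg.cexp).congr_deriv ?_
        have := hne w hw
        field_simp
        ring
    intro w hw
    have hconst := (convex_ball c (4 * a)).is_const_of_fderivWithin_eq_zero (𝕜 := ℂ)
      (fun w hw ↦ (hd w hw).differentiableAt.differentiableWithinAt) (fun w hw ↦ by
        rw [fderivWithin_of_isOpen Metric.isOpen_ball hw]
        ext
        simpa using (hd w hw).deriv) hw hc
    simp only [hg0, neg_zero, exp_zero, mul_one] at hconst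
    rw [← hconst, mul_assoc, ← exp_add, neg_add_cancel, exp_zero, mul_one]
  have hre : ∀ w ∈ Metric.ball c (4 * a), (g w).re ≤ 2 * L := fun w hw ↦ by
    have h1 := hup w hw
    rw [hexp w hw, norm_mul, norm_exp] at h1
    have h2 := (mul_le_mul_of_nonneg_right hlow (Real.exp_pos (g w).re).le).trans h1
    rw [← Real.exp_add, Real.exp_le_exp] at h2
    linarith
  have hbc : ∀ w ∈ Metric.ball c (3 * a), ‖g w‖ ≤ 12 * L := fun w hw ↦ by
    have hmem : ∀ u ∈ Metric.ball (0 : ℂ) (4 * a), c + u ∈ Metric.ball c (4 * a) := fun u hu ↦ by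
      simpa using hu
    have hw' : ‖w - c‖ < 3 * a := mem_ball_iff_norm.mp hw
    have h1 := borelCaratheodory_zero (f := fun u ↦ g (c + u)) (M := 2 * L) (R := 4 * a)
      (z := w - c) (by positivity) (fun u hu ↦ ?_) (fun u hu ↦ hre _ (hmem u hu)) (by positivity)
      (by
        rw [mem_ball_zero_iff]
        linarith) (by simpa using hg0)
    · rw [add_sub_cancel] at h1
      refine h1.trans ?_
      rw [div_le_iff₀ (by linarith)]
      nlinarith
    · have : HasDerivAt (fun u ↦ g (c + u)) _ u := (hg _ (hmem u hu)).comp_const_add c u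
      exact this.differentiableAt.differentiableWithinAt
  have hsub : Metric.closedBall z (a / 2) ⊆ Metric.ball c (3 * a) := fun w hw ↦ by
    rw [Metric.mem_closedBall] at hz hw
    rw [Metric.mem_ball]
    linarith [dist_triangle w z c]
  have hd : DiffContOnCl ℂ g (Metric.ball z (a / 2)) :=
    DifferentiableOn.diffContOnCl fun w hw ↦ (hg w (Metric.ball_subset_ball (by linarith)
      (hsub (Metric.closure_ball_subset_closedBall hw)))).differentiableAt.differentiableWithinAt
  have hcauchy := norm_deriv_le_of_forall_mem_sphere_norm_le (half_pos ha) hd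
    fun w hw ↦ hbc w (hsub (Metric.sphere_subset_closedBall hw))
  rw [(hg z (Metric.closedBall_subset_ball (by linarith) hz)).deriv] at hcauchy
  refine hcauchy.trans (le_of_eq ?_)
  field_simp
  norm_num

set_option maxHeartbeats 1000000 in
/-- A three circles estimate for a function which is large only near a tangent line. -/
theorem exists_norm_le_mul_log {a A B : ℝ} (ha : 0 < a) (hA : 0 ≤ A) (hB : 0 ≤ B) :
    ∃ C > (0 : ℝ), ∃ L₀ : ℝ, ∀ L ≥ L₀, ∀ (G : ℂ → ℂ) (c : ℂ),
      DifferentiableOn ℂ G (Metric.ball c (4 * a)) →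
      (∀ z ∈ Metric.closedBall c (2 * a), ‖G z‖ ≤ B * L) →
      (∀ z ∈ Metric.closedBall c (2 * a), c.re - a < z.re →
        ‖G z‖ ≤ A / (z.re - (c.re - a))) →
      ∀ z ∈ Metric.closedBall c a, ‖G z‖ ≤ C * Real.log L := by
  set E : ℝ := Real.exp (4 / (a * Real.log 2))
  refine ⟨A * E + B + 1, by positivity, Real.exp (max 2 (2 / a)), fun L hL G c hG hB' hA' z hz ↦ ?_⟩
  have hL0 : 0 < L := (Real.exp_pos _).trans_le hL
  have hlog : max 2 (2 / a) ≤ Real.log L := (Real.le_log_iff_exp_le hL0).mpr hL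
  have hlog2 : 2 ≤ Real.log L := (le_max_left _ _).trans hlog
  have hloga : 2 / a ≤ Real.log L := (le_max_right _ _).trans hlog
  set η : ℝ := (Real.log L)⁻¹
  have hη : 0 < η := by positivity
  have hηa : η ≤ a / 2 := by
    simp only [η]
    rw [inv_le_comm₀ (by linarith) (by positivity), inv_div]
    exact hloga
  have hl2 : 0 < Real.log 2 := Real.log_pos one_lt_two
  set m : ℕ := ⌈Real.log L / Real.log 2⌉₊
  have hm1 : L ≤ 2 ^ m := by
    rw [← Real.log_le_log_iff hL0 (by positivity), Real.log_pow, ← div_le_iff₀ hl2]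
    exact Nat.le_ceil _
  have hm2 : m * η ≤ 2 / Real.log 2 := by
    have h1 : (m : ℝ) ≤ Real.log L / Real.log 2 + 1 :=
      (Nat.ceil_lt_add_one (by positivity)).le
    have h2 : Real.log 2 ≤ Real.log L := by linarith [Real.log_two_lt_d9]
    have h3 : (m : ℝ) ≤ 2 / Real.log 2 * Real.log L := by
      refine h1.trans ?_
      have : 1 ≤ Real.log L / Real.log 2 := (one_le_div hl2).mpr h2
      rw [div_mul_eq_mul_div, mul_div_assoc]
      linarith
    simp only [η]
    rwa [← div_eq_mul_inv, div_le_iff₀ (by linarith)]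
  have hpow : a ^ m ≤ E * (a - η) ^ m := by
    have h1 : a ≤ (a - η) * Real.exp (2 * η / a) := by
      have h2 := Real.add_one_le_exp (2 * η / a)
      have h3 : a ≤ (a - η) * (2 * η / a + 1) := by
        rw [div_add_one ha.ne', mul_div_assoc', le_div_iff₀ ha]
        nlinarith
      exact h3.trans (mul_le_mul_of_nonneg_left h2 (by linarith))
    calc a ^ m ≤ ((a - η) * Real.exp (2 * η / a)) ^ m := pow_le_pow_left₀ ha.le h1 m
      _ = Real.exp (m * (2 * η / a)) * (a - η) ^ m := by
        rw [mul_pow, ← Real.exp_nat_mul, mul_comm]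
      _ ≤ _ := by
        refine mul_le_mul_of_nonneg_right (Real.exp_le_exp.mpr ?_) (pow_nonneg (by linarith) _)
        calc (m : ℝ) * (2 * η / a) = m * η * (2 / a) := by ring
          _ ≤ 2 / Real.log 2 * (2 / a) := mul_le_mul_of_nonneg_right hm2 (by positivity)
          _ = _ := by
            field_simp
            norm_num
  have hinner : ∀ w ∈ Metric.closedBall c (a - η), ‖G w‖ ≤ A * Real.log L := fun w hw ↦ by
    have h1 : η ≤ w.re - (c.re - a) := by
      have := (abs_le.mp ((abs_re_le_norm (w - c)).trans (mem_closedBall_iff_norm.mp hw))).1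
      rw [sub_re] at this
      linarith
    refine (hA' w (Metric.closedBall_subset_closedBall (by linarith) hw) (by linarith)).trans ?_
    refine (div_le_div_of_nonneg_left hA hη h1).trans (le_of_eq ?_)
    simp only [η, div_inv_eq_mul]
  have hfin : (A * E + B) * Real.log L ≤ (A * E + B + 1) * Real.log L := by nlinarith
  rcases le_or_gt (dist z c) (a - η) with hza | hza
  · refine (hinner z hza).trans (le_trans ?_ hfin)
    refine mul_le_mul_of_nonneg_right ?_ (by linarith)
    have hE : 1 ≤ E := Real.one_le_exp (by positivity)
    nlinarith
  set U : Set ℂ := Metric.ball c (2 * a) \ Metric.closedBall c (a - η)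
  have hclU : closure U ⊆ Metric.closedBall c (2 * a) \ Metric.ball c (a - η) := by
    refine closure_minimal (fun w hw ↦ ⟨Metric.ball_subset_closedBall hw.1, fun h ↦
      hw.2 (Metric.ball_subset_closedBall h)⟩) ?_
    exact Metric.isClosed_closedBall.sdiff Metric.isOpen_ball
  have hpos : 0 < a - η := by linarith
  have hUne : ∀ w ∈ closure U, w - c ≠ 0 := fun w hw h0 ↦ by
    refine (hclU hw).2 ?_
    rw [sub_eq_zero.mp h0]
    exact Metric.mem_ball_self hpos
  have hUo : IsOpen U := Metric.isOpen_ball.sdiff Metric.isClosed_closedBall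
  have hfr : ∀ w ∈ frontier U, dist w c = 2 * a ∨ dist w c = a - η := fun w hw ↦ by
    have h1 := hclU hw.1
    rw [hUo.frontier_eq] at hw
    have h2 : dist w c ≤ 2 * a := h1.1
    have h3 : a - η ≤ dist w c := not_lt.mp h1.2
    by_contra! hcon
    refine hw.2 ⟨lt_of_le_of_ne h2 hcon.1, fun h4 ↦ hcon.2 (le_antisymm h4 h3)⟩
  have hd : DiffContOnCl ℂ (fun w ↦ G w / (w - c) ^ m) U := by
    refine DifferentiableOn.diffContOnCl fun w hw ↦ ?_
    have hw' := (hclU hw).1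
    have h1 := hG.differentiableAt (Metric.isOpen_ball.mem_nhds
      (Metric.closedBall_subset_ball (by linarith : 2 * a < 4 * a) hw'))
    have h2 : DifferentiableAt ℂ (fun w ↦ (w - c) ^ m) w := (differentiableAt_id.sub_const c).pow m
    have h3 : (w - c) ^ m ≠ 0 := pow_ne_zero _ (hUne w hw)
    exact (DifferentiableAt.fun_div h1 h2 h3).differentiableWithinAt
  have hlogpos : 0 < Real.log L := by linarith
  have hbound := norm_le_of_forall_mem_frontier_norm_le (C := (A * E + B) * Real.log L / a ^ m)
    (Metric.isBounded_ball.subset Set.sdiff_subset) hd (fun w hw ↦ ?_)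
    (subset_closure (show z ∈ U from ⟨?_, not_le.mpr hza⟩))
  · rw [norm_div, norm_pow, ← dist_eq_norm,
      div_le_div_iff₀ (pow_pos (hpos.trans hza) _) (by positivity)] at hbound
    have h1 : dist z c ^ m ≤ a ^ m := pow_le_pow_left₀ dist_nonneg hz _
    refine le_trans ?_ hfin
    refine le_of_mul_le_mul_right (hbound.trans ?_) (pow_pos ha m)
    exact mul_le_mul_of_nonneg_left h1 (by positivity)
  · rw [norm_div, norm_pow, ← dist_eq_norm]
    rcases hfr w hw with h1 | h1
    · rw [h1, div_le_div_iff₀ (by positivity) (by positivity), mul_pow, ← mul_assoc]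
      refine mul_le_mul_of_nonneg_right ?_ (by positivity)
      refine (hB' w (hclU hw.1).1).trans ?_
      have h3 : B * L ≤ B * 2 ^ m := mul_le_mul_of_nonneg_left hm1 hB
      have h4 : B ≤ (A * E + B) * Real.log L := by
        have : 0 ≤ A * E := by positivity
        nlinarith
      exact h3.trans (mul_le_mul_of_nonneg_right h4 (by positivity))
    · rw [h1, div_le_div_iff₀ (pow_pos hpos _) (by positivity)]
      have h2 := hinner w (le_of_eq h1)
      calc ‖G w‖ * a ^ m ≤ A * Real.log L * (E * (a - η) ^ m) :=
            mul_le_mul h2 hpow (by positivity) (by positivity)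
        _ ≤ _ := by
          have : 0 ≤ B * Real.log L * (a - η) ^ m := by positivity
          nlinarith
  · rw [Metric.mem_ball]
    have : dist z c ≤ a := hz
    linarith

/-- A function without zeros near a point of the line `re s = 1` is not small there, provided it
behaves like a zeta function to the right of this line. -/
theorem exists_norm_inv_le_mul_log {a A : ℝ} (ha : 0 < a) (hA : 0 < A) :
    ∃ C > (0 : ℝ), ∃ L₀ : ℝ, ∀ L ≥ L₀, ∀ (Z : ℂ → ℂ) (t : ℝ),
      DifferentiableOn ℂ Z (Metric.ball (1 + a + t * I) (4 * a)) →
      (∀ z ∈ Metric.ball (1 + a + t * I : ℂ) (4 * a), Z z ≠ 0) →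
      (∀ z ∈ Metric.ball (1 + a + t * I : ℂ) (4 * a), ‖Z z‖ ≤ Real.exp L) →
      Real.exp (-L) ≤ ‖Z (1 + a + t * I)‖ →
      (∀ z ∈ Metric.ball (1 + a + t * I : ℂ) (4 * a), 1 < z.re →
        ‖(Z z)⁻¹‖ ≤ A / (z.re - 1) ∧ ‖deriv Z z / Z z‖ ≤ A / (z.re - 1)) →
      ‖(Z (1 + t * I))⁻¹‖ ≤ C * Real.log L := by
  obtain ⟨C, hC, L₀, hCL⟩ := exists_norm_le_mul_log (A := A) (B := 24 / a) ha hA.le (by positivity)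
  refine ⟨Real.exp C * A, by positivity, max L₀ (Real.exp (1 + (2 * a)⁻¹)),
    fun L hL Z t hZ hne hup hlow hAb ↦ ?_⟩
  set c : ℂ := 1 + a + t * I
  have hcre : c.re - a = 1 := by simp [c]
  have hLe : Real.exp (1 + (2 * a)⁻¹) ≤ L := (le_max_right _ _).trans hL
  have hL0 : 0 < L := (Real.exp_pos _).trans_le hLe
  have hlog : 1 + (2 * a)⁻¹ ≤ Real.log L := (Real.le_log_iff_exp_le hL0).mpr hLe
  have ha2 : 0 < (2 * a)⁻¹ := by positivity
  have hlogpos : 0 < Real.log L := by linarith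
  have hball : Metric.closedBall c (2 * a) ⊆ Metric.ball c (4 * a) :=
    Metric.closedBall_subset_ball (by linarith)
  have hG := hCL L ((le_max_left _ _).trans hL) (fun w ↦ deriv Z w / Z w) c
    ((hZ.deriv Metric.isOpen_ball).div hZ hne)
    (fun z hz ↦ norm_deriv_div_le_of_norm_le_exp ha hZ hne hL0 hup hlow hz)
    (fun z hz hre ↦ by
      rw [hcre] at hre ⊢
      exact (hAb z (hball hz) hre).2)
  set η : ℝ := (Real.log L)⁻¹
  have hη : 0 < η := by positivity
  have hηa : η ≤ 2 * a := by
    simp only [η]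
    rw [inv_le_comm₀ hlogpos (by positivity)]
    linarith
  have hmem : ∀ x ∈ Set.Icc 0 η, (1 + t * I + x : ℂ) ∈ Metric.closedBall c a := fun x hx ↦ by
    rw [mem_closedBall_iff_norm, show (1 + t * I + x : ℂ) - c = ((x - a : ℝ) : ℂ) by
      simp only [c]
      push_cast
      ring, norm_real, Real.norm_eq_abs, abs_le]
    constructor <;> linarith [hx.1, hx.2]
  have hball' : Metric.closedBall c a ⊆ Metric.ball c (4 * a) :=
    Metric.closedBall_subset_ball (by linarith)
  have hder : ∀ x ∈ Set.Icc 0 η, HasDerivAt (fun x : ℝ ↦ Z (1 + t * I + x))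
      (deriv Z (1 + t * I + x)) x := fun x hx ↦ by
    have h1 := (hZ.differentiableAt (Metric.isOpen_ball.mem_nhds (hball' (hmem x hx)))).hasDerivAt
    have h2 : HasDerivAt (fun w : ℂ ↦ Z (1 + t * I + w)) (deriv Z (1 + t * I + x)) (x : ℂ) :=
      h1.comp_const_add (1 + t * I) (x : ℂ)
    exact h2.comp_ofReal
  have hgr := norm_le_gronwallBound_of_norm_deriv_right_le (f := fun x : ℝ ↦ Z (1 + t * I + x))
    (f' := fun x : ℝ ↦ deriv Z (1 + t * I + x)) (δ := ‖Z (1 + t * I)‖) (K := C * Real.log L)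
    (ε := 0) (a := 0) (b := η) (fun x hx ↦ (hder x hx).continuousAt.continuousWithinAt)
    (fun x hx ↦ (hder x (Set.Ico_subset_Icc_self hx)).hasDerivWithinAt) (by simp)
    (fun x hx ↦ by
      have hx' := hmem x (Set.Ico_subset_Icc_self hx)
      have := hG _ hx'
      rw [norm_div, div_le_iff₀ (norm_pos_iff.mpr (hne _ (hball' hx')))] at this
      simpa using this) η (Set.right_mem_Icc.mpr hη.le)
  rw [gronwallBound_ε0, sub_zero, mul_assoc, mul_inv_cancel₀ hlogpos.ne', mul_one] at hgr
  have hη' : (1 + t * I + η : ℂ) ∈ Metric.ball c (4 * a) :=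
    hball' (hmem η (Set.right_mem_Icc.mpr hη.le))
  have hre : (1 + t * I + η : ℂ).re - 1 = η := by simp
  have h1 := (hAb _ hη' (by linarith)).1
  rw [hre, norm_inv] at h1
  have hp : 0 < ‖Z (1 + t * I + η)‖ := norm_pos_iff.mpr (hne _ hη')
  have h0 : (1 + t * I : ℂ) ∈ Metric.ball c (4 * a) := by
    have := hball' (hmem 0 (Set.left_mem_Icc.mpr hη.le))
    rwa [ofReal_zero, add_zero] at this
  have hp0 : 0 < ‖Z (1 + t * I)‖ := norm_pos_iff.mpr (hne _ h0)
  rw [norm_inv]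
  calc ‖Z (1 + t * I)‖⁻¹ ≤ Real.exp C * ‖Z (1 + t * I + η)‖⁻¹ := by
        rw [← div_eq_mul_inv, inv_eq_one_div, div_le_div_iff₀ hp0 hp, one_mul]
        exact hgr.trans_eq (mul_comm _ _)
    _ ≤ Real.exp C * (A / η) := mul_le_mul_of_nonneg_left h1 (Real.exp_pos _).le
    _ = Real.exp C * A * Real.log L := by
        simp only [η, div_inv_eq_mul]
        ring

end LocalBounds

section ExceptionalSet

theorem pi_div_two_le_integral_circleMap {f : ℂ → ℂ} {w z : ℂ} {ρ : ℝ} (hρ : 0 < ρ)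
    (hf : DifferentiableOn ℂ f (Metric.closedBall w ρ)) (hz : z ∈ Metric.ball w (ρ / 2))
    (hfz : 1 ≤ ‖f z‖) :
    IntegrableOn (fun θ : ℝ ↦ ‖f (circleMap w ρ θ)‖ ^ 2) (Set.Ioc 0 (2 * Real.pi)) ∧
      Real.pi / 2 ≤ ∫ θ in Set.Ioc 0 (2 * Real.pi), ‖f (circleMap w ρ θ)‖ ^ 2 := by
  have hpi := Real.pi_pos
  have hcont : Continuous fun θ : ℝ ↦ f (circleMap w ρ θ) :=
    hf.continuousOn.comp_continuous (continuous_circleMap w ρ) fun θ ↦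
      circleMap_mem_closedBall w hρ.le θ
  have hinteg : IntegrableOn (fun θ : ℝ ↦ ‖f (circleMap w ρ θ)‖ ^ 2) (Set.Ioc 0 (2 * Real.pi)) :=
    ((hcont.norm.pow 2).integrableOn_Icc).mono_set Set.Ioc_subset_Icc_self
  refine ⟨hinteg, ?_⟩
  have hd : DiffContOnCl ℂ f (Metric.ball w ρ) :=
    DifferentiableOn.diffContOnCl (hf.mono Metric.closure_ball_subset_closedBall)
  have hcauchy := hd.two_pi_i_inv_smul_circleIntegral_sub_inv_smul
    (Metric.ball_subset_ball (by linarith) hz)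
  have hle : ‖∮ z' in C(w, ρ), (z' - z)⁻¹ • f z'‖ ≤
      ∫ θ in (0 : ℝ)..(2 * Real.pi), (2 * ‖f (circleMap w ρ θ)‖ ^ 2 + 1 / 2) := by
    refine intervalIntegral.norm_integral_le_of_norm_le (by positivity)
      (Eventually.of_forall fun θ _ ↦ ?_)
      ((((hcont.norm.pow 2).const_mul 2).add continuous_const).intervalIntegrable _ _)
    have h1 : ρ / 2 ≤ ‖circleMap w ρ θ - z‖ := by
      have h2 : ‖circleMap w ρ θ - w‖ = ρ := by simp [abs_of_pos hρ]
      have h3 := mem_ball_iff_norm.mp hz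
      have h4 := norm_sub_le_norm_sub_add_norm_sub (circleMap w ρ θ) z w
      linarith
    rw [deriv_circleMap, norm_smul, norm_smul, norm_mul, norm_I, mul_one, norm_inv,
      norm_circleMap_zero, abs_of_pos hρ]
    have h5 : ρ * ‖circleMap w ρ θ - z‖⁻¹ ≤ 2 := by
      rw [← div_eq_mul_inv, div_le_iff₀ (by linarith)]
      linarith
    rw [← mul_assoc]
    have h6 := mul_le_mul_of_nonneg_right h5 (norm_nonneg (f (circleMap w ρ θ)))
    nlinarith [sq_nonneg (2 * ‖f (circleMap w ρ θ)‖ - 1)]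
  rw [intervalIntegral.integral_of_le (by positivity), integral_add (hinteg.const_mul 2)
    (integrable_const _), integral_const_mul] at hle
  simp only [integral_const, measureReal_restrict_apply MeasurableSet.univ, Set.univ_inter,
    Real.volume_real_Ioc_of_le (show (0 : ℝ) ≤ 2 * Real.pi by positivity), sub_zero,
    smul_eq_mul] at hle
  rw [← hcauchy, norm_smul, norm_inv] at hfz
  have h2pi : ‖(2 * Real.pi * I : ℂ)‖ = 2 * Real.pi := by simp [hpi.le]
  rw [h2pi, le_inv_mul_iff₀ (by positivity)] at hfz
  simp only [smul_eq_mul] at hfz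
  linarith

theorem measurable_lintegral_circleMap {f : ℂ → ℂ} (hf : Measurable f) (ρ : ℝ) :
    Measurable (fun p : ℝ × ℝ ↦ ENNReal.ofReal (‖f (circleMap (1 + p.1 * I) ρ p.2)‖ ^ 2)) := by
  have : Measurable fun p : ℝ × ℝ ↦ circleMap (1 + p.1 * I) ρ p.2 := by
    unfold circleMap
    fun_prop
  exact ((hf.comp this).norm.pow_const 2).ennreal_ofReal

theorem circleMap_one_add_mul_I (t ρ θ : ℝ) :
    circleMap (1 + t * I) ρ θ =
      (1 + ρ * Real.cos θ : ℝ) + (t + ρ * Real.sin θ : ℝ) * I := by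
  rw [circleMap, exp_mul_I]
  push_cast
  ring

theorem lintegral_lintegral_circleMap_le {f : ℂ → ℂ} (hf : Measurable f) {ρ T : ℝ} (hρ : 0 ≤ ρ)
    (hρ1 : ρ ≤ 1) {W : ENNReal}
    (hW : ∀ σ : ℝ, |σ - 1| ≤ ρ → ∫⁻ t in Set.Icc (T - 1) (2 * T + 1),
      ENNReal.ofReal (‖f (σ + t * I)‖ ^ 2) ≤ W) :
    ∫⁻ t in Set.Icc T (2 * T), ∫⁻ θ in Set.Ioc 0 (2 * Real.pi),
      ENNReal.ofReal (‖f (circleMap (1 + t * I) ρ θ)‖ ^ 2) ≤ W * ENNReal.ofReal (2 * Real.pi) := by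
  rw [lintegral_lintegral_swap (measurable_lintegral_circleMap hf ρ).aemeasurable]
  calc _ ≤ ∫⁻ θ in Set.Ioc 0 (2 * Real.pi), W := by
        refine lintegral_mono fun θ ↦ ?_
        have hcos : |ρ * Real.cos θ| ≤ ρ := by
          rw [abs_mul, abs_of_nonneg hρ]
          exact mul_le_of_le_one_right hρ (Real.abs_cos_le_one θ)
        have hsin : |ρ * Real.sin θ| ≤ 1 := by
          rw [abs_mul, abs_of_nonneg hρ]
          nlinarith [Real.abs_sin_le_one θ, abs_nonneg (Real.sin θ)]
        refine le_trans ?_ (hW (1 + ρ * Real.cos θ) (by rwa [add_sub_cancel_left]))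
        simp_rw [circleMap_one_add_mul_I]
        set g : ℝ → ENNReal := fun t ↦
          ENNReal.ofReal (‖f ((1 + ρ * Real.cos θ : ℝ) + t * I)‖ ^ 2)
        rw [← lintegral_indicator measurableSet_Icc, ← lintegral_indicator measurableSet_Icc,
          ← lintegral_add_right_eq_self (Set.indicator (Set.Icc (T - 1) (2 * T + 1)) g)
            (ρ * Real.sin θ)]
        refine lintegral_mono fun t ↦ ?_
        by_cases ht : t ∈ Set.Icc T (2 * T)
        swap
        · rw [Set.indicator_of_notMem ht]
          exact zero_le
        rw [Set.indicator_of_mem ht]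
        obtain ⟨h1, h2⟩ := abs_le.mp hsin
        rw [Set.indicator_of_mem (show t + ρ * Real.sin θ ∈ Set.Icc (T - 1) (2 * T + 1) from
          ⟨by linarith [ht.1], by linarith [ht.2]⟩)]
    _ = _ := by rw [setLIntegral_const, Real.volume_Ioc, sub_zero]

/-- A function which is small in mean square near the line `re s = 1` is rarely large near a point
of this line. -/
theorem exists_measurableSet_forall_norm_lt_one {f : ℂ → ℂ}
    (hf : ∀ s ≠ 1, DifferentiableAt ℂ f s) {ρ T W : ℝ} (hρ : 0 < ρ) (hρ1 : ρ ≤ 1) (hT : 2 ≤ T)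
    (hW0 : 0 ≤ W) (hW : ∀ σ : ℝ, |σ - 1| ≤ ρ → ∫⁻ t in Set.Icc (T - 1) (2 * T + 1),
      ENNReal.ofReal (‖f (σ + t * I)‖ ^ 2) ≤ ENNReal.ofReal W) :
    ∃ E : Set ℝ, MeasurableSet E ∧ E ⊆ Set.Icc T (2 * T) ∧ volume E ≤ ENNReal.ofReal (4 * W) ∧
      ∀ t ∈ Set.Icc T (2 * T) \ E, ∀ z ∈ Metric.ball (1 + t * I : ℂ) (ρ / 2), ‖f z‖ < 1 := by
  have hpi := Real.pi_pos
  have hfm : Measurable f := measurable_of_continuousOn_compl_singleton 1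
    fun s hs ↦ (hf s hs).continuousAt.continuousWithinAt
  set J : ℝ → ENNReal := fun t ↦ ∫⁻ θ in Set.Ioc 0 (2 * Real.pi),
      ENNReal.ofReal (‖f (circleMap (1 + t * I) ρ θ)‖ ^ 2)
  have hJ : Measurable J := (measurable_lintegral_circleMap hfm ρ).lintegral_prod_right'
  have hE : MeasurableSet {t | ENNReal.ofReal (Real.pi / 2) ≤ J t} := measurableSet_le
    measurable_const hJ
  refine ⟨Set.Icc T (2 * T) ∩ {t | ENNReal.ofReal (Real.pi / 2) ≤ J t},
    measurableSet_Icc.inter hE, Set.inter_subset_left, ?_, fun t ht z hz ↦ ?_⟩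
  · have h1 := mul_meas_ge_le_lintegral (μ := volume.restrict (Set.Icc T (2 * T))) hJ
      (ENNReal.ofReal (Real.pi / 2))
    rw [Measure.restrict_apply hE, Set.inter_comm] at h1
    have h2 := h1.trans (lintegral_lintegral_circleMap_le hfm hρ.le hρ1 hW)
    rw [mul_comm, ← ENNReal.le_div_iff_mul_le (Or.inl (by simpa using hpi))
      (Or.inl ENNReal.ofReal_ne_top), ← ENNReal.ofReal_mul hW0,
      ← ENNReal.ofReal_div_of_pos (by positivity)] at h2
    refine h2.trans (ENNReal.ofReal_le_ofReal (le_of_eq ?_))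
    field_simp
    norm_num
  · by_contra! hfz
    refine ht.2 ⟨ht.1, ?_⟩
    have hne : ∀ w ∈ Metric.closedBall (1 + t * I : ℂ) ρ, w ≠ 1 := fun w hw h1 ↦ by
      rw [h1, mem_closedBall_iff_norm] at hw
      have h2 := (abs_im_le_norm _).trans hw
      have h3 : (1 - (1 + t * I) : ℂ).im = -t := by simp
      rw [h3, abs_neg, abs_of_nonneg (by linarith [ht.1.1])] at h2
      linarith [ht.1.1]
    obtain ⟨h1, h2⟩ := pi_div_two_le_integral_circleMap hρ
      (fun w hw ↦ (hf w (hne w hw)).differentiableWithinAt) hz hfz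
    change ENNReal.ofReal (Real.pi / 2) ≤ J t
    simp only [J]
    rw [← ofReal_integral_eq_lintegral_ofReal h1 (Eventually.of_forall fun θ ↦ by positivity)]
    exact ENNReal.ofReal_le_ofReal h2

variable {r m Λ : ℕ → ℝ} {κ δ C : ℝ} {Z : ℂ → ℂ}

theorem exists_norm_inv_le_loglog (hr : ∀ n, 0 ≤ r n) (hr1 : r 1 = 1) (hm : ∀ n, |m n| ≤ r n)
    (hrm : ∀ n ≠ 0, ∑ x ∈ n.divisorsAntidiagonal, r x.1 * m x.2 = if n = 1 then 1 else 0)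
    (hΛ : ∀ n, 0 ≤ Λ n) (hΛr : ∀ n, Λ n ≤ r n * Real.log n)
    (hrΛ : ∀ n ≠ 0, ∑ x ∈ n.divisorsAntidiagonal, r x.1 * Λ x.2 = r n * Real.log n)
    (hrε : ∀ η > (0 : ℝ), ∃ D > (0 : ℝ), ∀ n : ℕ, r n ≤ D * (n : ℝ) ^ η)
    (hrr : ∀ η > (0 : ℝ), ∃ D > (0 : ℝ), ∀ n : ℕ,
      ∑ x ∈ n.divisorsAntidiagonal, r x.1 * r x.2 ≤ D * (n : ℝ) ^ η)
    (hκ : 0 < κ) (hδ₀ : 0 < δ) (hδ : δ ≤ 1)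
    (hC : 0 ≤ C) (h : ∀ x : ℝ, 1 ≤ x → |summatory r x - κ * x| ≤ C * x ^ (1 - δ))
    (hZ : ∀ s ≠ 1, DifferentiableAt ℂ Z s)
    (hZr : ∀ s : ℂ, 1 < s.re → Z s = LSeries (fun n ↦ (r n : ℂ)) s) {ε : ℝ} (hε : 0 < ε) :
    ∃ C' : ℝ, 0 < C' ∧ ∀ᶠ T : ℝ in atTop, ∃ E : Set ℝ,
      MeasurableSet E ∧ E ⊆ Set.Icc T (2 * T) ∧ volume E ≤ ENNReal.ofReal (T ^ ε) ∧
      ∀ t ∈ Set.Icc T (2 * T) \ E,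
        Z (1 + t * I) ≠ 0 ∧ ‖Z (1 + t * I)‖⁻¹ ≤ C' * Real.log (Real.log T) := by
  obtain ⟨A, hA, hAb⟩ := exists_bounds_of_one_lt_re hr hr1 hm hrm hΛ hΛr hrΛ hκ hδ₀ hδ hC h hZ hZr
  obtain ⟨ρ, hρ, hρδ, B, hB, hmoll⟩ := exists_lintegral_mul_mollifier_sub_one_le hr hm hrm hrε hrr
    hκ hδ₀ hδ hC h hZ hZr (half_pos hε) hδ₀
  set a : ℝ := ρ / 10 with ha_def
  have ha : 0 < a := by positivity
  obtain ⟨C₁, hC₁, L₀, hinv⟩ := exists_norm_inv_le_mul_log ha hA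
  refine ⟨C₁ * 2, by positivity, ?_⟩
  have ev1 : ∀ᶠ T : ℝ in atTop, 4 * B ≤ T ^ (ε / 2) :=
    (tendsto_rpow_atTop (half_pos hε)).eventually_ge_atTop _
  have ev2 : ∀ᶠ T : ℝ in atTop, max 2 L₀ ≤ Real.log T :=
    Real.tendsto_log_atTop.eventually_ge_atTop _
  filter_upwards [eventually_ge_atTop 3, eventually_ge_atTop (1 + κ + 16 * C / δ),
    eventually_ge_atTop (A / a), ev1, ev2] with T hT3 hTZ hTA hTB hTlog
  have hT0 : 0 < T := by linarith
  have hlog2 : 2 ≤ Real.log T := (le_max_left _ _).trans hTlog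
  have hlogL : L₀ ≤ Real.log T := (le_max_right _ _).trans hTlog
  have hexpL : Real.exp (2 * Real.log T) = T ^ 2 := by
    rw [mul_comm, Real.exp_mul, Real.exp_log hT0]
    exact_mod_cast Real.rpow_natCast T 2
  obtain ⟨M, hM, hMW⟩ := hmoll T hT3
  obtain ⟨E, hEm, hEsub, hEvol, hEt⟩ := exists_measurableSet_forall_norm_lt_one
    (f := fun s ↦ Z s * M s - 1) (fun s hs ↦ ((hZ s hs).mul (hM s)).sub_const 1) hρ
    (hρδ.trans hδ) (by linarith) (by positivity) hMW
  refine ⟨E, hEm, hEsub, hEvol.trans (ENNReal.ofReal_le_ofReal ?_), fun t ht ↦ ?_⟩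
  · rw [← mul_assoc, ← add_halves ε, Real.rpow_add hT0, add_halves]
    exact mul_le_mul_of_nonneg_right hTB (by positivity)
  have hsmall := hEt t ht
  obtain ⟨ht1, ht2⟩ := ht.1
  have hnz : ∀ z ∈ Metric.ball (1 + t * I : ℂ) (ρ / 2), Z z ≠ 0 := fun z hz h0 ↦ by
    have := hsmall z hz
    rw [h0, zero_mul, zero_sub, norm_neg, norm_one] at this
    exact lt_irrefl _ this
  have hsub : Metric.ball (1 + a + t * I : ℂ) (4 * a) ⊆ Metric.ball (1 + t * I : ℂ) (ρ / 2) := by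
    refine Metric.ball_subset_ball' ?_
    rw [dist_eq_norm, show (1 + a + t * I : ℂ) - (1 + t * I) = a by ring, norm_real,
      Real.norm_of_nonneg ha.le]
    linarith
  have hmem : ∀ z ∈ Metric.ball (1 + t * I : ℂ) (ρ / 2),
      |z.re - 1| < δ / 2 ∧ |z.im - t| < 1 / 2 := fun z hz ↦ by
    have hz' := mem_ball_iff_norm.mp hz
    have h1 := (abs_re_le_norm _).trans_lt hz'
    have h2 := (abs_im_le_norm _).trans_lt hz'
    have e1 : (z - (1 + t * I)).re = z.re - 1 := by simp
    have e2 : (z - (1 + t * I)).im = z.im - t := by simp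
    rw [e1] at h1
    rw [e2] at h2
    exact ⟨by linarith, by linarith⟩
  refine ⟨hnz _ (Metric.mem_ball_self (by positivity)), ?_⟩
  have hfinal := hinv (2 * Real.log T) (by linarith) Z t (fun z hz ↦ ?_)
    (fun z hz ↦ hnz z (hsub hz)) (fun z hz ↦ ?_) ?_ (fun z hz hz1 ↦ ?_)
  · rw [norm_inv] at hfinal
    refine hfinal.trans ?_
    rw [mul_assoc]
    refine mul_le_mul_of_nonneg_left ?_ hC₁.le
    rw [Real.log_mul two_ne_zero (by linarith), two_mul]
    exact add_le_add_left (Real.log_le_log two_pos hlog2) _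
  · have h2 := abs_lt.mp (hmem z (hsub hz)).2
    refine (hZ z fun h1 ↦ ?_).differentiableWithinAt
    rw [h1, one_im] at h2
    linarith
  · obtain ⟨h1, h2⟩ := hmem z (hsub hz)
    rw [abs_lt] at h1 h2
    have h3 := norm_sub_one_sub_le hr hr1 hδ₀ hδ hC h hZ hZr (s := z) (by linarith)
      (Or.inl (by linarith))
    have h4 : ‖z‖ ≤ 4 * T := by
      refine (norm_le_abs_re_add_abs_im z).trans ?_
      rw [abs_of_nonneg (by linarith), abs_of_nonneg (by linarith)]
      linarith
    have h5 : 1 ≤ ‖z - 1‖ := by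
      have := abs_im_le_norm (z - 1)
      rw [sub_im, one_im, sub_zero, abs_of_nonneg (by linarith)] at this
      linarith
    have h6 : ‖(κ : ℂ) / (z - 1)‖ ≤ κ := by
      rw [norm_div, norm_real, Real.norm_of_nonneg hκ.le]
      exact div_le_self hκ.le h5
    have h7 : ‖z‖ * (2 * C / (z.re - (1 - δ))) ≤ 4 * T * (2 * C / (δ / 2)) :=
      mul_le_mul h4 (div_le_div_of_nonneg_left (by positivity) (by positivity) (by linarith))
        (div_nonneg (by positivity) (by linarith)) (by positivity)
    have h8 : 4 * T * (2 * C / (δ / 2)) = 16 * C / δ * T := by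
      field_simp
      ring
    have h9 : ‖Z z‖ ≤ 1 + κ + 16 * C / δ * T := by
      calc ‖Z z‖ = ‖(Z z - 1 - κ / (z - 1)) + (1 + κ / (z - 1))‖ := by ring_nf
        _ ≤ 16 * C / δ * T + (1 + κ) := by
            refine (norm_add_le _ _).trans (add_le_add ((h3.trans h7).trans_eq h8)
              ((norm_add_le _ _).trans ?_))
            rw [norm_one]
            linarith
        _ = _ := by ring
    rw [hexpL]
    have : (1 + κ) * 1 ≤ (1 + κ) * T := mul_le_mul_of_nonneg_left (by linarith) (by linarith)
    nlinarith
  · have hcre : (1 + a + t * I : ℂ).re = 1 + a := by simp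
    obtain ⟨h0, h1, -⟩ := hAb (1 + a + t * I) (by linarith) (by linarith)
    rw [hcre, add_sub_cancel_left, norm_inv,
      inv_le_comm₀ (norm_pos_iff.mpr h0) (by positivity)] at h1
    refine le_trans ?_ h1
    rw [Real.exp_neg, hexpL]
    refine inv_anti₀ (by positivity) (hTA.trans ?_)
    nlinarith
  · obtain ⟨h1, -⟩ := hmem z (hsub hz)
    exact (hAb z hz1 (by linarith [abs_lt.mp h1])).2

end ExceptionalSet

/-- **Lemma.** For a number field `K` of degree `≥ 1` with Dedekind zeta function `ζK`
and fixed `ε > 0`, there is `C > 0` such that for all sufficiently large `T` there is a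
measurable set `E ⊆ [T, 2T]` of Lebesgue measure at most `T ^ ε` such that for every
`t ∈ [T, 2T] \ E` one has `ζK (1 + it) ≠ 0` and `|ζK (1 + it)|⁻¹ ≤ C · log log T`. -/
theorem inverse_dedekind_zeta_loglog_bound
    (K : Type) [Field K] [NumberField K] (hK : 1 ≤ Module.finrank ℚ K)
    (ζK : ℂ → ℂ)
    (hζK_holo : ∀ s : ℂ, s ≠ 1 → DifferentiableAt ℂ ζK s)
    (hζK_eq : ∀ s : ℂ, 1 < s.re → ζK s = LSeries (fun n => (rK K n : ℂ)) s)
    (ε : ℝ) (hε : 0 < ε) :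
    ∃ C : ℝ, 0 < C ∧ ∀ᶠ T : ℝ in atTop, ∃ E : Set ℝ,
      MeasurableSet E ∧ E ⊆ Set.Icc T (2 * T) ∧
      volume E ≤ ENNReal.ofReal (T ^ ε) ∧
      ∀ t ∈ Set.Icc T (2 * T) \ E,
        ζK (1 + t * Complex.I) ≠ 0 ∧
        ‖ζK (1 + t * Complex.I)‖⁻¹ ≤ C * Real.log (Real.log T) := by
  obtain ⟨κ, hκ, δ, hδ₀, hδ, C, hC, h⟩ := exists_abs_sum_rK_sub_le K
  refine exists_norm_inv_le_loglog (r := fun n ↦ (rK K n : ℝ)) (m := dedekindMoebius K)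
    (Λ := dedekindVonMangoldt K) (fun n ↦ Nat.cast_nonneg _) (by simp [rK_one])
    (abs_dedekindMoebius_le K) (fun n hn ↦ sum_rK_mul_dedekindMoebius K hn)
    (dedekindVonMangoldt_nonneg K) (dedekindVonMangoldt_le K)
    (fun n hn ↦ sum_rK_mul_dedekindVonMangoldt K hn) (fun η hη ↦ exists_rK_le K hη)
    (fun η hη ↦ exists_sum_rK_mul_rK_le K hη) hκ hδ₀ (by linarith) hC h hζK_holo
    (fun s hs ↦ ?_) hε
  simp only [hζK_eq s hs, ofReal_natCast]
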